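/- Let a<b be real numbers, let T: D_cdf([a,b]) → ℝ and a nonempty convex D ⊆ D_cdf([a,b]) satisfy the Lipschitz assumption with constant C>0 and the measurability assumption. Let {A₁,…,A_m} be a partition of {1,…,K} with m ≥ 2, let M_K = ∪_{j=1}^m M_{A_j,K} where each nonempty M_{A_j,K} ⊆ {δ∈S_K : δ_k = 0 if k∉A_j}, and assume M_K is closed with at least two elements. Consider the sequential elimination policy π̃ with finite discretization M_K^n = ∪_{j=1}^m M^n_{A_j,K}, ∅ ≠ M^n_{A_j,K} ⊆ M_{A_j,K}, elimination rounds R ⊆ {1,…,⌊n/2⌋}, and tuning parameter η>0, which: proceeds in rounds assigning each non-eliminated treatment once per round; after each completed round r ∈ R with at least two active groups, removes from the active part of each M^n_{A_j,K} every γ such that the maximum of T(⟨δ, F̂_{t,n}⟩) over active discretization points δ of the other groups exceeds T(⟨γ, F̂_{t,n}⟩) + u_η(r,n), where u_η(r,n) := C√( (1+η)/r · [0.5·log(n) + log(rK)] ) and F̂_{t,n} is the vector of empirical cdfs of the outcomes of subjects assigned to each treatment among the first t subjects; eliminates all treatments of group A_j once all points of M^n_{A_j,K} are removed; assigns any leftover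 subjects (fewer than the number of active treatments) to the smallest-indexed active treatments; and finally recommends the lexicographic minimum of the argmax of T(⟨δ, F̂_{n,n}⟩) over all remaining discretization points. Then for every n ≥ 2K: sup over all F¹,…,F^K ∈ D of E[r_n(π̃, M_K)] ≤ ε(n) + 4C√(K/n)·D_{n,K} + 4C·(K^{1−3η/(4+2η)}/√n)·(1+18.5·η^{-1})², where D_{n,K} := min( √(K·log(17K)), √(log(3.01·K(n+2))) ) and ε(n) := sup_{F∈D×…×D} | max_{δ∈M_K} T(⟨δ,F⟩) − max_{δ∈M_K^n} T(⟨δ,F⟩) |. -/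

import Mathlib

open MeasureTheory Set

noncomputable section

open scoped Classical

namespace TRDT

/-- `F` is a cumulative distribution function on `[a,b]`. -/
def IsCdfOn (a b : ℝ) (F : ℝ → ℝ) : Prop :=
  Monotone F ∧ (∀ x, ContinuousWithinAt F (Set.Ici x) x) ∧
    (∀ x, x < a → F x = 0) ∧ (∀ x, b ≤ x → F x = 1)

/-- Kolmogorov (supremum) distance `‖F - G‖_∞`. -/
def supDist (F G : ℝ → ℝ) : ℝ := ⨆ x : ℝ, |F x - G x|

/-- `|T F - T G| ≤ C ‖F - G‖_∞` for every `F ∈ D` and every cdf `G` on `[a,b]`. -/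
def LipschitzAssumption (a b : ℝ) (T : (ℝ → ℝ) → ℝ) (D : Set (ℝ → ℝ)) (C : ℝ) : Prop :=
  ∀ F ∈ D, ∀ G : ℝ → ℝ, IsCdfOn a b G → |T F - T G| ≤ C * supDist F G

/-- Assumption 5 of the paper: for every `m` and every `δ` in the standard simplex,
`x ↦ T(∑_j δ_j 1{x_j ≤ ·})` is Borel measurable on `[a,b]^m`. -/
def MeasurabilityAssumption (a b : ℝ) (T : (ℝ → ℝ) → ℝ) : Prop :=
  ∀ (m : ℕ) (δ : Fin m → ℝ), δ ∈ stdSimplex ℝ (Fin m) →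
    Measurable fun x : Fin m → Set.Icc a b =>
      T fun z => ∑ j, δ j * (if (x j : ℝ) ≤ z then (1 : ℝ) else 0)

/-- The mixture cdf `⟨δ, F⟩ = ∑ i δ_i F^i`. -/
def mix {K : ℕ} (δ : Fin K → ℝ) (F : Fin K → ℝ → ℝ) : ℝ → ℝ := fun x => ∑ i, δ i * F i x

/-- The lexicographic minimum of the set of maximizers of `f` over the finite set `S`
(empirical-success recommendation rule; ties are broken lexicographically). -/
def lexMinArgmax {K : ℕ} (S : Finset (Fin K → ℝ)) (f : (Fin K → ℝ) → ℝ) : Fin K → ℝ := by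
  haveI : WellFoundedLT (Fin K) := inferInstance
  exact if h : (S.filter fun δ => ∀ γ ∈ S, f γ ≤ f δ).Nonempty
    then ofLex (((S.filter fun δ => ∀ γ ∈ S, f γ ≤ f δ).image toLex).min' (h.image _))
    else fun _ => 0

/-- The worst-case optimization error `ε(n)` of the discretization `Mn` of `M`. -/
def epsOpt {K : ℕ} (T : (ℝ → ℝ) → ℝ) (D : Set (ℝ → ℝ)) (M : Set (Fin K → ℝ))
    (Mn : Finset (Fin K → ℝ)) : ℝ :=
  sSup {x : ℝ | ∃ G : Fin K → ℝ → ℝ, (∀ i, G i ∈ D) ∧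
    x = |sSup ((fun δ => T (mix δ G)) '' M)
          - sSup ((fun δ => T (mix δ G)) '' (Mn : Set (Fin K → ℝ)))|}

/-- `δ` puts weight only on treatments of group `j` (of the grouping `g`). -/
def GroupSupported {K m : ℕ} (g : Fin K → Fin m) (j : Fin m) (δ : Fin K → ℝ) : Prop :=
  ∀ i, g i ≠ j → δ i = 0

/-- The elimination threshold `u_η(r,n) = C√((1+η)/r·[0.5 log n + log(rK)])`. -/
def uEta (C η : ℝ) (r n K : ℕ) : ℝ :=
  C * Real.sqrt ((1 + η) / r * (0.5 * Real.log n + Real.log (r * K)))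

/-- The state of the sequential elimination policy: `t` = number of subjects assigned so
far, `times i` = (global) indices of the subjects assigned to treatment `i`, `act j` =
the not-yet-removed discretization points of group `j` (group `j`, and all its
treatments, is eliminated exactly when `act j = ∅`). -/
structure SEState (K m : ℕ) where
  t : ℕ
  times : Fin K → List ℕ
  act : Fin m → Finset (Fin K → ℝ)

/-- Empirical cdfs from the assignment-times record: `F̂_i` is the empirical cdf of the
outcomes `y s i` over the subjects `s` assigned to treatment `i`. -/
def empOf {K : ℕ} (y : ℕ → Fin K → ℝ) (times : Fin K → List ℕ) : Fin K → ℝ → ℝ :=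
  fun i z => (((times i).map fun s => if y s i ≤ z then (1 : ℝ) else 0).sum)
    / (times i).length

/-- One iteration of the while-loop of the sequential elimination policy (Policy 3): if
enough subjects remain, each active treatment is assigned once (in increasing index
order), completing round `r+1`; if `r+1` is an elimination round and at least two groups
are active, every point `γ` of a group `j` is removed whose plug-in value is worse by
more than `u_η(r+1,n)` than the best plug-in value among the other groups' active
points. -/
def seStep {K m : ℕ} (g : Fin K → Fin m) (T : (ℝ → ℝ) → ℝ) (C η : ℝ) (n : ℕ)
    (R : Finset ℕ) (y : ℕ → Fin K → ℝ) (r : ℕ) (S : SEState K m) : SEState K m :=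
  let I : Finset (Fin K) := Finset.univ.filter fun i => (S.act (g i)).Nonempty
  if I.card ≤ n - S.t then
    let newtimes : Fin K → List ℕ := fun i =>
      if i ∈ I then S.times i ++ [S.t + (I.filter (· < i)).card] else S.times i
    let Fhat := empOf y newtimes
    let J : Finset (Fin m) := Finset.univ.filter fun j => (S.act j).Nonempty
    if (r + 1) ∈ R ∧ 2 ≤ J.card then
      { t := S.t + I.card, times := newtimes,
        act := fun j => (S.act j).filter fun γ =>
          ¬ (sSup ((fun δ => T (mix δ Fhat)) '' (⋃ l ∈ J.erase j, ↑(S.act l)))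
              > T (mix γ Fhat) + uEta C η (r + 1) n K) }
    else
      { t := S.t + I.card, times := newtimes, act := S.act }
  else S

/-- The state of the sequential elimination policy after (at most) `r` rounds, started
from the per-group discretization sets `Mn_j = {δ ∈ Mn : δ supported in group j}`. -/
def seRun {K m : ℕ} (g : Fin K → Fin m) (T : (ℝ → ℝ) → ℝ) (C η : ℝ) (n : ℕ)
    (R : Finset ℕ) (Mn : Finset (Fin K → ℝ)) (y : ℕ → Fin K → ℝ) : ℕ → SEState K m
  | 0 => ⟨0, fun _ => [], fun j => Mn.filter fun δ => GroupSupported g j δ⟩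
  | r + 1 => seStep g T C η n R y r (seRun g T C η n R Mn y r)

/-- The assignment-times record after also assigning the leftover subjects (fewer than
the number of active treatments) to the smallest-indexed active treatments. -/
def seFinalTimes {K m : ℕ} (g : Fin K → Fin m) (n : ℕ) (S : SEState K m) :
    Fin K → List ℕ :=
  let I : Finset (Fin K) := Finset.univ.filter fun i => (S.act (g i)).Nonempty
  fun i =>
    if i ∈ I ∧ (I.filter (· < i)).card < n - S.t then
      S.times i ++ [S.t + (I.filter (· < i)).card]
    else S.times i

/-- The final recommendation of the sequential elimination policy on the outcome array
`y`: the lexicographically smallest maximizer of `δ ↦ T(⟨δ, F̂_{n,n}⟩)` over all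
remaining discretization points. -/
def seRecommendation {K m : ℕ} (g : Fin K → Fin m) (T : (ℝ → ℝ) → ℝ) (C η : ℝ) (n : ℕ)
    (R : Finset ℕ) (Mn : Finset (Fin K → ℝ)) (y : ℕ → Fin K → ℝ) : Fin K → ℝ :=
  let S := seRun g T C η n R Mn y n
  lexMinArgmax (Finset.univ.biUnion S.act)
    (fun δ => T (mix δ (empOf y (seFinalTimes g n S))))

/-- Extension of a finite outcome array to all of `ℕ` (junk value `0` beyond `n`). -/
def Yext {K n : ℕ} (y : Fin n → Fin K → ℝ) : ℕ → Fin K → ℝ :=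
  fun t => if h : t < n then y ⟨t, h⟩ else fun _ => 0

/-! ### Finite-alphabet expectation, Doob's inequality and Hoeffding -/

/-- Expectation of `f` over `r` independent draws from the finite weights `p`. -/
def Ex {α : Type} [Fintype α] (p : α → ℝ) (r : ℕ) (f : (Fin r → α) → ℝ) : ℝ :=
  ∑ v : Fin r → α, (∏ j, p (v j)) * f v

lemma Ex_mono {α : Type} [Fintype α] {p : α → ℝ} (hp : ∀ c, 0 ≤ p c) {r : ℕ}
    {f f' : (Fin r → α) → ℝ} (h : ∀ v, f v ≤ f' v) : Ex p r f ≤ Ex p r f' :=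
  Finset.sum_le_sum fun v _ => mul_le_mul_of_nonneg_left (h v)
    (Finset.prod_nonneg fun _ _ => hp _)

lemma Ex_add {α : Type} [Fintype α] (p : α → ℝ) (r : ℕ)
    (f f' : (Fin r → α) → ℝ) : Ex p r (fun v => f v + f' v) = Ex p r f + Ex p r f' := by
  simp [Ex, mul_add, Finset.sum_add_distrib]

lemma Ex_mul {α : Type} [Fintype α] (p : α → ℝ) (r : ℕ) (c : ℝ)
    (f : (Fin r → α) → ℝ) : Ex p r (fun v => c * f v) = c * Ex p r f := by
  simp only [Ex, Finset.mul_sum]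
  exact Finset.sum_congr rfl fun v _ => by ring

lemma Ex_sum {α : Type} [Fintype α] (p : α → ℝ) (r : ℕ) {ι : Type} (s : Finset ι)
    (f : ι → (Fin r → α) → ℝ) :
    Ex p r (fun v => ∑ i ∈ s, f i v) = ∑ i ∈ s, Ex p r (f i) := by
  simp only [Ex, Finset.mul_sum]
  exact Finset.sum_comm

lemma Ex_prod {α : Type} [Fintype α] (p : α → ℝ) (r : ℕ) (f : α → ℝ) :
    Ex p r (fun v => ∏ j, f (v j)) = (∑ c, p c * f c) ^ r := by
  have h := Finset.prod_univ_sum (ι := Fin r) (fun _ => (Finset.univ : Finset α))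
    (fun _ c => p c * f c)
  simp only [Finset.prod_const, Finset.card_univ, Fintype.card_fin, Fintype.piFinset_univ] at h
  rw [h]
  simp [Ex, Finset.prod_mul_distrib]

lemma Ex_one {α : Type} [Fintype α] {p : α → ℝ} (hs : ∑ c, p c = 1) (r : ℕ) :
    Ex p r (fun _ => 1) = 1 := by
  have := Ex_prod p r (fun _ => 1)
  simpa [hs] using this

lemma Ex_coord {α : Type} [Fintype α] (p : α → ℝ) (r : ℕ) (j : Fin (r + 1))
    (f : (Fin (r + 1) → α) → ℝ) :
    Ex p (r + 1) f
      = ∑ w : Fin r → α, (∏ i, p (w i)) * ∑ c, p c * f (Fin.insertNth j c w) := by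
  unfold Ex
  rw [← (Fin.insertNthEquiv (fun _ => α) j).sum_comp, Fintype.sum_prod_type, Finset.sum_comm]
  refine Finset.sum_congr rfl fun w _ => ?_
  rw [Finset.mul_sum]
  refine Finset.sum_congr rfl fun c _ => ?_
  rw [Fin.prod_univ_succAbove _ j]
  simp [Fin.insertNthEquiv]
  ring

lemma Ex_coord_zero {α : Type} [Fintype α] (p : α → ℝ) (r : ℕ) (j : Fin r)
    (h : (Fin r → α) → ℝ) (d : α → ℝ) (A : α → Prop)
    (hd : ∀ c, ¬ A c → d c = 0) (hsum : ∑ c, p c * d c = 0)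
    (hh : ∀ v v' : Fin r → α, A (v j) → A (v' j) → (∀ i, i ≠ j → v i = v' i) → h v = h v') :
    Ex p r (fun v => h v * d (v j)) = 0 := by
  cases r with
  | zero => exact j.elim0
  | succ r =>
    rw [Ex_coord p r j]
    refine Finset.sum_eq_zero fun w _ => ?_
    have : ∑ c, p c * (h (Fin.insertNth j c w) * d ((Fin.insertNth j c w : Fin (r+1) → α) j)) = 0 := by
      by_cases hA : ∃ c0, A c0
      · obtain ⟨c0, hc0⟩ := hA
        have : ∀ c, p c * (h (Fin.insertNth j c w) * d ((Fin.insertNth j c w : Fin (r+1) → α) j))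
            = h (Fin.insertNth j c0 w) * (p c * d c) := by
          intro c
          by_cases hc : A c
          · rw [hh (Fin.insertNth j c w) (Fin.insertNth j c0 w) (by simpa using hc)
              (by simpa using hc0)]
            · simp; ring
            · intro i hi
              obtain ⟨k, rfl⟩ := Fin.exists_succAbove_eq hi
              simp
          · simp [hd c hc]
        rw [Finset.sum_congr rfl fun c _ => this c, ← Finset.mul_sum, hsum, mul_zero]
      · push Not at hA
        refine Finset.sum_eq_zero fun c _ => by simp [hd c (hA c)]
    rw [this, mul_zero]

/-- Running maximum. -/
def runMax (X : ℕ → ℝ) : ℕ → ℝ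
  | 0 => X 0
  | k + 1 => max (runMax X k) (X (k + 1))

lemma le_runMax (X : ℕ → ℝ) {k N : ℕ} (h : k ≤ N) : X k ≤ runMax X N := by
  induction N with
  | zero => obtain rfl : k = 0 := by omega
            exact le_refl _
  | succ N ih =>
    rcases Nat.lt_or_ge N k with h1 | h1
    · obtain rfl : k = N + 1 := by omega
      exact le_max_right _ _
    · exact (ih h1).trans (le_max_left _ _)

lemma runMax_congr {X X' : ℕ → ℝ} {N : ℕ} (h : ∀ k ≤ N, X k = X' k) :
    runMax X N = runMax X' N := by
  induction N with
  | zero => exact h 0 le_rfl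
  | succ N ih =>
    simp only [runMax]
    rw [ih fun k hk => h k (by omega), h (N + 1) le_rfl]

lemma runMax_sq_le (X : ℕ → ℝ) (N : ℕ) :
    runMax X N ^ 2 ≤ 4 * X N ^ 2 - 4 * ∑ k ∈ Finset.range N, runMax X k * (X (k + 1) - X k) := by
  have key : 0 ≤ runMax X N * X N - 1 / 2 * runMax X N ^ 2
      - ∑ k ∈ Finset.range N, runMax X k * (X (k + 1) - X k) := by
    induction N with
    | zero => simp [runMax]; nlinarith [sq_nonneg (X 0)]
    | succ N ih =>
      rw [Finset.sum_range_succ]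
      simp only [runMax]
      rcases le_total (X (N + 1)) (runMax X N) with h | h
      · rw [max_eq_left h]; nlinarith
      · rw [max_eq_right h]; nlinarith [sq_nonneg (X (N + 1) - runMax X N)]
  nlinarith [sq_nonneg (runMax X N - 2 * X N)]

/-- Probability of the set `A`. -/
def prA {α : Type} [Fintype α] (p : α → ℝ) (A : α → Prop) : ℝ :=
  ∑ c, p c * (if A c then 1 else 0)

/-- Normalized martingale summand. -/
def mA {α : Type} [Fintype α] (p : α → ℝ) (A : α → Prop) (c : α) : ℝ :=
  (if A c then 1 else 0) / prA p A - 1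

lemma doob_chain {α : Type} [Fintype α] {p : α → ℝ} (hp : ∀ c, 0 ≤ p c) (r : ℕ)
    (A : ℕ → α → Prop) (hA : ∀ k c, A (k + 1) c → A k c) (N : ℕ)
    (hq : ∀ k ≤ N, prA p (A k) ≠ 0) (θ : ℝ) :
    Ex p r (fun v => runMax (fun k => Real.exp (θ * ∑ j, mA p (A k) (v j))) N ^ 2)
      ≤ 4 * Ex p r (fun v => Real.exp (2 * θ * ∑ j, mA p (A N) (v j))) := by
  set X : (Fin r → α) → ℕ → ℝ := fun v k => Real.exp (θ * ∑ j, mA p (A k) (v j)) with hX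
  have hAm : ∀ k l c, l ≤ k → A k c → A l c := by
    intro k l c hl h
    induction k with
    | zero => obtain rfl : l = 0 := by omega
              exact h
    | succ k ih =>
      rcases Nat.lt_or_ge k l with h1 | h1
      · obtain rfl : l = k + 1 := by omega
        exact h
      · exact ih h1 (hA k c h)
  have hinc : ∀ k < N, 0 ≤ Ex p r (fun v => runMax (X v) k * (X v (k + 1) - X v k)) := by
    intro k hk
    have h1 : Ex p r (fun v => ∑ j ∈ Finset.univ, (θ * (runMax (X v) k * X v k)) *
        (mA p (A (k + 1)) (v j) - mA p (A k) (v j))) = 0 := by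
      rw [Ex_sum]
      refine Finset.sum_eq_zero fun j _ => ?_
      refine Ex_coord_zero p r j (fun v => θ * (runMax (X v) k * X v k))
        (fun c => mA p (A (k + 1)) c - mA p (A k) c) (A k) ?_ ?_ ?_
      · intro c hc
        have : ¬ A (k + 1) c := fun h => hc (hA k c h)
        simp [mA, hc, this]
      · have e1 : ∀ l ≤ N, ∑ c, p c * mA p (A l) c = 1 - ∑ c, p c := by
          intro l hl
          simp only [mA, mul_sub, mul_one, Finset.sum_sub_distrib]
          congr 1
          simp_rw [← mul_div_assoc]
          rw [← Finset.sum_div]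
          exact div_self (hq l hl)
        simp only [mul_sub, Finset.sum_sub_distrib]
        rw [e1 _ hk, e1 _ hk.le, sub_self]
      · intro v v' hv hv' hvv
        have hXX : ∀ l ≤ k, X v l = X v' l := by
          intro l hl
          simp only [hX]
          congr 2
          refine Finset.sum_congr rfl fun i _ => ?_
          by_cases hi : i = j
          · subst hi
            simp [mA, hAm k l _ hl hv, hAm k l _ hl hv']
          · rw [hvv i hi]
        rw [runMax_congr hXX, hXX k le_rfl]
    rw [← h1]
    refine Ex_mono hp fun v => ?_
    rw [← Finset.mul_sum, Finset.sum_sub_distrib]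
    set a := ∑ j, mA p (A k) (v j)
    set b := ∑ j, mA p (A (k + 1)) (v j)
    have hx : X v (k + 1) - X v k ≥ X v k * (θ * (b - a)) := by
      have : X v (k + 1) = X v k * Real.exp (θ * (b - a)) := by
        simp only [hX]
        rw [← Real.exp_add]
        congr 1; ring
      rw [this]
      have h2 := Real.add_one_le_exp (θ * (b - a))
      have h3 : 0 < X v k := Real.exp_pos _
      nlinarith
    have hS : 0 ≤ runMax (X v) k := (Real.exp_pos _).le.trans (le_runMax (X v) (le_refl k))
    calc θ * (runMax (X v) k * X v k) * (b - a) = runMax (X v) k * (X v k * (θ * (b - a))) := by ring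
      _ ≤ _ := mul_le_mul_of_nonneg_left hx hS
  calc Ex p r (fun v => runMax (X v) N ^ 2)
      ≤ Ex p r (fun v => 4 * X v N ^ 2 +
          (-4) * ∑ k ∈ Finset.range N, runMax (X v) k * (X v (k + 1) - X v k)) := by
        refine Ex_mono hp fun v => ?_
        linarith [runMax_sq_le (X v) N]
    _ = 4 * Ex p r (fun v => X v N ^ 2) +
          (-4) * ∑ k ∈ Finset.range N, Ex p r (fun v => runMax (X v) k * (X v (k + 1) - X v k)) := by
        rw [Ex_add, Ex_mul, Ex_mul, Ex_sum]
    _ ≤ 4 * Ex p r (fun v => X v N ^ 2) := by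
        have := Finset.sum_nonneg fun k hk => hinc k (Finset.mem_range.1 hk)
        linarith
    _ = _ := by
        congr 2
        funext v
        simp only [hX]
        rw [← Real.exp_nat_mul]
        congr 1; push_cast; ring

lemma hoeffding_two (q t : ℝ) (h0 : 0 ≤ q) (h1 : q ≤ 1) :
    q * Real.exp (t * (1 - q)) + (1 - q) * Real.exp (-(t * q)) ≤ Real.exp (t ^ 2 / 8) := by
  let P : Measure ℝ := ENNReal.ofReal q • Measure.dirac 1 + ENNReal.ofReal (1 - q) • Measure.dirac 0
  have hint : ∀ f : ℝ → ℝ, ∫ x, f x ∂P = q * f 1 + (1 - q) * f 0 := by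
    intro f
    have i1 : Integrable f (ENNReal.ofReal q • Measure.dirac (1:ℝ)) :=
      (integrable_dirac (by simp)).smul_measure (by simp)
    have i2 : Integrable f (ENNReal.ofReal (1-q) • Measure.dirac (0:ℝ)) :=
      (integrable_dirac (by simp)).smul_measure (by simp)
    simp only [P]
    rw [integral_add_measure i1 i2, integral_smul_measure, integral_smul_measure]
    simp [ENNReal.toReal_ofReal, h0, sub_nonneg.2 h1]
  have : IsProbabilityMeasure P := ⟨by
    simp only [P]
    simp [← ENNReal.ofReal_add h0 (sub_nonneg.2 h1)]⟩
  have h := ProbabilityTheory.hasSubgaussianMGF_of_mem_Icc (μ := P) (X := fun x => x) (a := 0) (b := 1)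
    aemeasurable_id (by
      simp only [P]
      rw [ae_add_measure_iff]
      refine ⟨Measure.ae_smul_measure ?_ _, Measure.ae_smul_measure ?_ _⟩ <;>
      · rw [ae_dirac_eq]; simp)
  have h2 := h.mgf_le t
  rw [ProbabilityTheory.mgf, hint, hint] at h2
  norm_num at h2
  rw [show (1/4 : ℝ) * t^2/2 = t^2/8 by ring] at h2
  simpa using h2

lemma prA_nonneg {α : Type} [Fintype α] {p : α → ℝ} (hp : ∀ c, 0 ≤ p c) (A : α → Prop) :
    0 ≤ prA p A := Finset.sum_nonneg fun c _ => mul_nonneg (hp c) (by split_ifs <;> norm_num)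

lemma prA_le_one {α : Type} [Fintype α] {p : α → ℝ} (hp : ∀ c, 0 ≤ p c) (hs : ∑ c, p c = 1)
    (A : α → Prop) : prA p A ≤ 1 := by
  rw [← hs]
  exact Finset.sum_le_sum fun c _ => by
    have := hp c
    split_ifs <;> simp [this]

lemma hoeffding_fin {α : Type} [Fintype α] {p : α → ℝ} (hp : ∀ c, 0 ≤ p c) (hs : ∑ c, p c = 1)
    (A : α → Prop) (r : ℕ) (t : ℝ) :
    Ex p r (fun v => Real.exp (t * ∑ j, ((if A (v j) then 1 else 0) - prA p A)))
      ≤ Real.exp (r * t ^ 2 / 8) := by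
  have e : (fun v : Fin r → α => Real.exp (t * ∑ j, ((if A (v j) then 1 else 0) - prA p A)))
      = fun v => ∏ j, (fun c => Real.exp (t * ((if A c then 1 else 0) - prA p A))) (v j) := by
    funext v
    rw [Finset.mul_sum, Real.exp_sum]
  rw [e]
  refine (le_of_eq (Ex_prod p r
    (fun c => Real.exp (t * ((if A c then 1 else 0) - prA p A))))).trans ?_
  have e2 : Real.exp (r * t ^ 2 / 8) = Real.exp (t ^ 2 / 8) ^ r := by
    rw [← Real.exp_nat_mul]; congr 1; ring
  rw [e2]
  refine pow_le_pow_left₀ (Finset.sum_nonneg fun c _ => mul_nonneg (hp c) (Real.exp_pos _).le) ?_ r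
  refine le_trans (le_of_eq ?_) (hoeffding_two (prA p A) t (prA_nonneg hp A) (prA_le_one hp hs A))
  set q := prA p A with hq
  have : ∀ c, p c * Real.exp (t * ((if A c then 1 else 0) - q))
      = (p c * (if A c then 1 else 0)) * Real.exp (t * (1 - q))
        + (p c - p c * (if A c then 1 else 0)) * Real.exp (-(t * q)) := by
    intro c
    split_ifs <;> simp
  rw [Finset.sum_congr rfl fun c _ => this c, Finset.sum_add_distrib, ← Finset.sum_mul,
    ← Finset.sum_mul, Finset.sum_sub_distrib, hs]
  rw [← prA.eq_1]

/-- Maximal inequality over one bin of a decreasing chain of sets. -/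
lemma bin_bound {α : Type} [Fintype α] {p : α → ℝ} (hp : ∀ c, 0 ≤ p c) (hs : ∑ c, p c = 1)
    (r : ℕ) (A : ℕ → α → Prop) (hA : ∀ k c, A (k + 1) c → A k c) (N : ℕ) (ρ : ℝ)
    (hq0 : 0 < prA p (A N)) (hρ : prA p (A 0) ≤ ρ * prA p (A N)) (θ : ℝ) (hθ : 0 ≤ θ) :
    ∃ B : (Fin r → α) → ℝ, (∀ v, 0 ≤ B v) ∧
      Ex p r B ≤ 8 * Real.exp (r * (θ * ρ) ^ 2 / 8) ∧
      ∀ k ≤ N, ∀ v, Real.exp (θ * |∑ j, ((if A k (v j) then (1:ℝ) else 0) - prA p (A k))|) ≤ 1 + B v := by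
  have hmono : ∀ k l, k ≤ l → prA p (A l) ≤ prA p (A k) := by
    intro k l h
    induction l with
    | zero => obtain rfl : k = 0 := by omega
              exact le_rfl
    | succ l ih =>
      rcases Nat.lt_or_ge l k with h1 | h1
      · obtain rfl : k = l + 1 := by omega
        exact le_rfl
      · refine le_trans ?_ (ih h1)
        refine Finset.sum_le_sum fun c _ => mul_le_mul_of_nonneg_left ?_ (hp c)
        by_cases h2 : A (l + 1) c
        · simp [h2, hA l c h2]
        · simp only [h2, if_false]; split_ifs <;> norm_num
  have hqpos : ∀ k ≤ N, 0 < prA p (A k) := fun k hk => hq0.trans_le (hmono k N hk)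
  have hq00 := hqpos 0 (Nat.zero_le _)
  have hMD : ∀ k ≤ N, ∀ v : Fin r → α, ∑ j, ((if A k (v j) then (1:ℝ) else 0) - prA p (A k))
      = prA p (A k) * ∑ j, mA p (A k) (v j) := by
    intro k hk v
    rw [Finset.mul_sum]
    refine Finset.sum_congr rfl fun j _ => ?_
    have := (hqpos k hk).ne'
    rw [mA]; field_simp
  let φ : ℝ → (Fin r → α) → ℝ := fun s v =>
    runMax (fun k => Real.exp (s * ∑ j, mA p (A k) (v j))) N ^ 2
  set s := θ * prA p (A 0) / 2 with hsdef
  have hEx : ∀ σ : ℝ, |σ| = s → Ex p r (φ σ) ≤ 4 * Real.exp (r * (θ * ρ) ^ 2 / 8) := by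
    intro σ hσ
    refine (doob_chain hp r A hA N (fun k hk => (hqpos k hk).ne') σ).trans ?_
    refine mul_le_mul_of_nonneg_left ?_ (by norm_num)
    have h1 := hoeffding_fin hp hs (A N) r (2 * σ / prA p (A N))
    have e : (fun v : Fin r → α => Real.exp (2 * σ / prA p (A N) *
        ∑ j, ((if A N (v j) then (1:ℝ) else 0) - prA p (A N))))
        = fun v => Real.exp (2 * σ * ∑ j, mA p (A N) (v j)) := by
      funext v
      rw [hMD N le_rfl]
      congr 1
      field_simp
    rw [e] at h1
    refine h1.trans (Real.exp_le_exp.2 ?_)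
    have h2 : (2 * σ / prA p (A N)) ^ 2 ≤ (θ * ρ) ^ 2 := by
      rw [← sq_abs (2 * σ / prA p (A N))]
      refine pow_le_pow_left₀ (abs_nonneg _) ?_ 2
      rw [abs_div, abs_mul, hσ, abs_of_pos hq0, div_le_iff₀ hq0, hsdef]
      simp only [Nat.abs_ofNat]
      nlinarith
    have : (0:ℝ) ≤ r := Nat.cast_nonneg r
    have := mul_le_mul_of_nonneg_left h2 this
    linarith
  have hs0 : 0 ≤ s := by rw [hsdef]; positivity
  refine ⟨fun v => φ s v + φ (-s) v, fun v => by positivity, ?_, ?_⟩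
  · rw [Ex_add]
    linarith [hEx s (abs_of_nonneg hs0), hEx (-s) (by rw [abs_neg, abs_of_nonneg hs0])]
  · intro k hk v
    have hφ : ∀ σ : ℝ, Real.exp (2 * σ * ∑ j, mA p (A k) (v j)) ≤ φ σ v := by
      intro σ
      have h1 := le_runMax (fun k => Real.exp (σ * ∑ j, mA p (A k) (v j))) hk
      have h2 := pow_le_pow_left₀ (Real.exp_pos _).le h1 2
      refine le_trans (le_of_eq ?_) h2
      rw [← Real.exp_nat_mul]; congr 1; push_cast; ring
    have h0 : ∀ σ, 0 ≤ φ σ v := fun σ => sq_nonneg _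
    rw [hMD k hk v, abs_mul, abs_of_pos (hqpos k hk)]
    set m := ∑ j, mA p (A k) (v j) with hm
    have hqk := hmono 0 k (Nat.zero_le _)
    have hle : θ * (prA p (A k) * |m|) ≤ 2 * s * |m| := by
      rw [hsdef]
      have := abs_nonneg m
      have h3 : θ * prA p (A k) ≤ θ * prA p (A 0) := mul_le_mul_of_nonneg_left hqk hθ
      nlinarith
    refine (Real.exp_le_exp.2 hle).trans ?_
    rcases abs_cases m with ⟨h, _⟩ | ⟨h, _⟩
    · rw [h]; linarith [hφ s, h0 (-s)]
    · rw [h, show 2 * s * -m = 2 * (-s) * m by ring]; linarith [hφ (-s), h0 s]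

lemma chain_bound {α : Type} [Fintype α] {p : α → ℝ} (hp : ∀ c, 0 ≤ p c) (hs : ∑ c, p c = 1)
    (r : ℕ) (A : ℕ → α → Prop) (hA : ∀ k c, A (k + 1) c → A k c) (m Nb : ℕ) (ρ : ℝ)
    (hρ1 : 1 ≤ ρ) (hρ : 2 ≤ ρ ^ Nb) (θ : ℝ) (hθ : 0 ≤ θ) :
    ∃ B : (Fin r → α) → ℝ, (∀ v, 0 ≤ B v) ∧
      Ex p r B ≤ Nb * (8 * Real.exp (r * (θ * ρ) ^ 2 / 8)) ∧
      ∀ k ≤ m, 1 / 2 ≤ prA p (A k) → ∀ v,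
        Real.exp (θ * |∑ j, ((if A k (v j) then (1:ℝ) else 0) - prA p (A k))|) ≤ 1 + B v := by
  have hρ0 : 0 < ρ := by linarith
  have hbin : ∀ b : ℕ, ∃ B : (Fin r → α) → ℝ, (∀ v, 0 ≤ B v) ∧
      Ex p r B ≤ (8 * Real.exp (r * (θ * ρ) ^ 2 / 8)) ∧
      ∀ k ≤ m, 1 ≤ ρ ^ (b + 1) * prA p (A k) → ρ ^ b * prA p (A k) ≤ 1 → ∀ v,
        Real.exp (θ * |∑ j, ((if A k (v j) then (1:ℝ) else 0) - prA p (A k))|) ≤ 1 + B v := by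
    intro b
    set I : Finset ℕ := (Finset.range (m + 1)).filter fun k =>
      1 ≤ ρ ^ (b + 1) * prA p (A k) ∧ ρ ^ b * prA p (A k) ≤ 1 with hI
    by_cases hne : I.Nonempty
    · set k0 := I.min' hne
      set k1 := I.max' hne
      have h0 : k0 ∈ I := I.min'_mem hne
      have h1 : k1 ∈ I := I.max'_mem hne
      have h01 : k0 ≤ k1 := I.min'_le _ h1
      rw [hI, Finset.mem_filter] at h0 h1
      have hpow : 0 < ρ ^ b := pow_pos hρ0 b
      obtain ⟨B, hB0, hB1, hB2⟩ := bin_bound hp hs r (fun i => A (k0 + i))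
        (fun k c h => hA (k0 + k) c h) (k1 - k0) ρ
        (by
          rw [show k0 + (k1 - k0) = k1 by omega]
          by_contra hcon
          have : ρ ^ (b + 1) * prA p (A k1) ≤ 0 :=
            mul_nonpos_of_nonneg_of_nonpos (by positivity) (not_lt.1 hcon)
          linarith [h1.2.1])
        (by
          rw [show k0 + (k1 - k0) = k1 by omega, Nat.add_zero]
          have e := h0.2.2.trans h1.2.1
          rw [pow_succ, mul_assoc] at e
          exact le_of_mul_le_mul_left e hpow) θ hθ
      refine ⟨B, hB0, hB1, fun k hk hk1 hk2 v => ?_⟩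
      have hkI : k ∈ I := by
        rw [hI, Finset.mem_filter]
        exact ⟨Finset.mem_range.2 (by omega), hk1, hk2⟩
      have ha : k0 ≤ k := I.min'_le _ hkI
      have hb : k ≤ k1 := I.le_max' _ hkI
      have := hB2 (k - k0) (by omega) v
      simpa only [show k0 + (k - k0) = k by omega] using this
    · refine ⟨fun _ => 0, fun _ => le_rfl, ?_, fun k hk hk1 hk2 => ?_⟩
      · have : Ex p r (fun _ => (0:ℝ)) = 0 := by simp [Ex]
        rw [this]; positivity
      · exact absurd ⟨k, by
          rw [hI, Finset.mem_filter]
          exact ⟨Finset.mem_range.2 (by omega), hk1, hk2⟩⟩ hne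
  choose B hB0 hB1 hB2 using hbin
  refine ⟨fun v => ∑ b ∈ Finset.range Nb, B b v,
    fun v => Finset.sum_nonneg fun b _ => hB0 b v, ?_, ?_⟩
  · rw [Ex_sum]
    refine (Finset.sum_le_sum fun b _ => hB1 b).trans ?_
    simp
  · intro k hk hq v
    have hex : ∃ b : ℕ, 1 ≤ ρ ^ (b + 1) * prA p (A k) ∧ b < Nb := by
      cases Nb with
      | zero => norm_num at hρ
      | succ N => exact ⟨N, by nlinarith, by omega⟩
    have hex' : ∃ b : ℕ, 1 ≤ ρ ^ (b + 1) * prA p (A k) := ⟨_, hex.choose_spec.1⟩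
    set b := Nat.find hex'
    have hb1 : 1 ≤ ρ ^ (b + 1) * prA p (A k) := Nat.find_spec hex'
    have hbN : b < Nb := (Nat.find_min' hex' hex.choose_spec.1).trans_lt hex.choose_spec.2
    have hb2 : ρ ^ b * prA p (A k) ≤ 1 := by
      rcases Nat.eq_zero_or_pos b with h | h
      · rw [h]; simpa using prA_le_one hp hs (A k)
      · have := Nat.find_min hex' (show b - 1 < b by omega)
        rw [show b - 1 + 1 = b by omega] at this
        linarith
    refine (hB2 b k hk hb1 hb2 v).trans ?_
    have := Finset.single_le_sum (f := fun b => B b v) (fun b _ => hB0 b v) (Finset.mem_range.2 hbN)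
    linarith

lemma dkw_fin (m : ℕ) {p : Fin (m + 1) → ℝ} (hp : ∀ c, 0 ≤ p c) (hs : ∑ c, p c = 1)
    (r Nb : ℕ) (ρ : ℝ) (hρ1 : 1 ≤ ρ) (hρ : 2 ≤ ρ ^ Nb) (θ : ℝ) (hθ : 0 ≤ θ) :
    ∃ B : (Fin r → Fin (m + 1)) → ℝ, (∀ v, 0 ≤ B v) ∧
      Ex p r B ≤ (1 + 16 * Nb) * Real.exp (r * (θ * ρ) ^ 2 / 8) ∧
      ∀ k ≤ m, ∀ v, Real.exp (θ * |∑ j, ((if (v j : ℕ) ≤ k then (1:ℝ) else 0)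
        - prA p (fun c => (c : ℕ) ≤ k))|) ≤ B v := by
  obtain ⟨B, hB0, hB1, hB2⟩ := chain_bound hp hs r (fun k c => k < (c : ℕ))
    (fun k c h => by omega) m Nb ρ hρ1 hρ θ hθ
  obtain ⟨B', hB0', hB1', hB2'⟩ := chain_bound hp hs r (fun k c => (c : ℕ) ≤ m - k)
    (fun k c h => by omega) m Nb ρ hρ1 hρ θ hθ
  refine ⟨fun v => (1 + B v) + B' v, fun v => by linarith [hB0 v, hB0' v], ?_, ?_⟩
  · rw [Ex_add, Ex_add, Ex_one hs]
    have : 1 ≤ Real.exp (r * (θ * ρ) ^ 2 / 8) := Real.one_le_exp (by positivity)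
    linarith
  · intro k hk v
    have hcompl : prA p (fun c => k < (c : ℕ)) + prA p (fun c => (c : ℕ) ≤ k) = 1 := by
      rw [← hs, prA, prA, ← Finset.sum_add_distrib]
      refine Finset.sum_congr rfl fun c _ => ?_
      by_cases h : (c : ℕ) ≤ k
      · simp [h, not_lt.2 h]
      · simp [h, not_le.1 h]
    rcases le_total (1 / 2) (prA p (fun c => k < (c : ℕ))) with h | h
    · have h1 := hB2 k hk h v
      have e : |∑ j, ((if (v j : ℕ) ≤ k then (1:ℝ) else 0) - prA p (fun c => (c : ℕ) ≤ k))|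
          = |∑ j, ((if k < (v j : ℕ) then (1:ℝ) else 0) - prA p (fun c => k < (c : ℕ)))| := by
        rw [← abs_neg, ← Finset.sum_neg_distrib]
        congr 1
        refine Finset.sum_congr rfl fun j _ => ?_
        by_cases h : (v j : ℕ) ≤ k
        · simp [h, not_lt.2 h]; linarith
        · simp [h, not_le.1 h]; linarith
      rw [e]
      refine le_trans (le_of_eq ?_) (h1.trans (show _ ≤ (1 + B v) + B' v by linarith [hB0' v]))
      congr!
    · have h1 := hB2' (m - k) (by omega) (by
        simp only [show m - (m - k) = k by omega]; linarith) v
      simp only [show m - (m - k) = k by omega] at h1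
      show _ ≤ (1 + B v) + B' v
      linarith [hB0 v]


/-- iterated integration by appending sample points -/
def iterE {α : Type} [MeasurableSpace α] (P : Measure α) (φ : List α → ENNReal) :
    ℕ → List α → ENNReal
  | 0, x => φ x
  | k + 1, x => ∫⁻ u, iterE P φ k (x ++ [u]) ∂P

lemma iterE_mono {α : Type} [MeasurableSpace α] (P : Measure α) {φ φ' : List α → ENNReal}
    (h : ∀ x, φ x ≤ φ' x) : ∀ k x, iterE P φ k x ≤ iterE P φ' k x
  | 0, x => h x
  | k + 1, x => lintegral_mono fun u => iterE_mono P h k (x ++ [u])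

def LMeas {α : Type} [MeasurableSpace α] (φ : List α → ENNReal) : Prop :=
  ∀ (k : ℕ) (x : List α), Measurable fun v : Fin k → α => φ (x ++ List.ofFn v)

lemma iterE_meas {α : Type} [MeasurableSpace α] (P : Measure α) [IsProbabilityMeasure P]
    {φ : List α → ENNReal} (h : LMeas φ) : ∀ k, LMeas (iterE P φ k)
  | 0 => h
  | k + 1 => by
    intro l x
    have h1 := iterE_meas P h k (l + 1) x
    have h2 : Measurable fun q : (Fin l → α) × α => (Fin.snoc q.1 q.2 : Fin (l + 1) → α) := by
      rw [measurable_pi_iff]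
      intro i
      refine Fin.lastCases ?_ (fun i => ?_) i
      · simpa using measurable_snd
      · simpa [Function.comp_def] using (measurable_pi_apply i).comp (measurable_fst (α := Fin l → α) (β := α))
    have h3 := (h1.comp h2).lintegral_prod_right' (ν := P)
    convert h3 using 2 with v
    simp only [iterE]
    refine lintegral_congr fun u => ?_
    simp only [Function.comp]
    congr 1
    rw [List.append_assoc, List.ofFn_succ' (Fin.snoc v u)]
    simp

lemma LMeas.one {α : Type} [MeasurableSpace α] {φ : List α → ENNReal} (h : LMeas φ) (x : List α) :
    Measurable fun u => φ (x ++ [u]) := by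
  have h1 := (h 1 x).comp (measurable_pi_lambda (fun (u : α) (_ : Fin 1) => u)
    (fun _ => measurable_id))
  simpa [Function.comp_def] using h1

lemma iterE_map {α β : Type} [MeasurableSpace α] [MeasurableSpace β] [DiscreteMeasurableSpace β]
    (P : Measure α)
    (c : α → β) (hc : Measurable c) (h : List β → ENNReal) : ∀ k x,
    iterE P (fun x => h (x.map c)) k x = iterE (P.map c) h k (x.map c)
  | 0, x => rfl
  | k + 1, x => by
    simp only [iterE]
    rw [lintegral_map (Measurable.of_discrete) hc]
    refine lintegral_congr fun u => ?_
    rw [iterE_map P c hc h k]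
    simp

lemma iterE_fin {β : Type} [MeasurableSpace β] [Fintype β] [DiscreteMeasurableSpace β]
    (Q : Measure β) (h : List β → ENNReal) : ∀ k x,
    iterE Q h k x = ∑ v : Fin k → β, (∏ j, Q {v j}) * h (x ++ List.ofFn v)
  | 0, x => by simp [iterE]
  | k + 1, x => by
    simp only [iterE]
    rw [lintegral_fintype, ← (Fin.consEquiv (fun _ : Fin (k + 1) => β)).sum_comp,
      Fintype.sum_prod_type]
    refine Finset.sum_congr rfl fun c _ => ?_
    rw [iterE_fin Q h k, Finset.sum_mul]
    refine Finset.sum_congr rfl fun v _ => ?_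
    simp [Fin.consEquiv, Fin.prod_univ_succ]
    ring

lemma iterE_bound {m : ℕ} (Q : Measure (Fin (m + 1))) [IsProbabilityMeasure Q] (r : ℕ)
    (B : (Fin r → Fin (m + 1)) → ℝ) (hB : ∀ v, 0 ≤ B v) (h : List (Fin (m + 1)) → ENNReal)
    (hh : ∀ v, h (List.ofFn v) ≤ ENNReal.ofReal (B v)) :
    iterE Q h r [] ≤ ENNReal.ofReal (Ex (fun c => Q.real {c}) r B) := by
  rw [iterE_fin, Ex, ENNReal.ofReal_sum_of_nonneg]
  · refine Finset.sum_le_sum fun v _ => ?_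
    rw [ENNReal.ofReal_mul (Finset.prod_nonneg fun _ _ => measureReal_nonneg),
      ENNReal.ofReal_prod_of_nonneg (fun _ _ => measureReal_nonneg)]
    refine mul_le_mul' (le_of_eq ?_) (by simpa using hh v)
    refine Finset.prod_congr rfl fun j _ => ?_
    rw [measureReal_def, ENNReal.ofReal_toReal (measure_ne_top _ _)]
  · intro v _
    exact mul_nonneg (Finset.prod_nonneg fun _ _ => measureReal_nonneg) (hB v)

/-- centered count -/
def Sz (P : Measure ℝ) (x : List ℝ) (z : ℝ) : ℝ :=
  (x.map fun s => (if s ≤ z then (1:ℝ) else 0) - P.real (Iic z)).sum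

def phiZ (P : Measure ℝ) (θ : ℝ) (Z : Finset ℝ) (x : List ℝ) : ENNReal :=
  ⨆ z ∈ Z, ENNReal.ofReal (Real.exp (θ * |Sz P x z|))

lemma Sz_append (P : Measure ℝ) (x y : List ℝ) (z : ℝ) : Sz P (x ++ y) z = Sz P x z + Sz P y z := by
  simp [Sz]

lemma Sz_meas (P : Measure ℝ) (k : ℕ) (z : ℝ) :
    Measurable fun v : Fin k → ℝ => Sz P (List.ofFn v) z := by
  simp only [Sz, List.map_ofFn, List.sum_ofFn, Function.comp]
  refine Finset.measurable_sum _ fun i _ => ?_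
  refine Measurable.sub ?_ measurable_const
  exact Measurable.ite (measurableSet_le (measurable_pi_apply i) measurable_const)
    measurable_const measurable_const

lemma phiZ_meas (P : Measure ℝ) (θ : ℝ) (Z : Finset ℝ) : LMeas (phiZ P θ Z) := by
  intro k x
  simp only [phiZ, Sz_append]
  refine Measurable.biSup _ (Finset.countable_toSet Z) fun z _ => ?_
  refine ENNReal.measurable_ofReal.comp (Real.measurable_exp.comp ?_)
  exact measurable_const.mul (measurable_const.add (Sz_meas P k z)).abs

def cellZ (Z : Finset ℝ) (u : ℝ) : Fin (Z.card + 1) :=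
  ⟨(Z.filter (· < u)).card, Nat.lt_succ_of_le (Finset.card_filter_le _ _)⟩

lemma cellZ_mono (Z : Finset ℝ) : Monotone (cellZ Z) := by
  intro u v h
  rw [Fin.le_def]
  exact Finset.card_le_card (Finset.monotone_filter_right _ fun z _ hz => lt_of_lt_of_le hz h)

lemma cellZ_le (Z : Finset ℝ) {z : ℝ} (hz : z ∈ Z) (u : ℝ) :
    (cellZ Z u : ℕ) ≤ cellZ Z z ↔ u ≤ z := by
  constructor
  · intro h
    by_contra hlt
    push Not at hlt
    refine absurd h (not_le.2 ?_)
    refine Finset.card_lt_card ((Finset.ssubset_iff_of_subset ?_).2 ⟨z, ?_, ?_⟩)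
    · exact Finset.monotone_filter_right _ fun w _ hw => lt_trans hw hlt
    · simp [hz, hlt]
    · simp
  · exact fun h => cellZ_mono Z h

lemma phiZ_bound (P : Measure ℝ) [IsProbabilityMeasure P] (Z : Finset ℝ)
    (r Nb : ℕ) (ρ : ℝ) (hρ1 : 1 ≤ ρ) (hρ : 2 ≤ ρ ^ Nb) (θ : ℝ) (hθ : 0 ≤ θ) :
    iterE P (phiZ P θ Z) r [] ≤ ENNReal.ofReal ((1 + 16 * Nb) * Real.exp (r * (θ * ρ) ^ 2 / 8)) := by
  have hc : Measurable (cellZ Z) := (cellZ_mono Z).measurable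
  set Q := P.map (cellZ Z) with hQ
  haveI : IsProbabilityMeasure Q := Measure.isProbabilityMeasure_map hc.aemeasurable
  obtain ⟨B, hB0, hB1, hB2⟩ := dkw_fin Z.card (p := fun c => Q.real {c})
    (fun c => measureReal_nonneg) (by
      have := sum_measureReal_singleton (μ := Q) Finset.univ
      simpa using this) r Nb ρ hρ1 hρ θ hθ
  have hpr : ∀ z ∈ Z, prA (fun c => Q.real {c}) (fun c => (c : ℕ) ≤ (cellZ Z z : ℕ)) = P.real (Iic z) := by
    intro z hz
    have e1 : prA (fun c => Q.real {c}) (fun c => (c : ℕ) ≤ (cellZ Z z : ℕ))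
        = ∑ c ∈ Finset.univ.filter (fun c : Fin (Z.card + 1) => (c : ℕ) ≤ (cellZ Z z : ℕ)), Q.real {c} := by
      rw [prA, Finset.sum_filter]
      exact Finset.sum_congr rfl fun c _ => by split_ifs <;> simp
    rw [e1, sum_measureReal_singleton, measureReal_def, hQ, Measure.map_apply hc (Finset.measurableSet _),
      measureReal_def]
    congr 2
    ext u
    simp only [Finset.coe_filter, Finset.mem_univ, true_and, mem_preimage, mem_ofPred_eq, mem_Iic]
    exact cellZ_le Z hz u
  let h : List (Fin (Z.card + 1)) → ENNReal := fun l =>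
    ⨆ z ∈ Z, ENNReal.ofReal (Real.exp (θ * |(l.map fun c : Fin (Z.card + 1) =>
      ((if (c : ℕ) ≤ (cellZ Z z : ℕ) then (1:ℝ) else 0)
        - prA (fun c => Q.real {c}) (fun c => (c : ℕ) ≤ (cellZ Z z : ℕ)))).sum|))
  have e : phiZ P θ Z = fun x => h (x.map (cellZ Z)) := by
    funext x
    simp only [phiZ, h]
    refine iSup_congr fun z => iSup_congr fun hz => ?_
    rw [hpr z hz, List.map_map, Sz]
    simp only [Function.comp_def, cellZ_le Z hz]
  rw [e, iterE_map P _ hc h, ← hQ]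
  refine (iterE_bound Q r B hB0 h fun v => ?_).trans (ENNReal.ofReal_le_ofReal hB1)
  refine iSup₂_le fun z hz => ENNReal.ofReal_le_ofReal ?_
  have := hB2 (cellZ Z z) (Nat.le_of_lt_succ (cellZ Z z).2) v
  simpa only [List.map_ofFn, List.sum_ofFn, Function.comp_def] using this

lemma phi_jensen (P : Measure ℝ) [IsProbabilityMeasure P] (θ : ℝ) (hθ : 0 ≤ θ) (z : ℝ) : ∀ k x,
    ENNReal.ofReal (Real.exp (θ * |Sz P x z|)) ≤
      iterE P (fun x => ENNReal.ofReal (Real.exp (θ * |Sz P x z|))) k x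
  | 0, x => le_rfl
  | k + 1, x => by
    simp only [iterE]
    refine le_trans ?_ (lintegral_mono fun u => phi_jensen P θ hθ z k (x ++ [u]))
    set w : ℝ → ℝ := fun u => (if u ≤ z then (1:ℝ) else 0) - P.real (Iic z) with hw
    have hS : ∀ u, Sz P (x ++ [u]) z = Sz P x z + w u := by
      intro u; rw [Sz_append]; simp [Sz, hw]
    have hind : (fun u : ℝ => if u ≤ z then (1:ℝ) else 0) = (Iic z).indicator 1 := by
      funext u; simp [indicator]
    have hiw0 : Integrable (fun u : ℝ => if u ≤ z then (1:ℝ) else 0) P := by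
      rw [hind]; exact (integrable_const 1).indicator measurableSet_Iic
    have hiw : Integrable w P := hiw0.sub (integrable_const _)
    have hw0 : ∫ u, w u ∂P = 0 := by
      rw [hw, integral_sub hiw0 (integrable_const _), hind, integral_indicator_one measurableSet_Iic]
      simp
    have hwb : ∀ u, |w u| ≤ 1 := by
      intro u
      have h0 : 0 ≤ P.real (Iic z) := measureReal_nonneg
      have h1 : P.real (Iic z) ≤ 1 := measureReal_le_one
      simp only [hw, abs_le]
      split_ifs <;> constructor <;> linarith
    have hmw : Measurable w := (Measurable.ite measurableSet_Iic measurable_const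
      measurable_const).sub measurable_const
    set s := Sz P x z
    have hg : Integrable (fun u => Real.exp (θ * |s + w u|)) P := by
      refine Integrable.mono' (integrable_const (Real.exp (θ * (|s| + 1)))) ?_ ?_
      · exact (Real.measurable_exp.comp (measurable_const.mul
          (measurable_const.add hmw).abs)).aestronglyMeasurable
      · refine Filter.Eventually.of_forall fun u => ?_
        rw [Real.norm_eq_abs, Real.abs_exp]
        refine Real.exp_le_exp.2 (mul_le_mul_of_nonneg_left ?_ hθ)
        exact (abs_add_le _ _).trans (by linarith [hwb u])
    simp only [hS]
    rw [← ofReal_integral_eq_lintegral_ofReal hg (Filter.Eventually.of_forall fun u =>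
      (Real.exp_pos _).le)]
    refine ENNReal.ofReal_le_ofReal ?_
    obtain ⟨σ, hσ⟩ : ∃ σ : ℝ, ∀ y, |s| + σ * y ≤ |s + y| := by
      rcases le_total 0 s with h | h
      · exact ⟨1, fun y => by rw [abs_of_nonneg h]; linarith [le_abs_self (s + y)]⟩
      · exact ⟨-1, fun y => by rw [abs_of_nonpos h]; linarith [neg_abs_le (s + y)]⟩
    have hlin : ∫ u, Real.exp (θ * |s|) * (1 + θ * σ * w u) ∂P = Real.exp (θ * |s|) := by
      rw [integral_const_mul, integral_add (integrable_const _) (hiw.const_mul _),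
        integral_const_mul, hw0]
      simp
    rw [← hlin]
    refine integral_mono (((integrable_const _).add (hiw.const_mul _)).const_mul _) hg fun u => ?_
    have h1 : Real.exp (θ * |s|) * Real.exp (θ * σ * w u) ≤ Real.exp (θ * |s + w u|) := by
      rw [← Real.exp_add]
      refine Real.exp_le_exp.2 ?_
      have := mul_le_mul_of_nonneg_left (hσ (w u)) hθ
      linarith
    refine le_trans (mul_le_mul_of_nonneg_left ?_ (Real.exp_pos _).le) h1
    linarith [Real.add_one_le_exp (θ * σ * w u)]

/-- a nonnegative supermartingale function -/
def Good (P : Measure ℝ) (Ψ : List ℝ → ENNReal) : Prop :=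
  ∀ x, Measurable (fun u => Ψ (x ++ [u])) ∧ ∫⁻ u, Ψ (x ++ [u]) ∂P ≤ Ψ x

def PsiZ (P : Measure ℝ) (θ : ℝ) (r : ℕ) (Z : Finset ℝ) (x : List ℝ) : ENNReal :=
  iterE P (phiZ P θ Z) (r - x.length) (x.take r)

lemma PsiZ_good (P : Measure ℝ) [IsProbabilityMeasure P] (θ : ℝ) (r : ℕ) (Z : Finset ℝ) :
    Good P (PsiZ P θ r Z) := by
  intro x
  rcases Nat.lt_or_ge x.length r with h | h
  · have e : ∀ u, PsiZ P θ r Z (x ++ [u]) = iterE P (phiZ P θ Z) (r - x.length - 1) (x ++ [u]) := by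
      intro u
      simp only [PsiZ]
      rw [List.take_of_length_le (by simp; omega)]
      simp [Nat.sub_sub]
    simp only [e]
    refine ⟨(iterE_meas P (phiZ_meas P θ Z) _).one x, ?_⟩
    rw [PsiZ, List.take_of_length_le h.le]
    obtain ⟨k, hk⟩ : ∃ k, r - x.length = k + 1 := ⟨r - x.length - 1, by omega⟩
    rw [hk]
    simp [iterE]
  · have e : ∀ u, PsiZ P θ r Z (x ++ [u]) = PsiZ P θ r Z x := by
      intro u
      simp only [PsiZ]
      rw [List.take_append_of_le_length h]
      rw [show r - (x ++ [u]).length = 0 by simp; omega, show r - x.length = 0 by omega]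
    simp only [e]
    exact ⟨measurable_const, by simp⟩

lemma phiZ_mono (P : Measure ℝ) (θ : ℝ) {Z Z' : Finset ℝ} (h : Z ⊆ Z') (x : List ℝ) :
    phiZ P θ Z x ≤ phiZ P θ Z' x := by
  refine iSup₂_le fun z hz => ?_
  exact le_iSup₂_of_le z (h hz) le_rfl

lemma phiZ_le_PsiZ (P : Measure ℝ) [IsProbabilityMeasure P] (θ : ℝ) (hθ : 0 ≤ θ) (r : ℕ)
    (Z : Finset ℝ) (x : List ℝ) : phiZ P θ Z (x.take r) ≤ PsiZ P θ r Z x := by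
  refine iSup₂_le fun z hz => ?_
  refine (phi_jensen P θ hθ z (r - x.length) _).trans (iterE_mono P (fun y => ?_) _ _)
  exact le_iSup₂_of_le (f := fun z (_ : z ∈ Z) => ENNReal.ofReal (Real.exp (θ * |Sz P y z|))) z hz le_rfl

lemma Sz_rc (P : Measure ℝ) [IsProbabilityMeasure P] (x : List ℝ) (z : ℝ) :
    ContinuousWithinAt (Sz P x) (Ici z) z := by
  induction x with
  | nil =>
    have e : Sz P [] = fun _ => 0 := by funext z; simp [Sz]
    rw [e]; exact continuousWithinAt_const
  | cons s x ih =>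
    have e : Sz P (s :: x) = fun z => ((if s ≤ z then (1:ℝ) else 0) - P.real (Iic z)) + Sz P x z := by
      funext z; simp [Sz]
    rw [e]
    refine ContinuousWithinAt.add (ContinuousWithinAt.sub ?_ ?_) ih
    · rcases le_or_gt s z with h | h
      · refine (continuousWithinAt_const (b := (1:ℝ))).congr ?_ ?_
        · intro y hy; simp [h.trans (mem_Ici.1 hy)]
        · simp [h]
      · refine ContinuousAt.continuousWithinAt ?_
        refine (continuousAt_const (y := (0:ℝ))).congr ?_
        filter_upwards [Iio_mem_nhds h] with y hy
        simp [mem_Iio.1 hy]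
    · have := (ProbabilityTheory.cdf P).right_continuous z
      have e2 : (fun z => P.real (Iic z)) = ProbabilityTheory.cdf P := by
        funext z; rw [ProbabilityTheory.cdf_eq_real]
      rw [e2]; exact this

theorem good_exists (P : Measure ℝ) [IsProbabilityMeasure P]
    (r Nb : ℕ) (ρ : ℝ) (hρ1 : 1 ≤ ρ) (hρ : 2 ≤ ρ ^ Nb) (θ : ℝ) (hθ : 0 ≤ θ) :
    ∃ Ψ : List ℝ → ENNReal, Good P Ψ ∧
      (∀ x z, ENNReal.ofReal (Real.exp (θ * |Sz P (x.take r) z|)) ≤ Ψ x) ∧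
      Ψ [] ≤ ENNReal.ofReal ((1 + 16 * Nb) * Real.exp (r * (θ * ρ) ^ 2 / 8)) := by
  obtain ⟨qs, hqs⟩ := exists_surjective_nat ℚ
  let Z : ℕ → Finset ℝ := fun N => (Finset.range N).image fun k => (qs k : ℝ)
  have hZ : Monotone Z := fun N N' h => Finset.image_subset_image (Finset.range_mono h)
  have hmono : ∀ x, Monotone fun N => PsiZ P θ r (Z N) x := fun x N N' h =>
    iterE_mono P (phiZ_mono P θ (hZ h)) _ _
  refine ⟨fun x => ⨆ N, PsiZ P θ r (Z N) x, ?_, ?_, ?_⟩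
  · intro x
    refine ⟨Measurable.iSup fun N => (PsiZ_good P θ r (Z N) x).1, ?_⟩
    rw [lintegral_iSup (fun N => (PsiZ_good P θ r (Z N) x).1)]
    · exact iSup_mono fun N => (PsiZ_good P θ r (Z N) x).2
    · intro N N' h u
      exact hmono _ h
  · intro x z
    have hq : ∀ q : ℚ, ENNReal.ofReal (Real.exp (θ * |Sz P (x.take r) q|))
        ≤ ⨆ N, PsiZ P θ r (Z N) x := by
      intro q
      obtain ⟨k, hk⟩ := hqs q
      refine le_iSup_of_le (k + 1) (le_trans ?_ (phiZ_le_PsiZ P θ hθ r _ x))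
      refine le_iSup₂_of_le (f := fun z (_ : z ∈ Z (k + 1)) =>
        ENNReal.ofReal (Real.exp (θ * |Sz P (x.take r) z|))) (q : ℝ) ?_ le_rfl
      exact Finset.mem_image.2 ⟨k, by simp, by rw [hk]⟩
    have hcont : ContinuousWithinAt
        (fun z => ENNReal.ofReal (Real.exp (θ * |Sz P (x.take r) z|))) (Ici z) z := by
      refine ENNReal.continuous_ofReal.continuousAt.comp_continuousWithinAt ?_
      refine Real.continuous_exp.continuousAt.comp_continuousWithinAt ?_
      exact continuousWithinAt_const.mul (Sz_rc P _ z).abs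
    obtain ⟨q, -, hqz, hql⟩ := Rat.denseRange_cast.exists_seq_strictAnti_tendsto (Rat.cast_strictMono (K := ℝ)).monotone z
    · exact le_of_tendsto (hcont.tendsto.comp (tendsto_nhdsWithin_iff.2 ⟨hql,
        Filter.Eventually.of_forall fun n => mem_Ici.2 (le_of_lt (mem_Ioi.1 (hqz n)))⟩)) (Filter.Eventually.of_forall fun n => hq (q n))
  · refine iSup_le fun N => ?_
    simp only [PsiZ, List.length_nil, Nat.sub_zero, List.take_nil]
    exact phiZ_bound P _ r Nb ρ hρ1 hρ θ hθ


/-- outcomes observed per treatment, given the assignment -/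
def outL {K n : ℕ} (asg : Fin n → Option (Fin K)) (ω : Fin n → Fin K → ℝ) (i : Fin K) : List ℝ :=
  ((List.finRange n).filter fun t => asg t = some i).map fun t => ω t i

lemma outL_cons {K n : ℕ} (asg : Fin (n + 1) → Option (Fin K)) (ω : Fin (n + 1) → Fin K → ℝ)
    (i : Fin K) : outL asg ω i = (if asg 0 = some i then [ω 0 i] else [])
      ++ outL (fun t => asg t.succ) (fun t => ω t.succ) i := by
  unfold outL
  rw [List.finRange_succ, List.filter_cons, List.filter_map]
  split_ifs <;> simp_all [Function.comp_def]

theorem sampling {K : ℕ} (ν : Measure (Fin K → ℝ)) [IsProbabilityMeasure ν]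
    (G : (Fin K → List ℝ) → ENNReal)
    (hG : ∀ ℓ i, ∫⁻ e, G (Function.update ℓ i (ℓ i ++ [e i])) ∂ν ≤ G ℓ) :
    ∀ (n : ℕ) (asg : (Fin n → Fin K → ℝ) → Fin n → Option (Fin K))
      (_ : ∀ t ω ω', (∀ s, s < t → ω s = ω' s) → asg ω t = asg ω' t) (ℓ : Fin K → List ℝ),
      ∫⁻ ω, G (fun i => ℓ i ++ outL (asg ω) ω i) ∂(Measure.pi fun _ : Fin n => ν) ≤ G ℓ := by
  intro n
  induction n with
  | zero =>
    intro asg _ ℓ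
    simp [outL]
  | succ n ih =>
    intro asg hasg ℓ
    obtain ⟨o, ho⟩ : ∃ o, ∀ ω, asg ω 0 = o :=
      ⟨asg (fun _ _ => 0) 0, fun ω => hasg 0 _ _ fun s hs => absurd hs (Fin.not_lt_zero s)⟩
    have mp := (measurePreserving_piFinSuccAbove (fun _ : Fin (n + 1) => ν) 0).symm
    rw [← mp.map_eq, lintegral_map_equiv]
    refine (lintegral_prod_le _).trans ?_
    have step : ∀ e : Fin K → ℝ, ∫⁻ ω' : Fin n → Fin K → ℝ,
        G (fun i => ℓ i ++ outL (asg (Fin.cons e ω')) (Fin.cons e ω') i)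
          ∂(Measure.pi fun _ : Fin n => ν)
        ≤ G (fun i => ℓ i ++ (if o = some i then [e i] else [])) := by
      intro e
      have h := ih (fun ω' s => asg (Fin.cons e ω') s.succ) (by
        intro t ω ω' h
        refine hasg _ _ _ fun s hs => ?_
        refine Fin.cases ?_ (fun s hs => ?_) s hs
        · intro _; simp
        · simpa using h s (Fin.succ_lt_succ_iff.1 hs))
        (fun i => ℓ i ++ (if o = some i then [e i] else []))
      refine le_trans (le_of_eq ?_) h
      refine lintegral_congr fun ω' => ?_
      congr 1
      funext i
      rw [outL_cons, ho, List.append_assoc]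
      simp
    refine le_trans (lintegral_mono fun e => ?_) (?_ : ∫⁻ e, G (fun i => ℓ i ++
      (if o = some i then [e i] else [])) ∂ν ≤ G ℓ)
    · refine le_trans (le_of_eq ?_) (step e)
      refine lintegral_congr fun ω' => ?_
      simp [MeasurableEquiv.piFinSuccAbove, Fin.insertNthEquiv, Fin.insertNth_zero]
    · cases o with
      | none => simp
      | some j =>
        refine le_trans (le_of_eq ?_) (hG ℓ j)
        refine lintegral_congr fun e => ?_
        congr 1
        funext i
        by_cases h : i = j
        · subst h; simp
        · simp [h, Ne.symm h]

def SupG {K : ℕ} (ν : Measure (Fin K → ℝ)) (G : (Fin K → List ℝ) → ENNReal) : Prop :=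
  ∀ ℓ i, Measurable (fun e : Fin K → ℝ => G (Function.update ℓ i (ℓ i ++ [e i]))) ∧
    ∫⁻ e, G (Function.update ℓ i (ℓ i ++ [e i])) ∂ν ≤ G ℓ

lemma SupG.const {K : ℕ} (ν : Measure (Fin K → ℝ)) [IsProbabilityMeasure ν] (c : ENNReal) :
    SupG ν (fun _ => c) := fun _ _ => ⟨measurable_const, by simp⟩

lemma SupG.add {K : ℕ} {ν : Measure (Fin K → ℝ)} {G G' : (Fin K → List ℝ) → ENNReal}
    (h : SupG ν G) (h' : SupG ν G') : SupG ν (fun ℓ => G ℓ + G' ℓ) := by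
  intro ℓ i
  refine ⟨(h ℓ i).1.add (h' ℓ i).1, ?_⟩
  rw [lintegral_add_left (h ℓ i).1]
  exact add_le_add (h ℓ i).2 (h' ℓ i).2

lemma SupG.mul {K : ℕ} {ν : Measure (Fin K → ℝ)} {G : (Fin K → List ℝ) → ENNReal}
    (c : ENNReal) (h : SupG ν G) : SupG ν (fun ℓ => c * G ℓ) := by
  intro ℓ i
  refine ⟨measurable_const.mul (h ℓ i).1, ?_⟩
  rw [lintegral_const_mul _ (h ℓ i).1]
  exact mul_le_mul' le_rfl (h ℓ i).2

lemma SupG.sum {K : ℕ} {ν : Measure (Fin K → ℝ)} [IsProbabilityMeasure ν] {ι : Type}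
    (s : Finset ι) {G : ι → (Fin K → List ℝ) → ENNReal}
    (h : ∀ j ∈ s, SupG ν (G j)) : SupG ν (fun ℓ => ∑ j ∈ s, G j ℓ) := by
  induction s using Finset.induction_on with
  | empty => simpa using SupG.const ν 0
  | insert j s hj ih =>
    simp only [Finset.sum_insert hj]
    exact (h j (Finset.mem_insert_self _ _)).add (ih fun j hj => h j (Finset.mem_insert_of_mem hj))

lemma SupG.single {K : ℕ} (ν : Measure (Fin K → ℝ)) [IsProbabilityMeasure ν] (j : Fin K)
    {Ψ : List ℝ → ENNReal} (h : Good (ν.map (fun e => e j)) Ψ) : SupG ν (fun ℓ => Ψ (ℓ j)) := by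
  intro ℓ i
  by_cases hij : i = j
  · subst hij
    simp only [Function.update_self]
    refine ⟨(h (ℓ i)).1.comp (measurable_pi_apply i), ?_⟩
    have := (h (ℓ i)).2
    rwa [lintegral_map (h (ℓ i)).1 (measurable_pi_apply i)] at this
  · simp only [Function.update_of_ne (Ne.symm hij)]
    exact SupG.const ν (Ψ (ℓ j)) ℓ i

lemma SupG.pair {K : ℕ} (ν : Measure (Fin K → ℝ)) [IsProbabilityMeasure ν] (j j' : Fin K)
    (hj : j ≠ j') {Ψ Ψ' : List ℝ → ENNReal} (h : Good (ν.map (fun e => e j)) Ψ)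
    (h' : Good (ν.map (fun e => e j')) Ψ') : SupG ν (fun ℓ => Ψ (ℓ j) * Ψ' (ℓ j')) := by
  intro ℓ i
  by_cases hij : i = j
  · subst hij
    simp only [Function.update_of_ne hj.symm]
    have := (SupG.single ν i h).mul (Ψ' (ℓ j')) ℓ i
    simpa only [mul_comm] using this
  · simp only [Function.update_of_ne (Ne.symm hij)]
    exact (SupG.single ν j' h').mul (Ψ (ℓ j)) ℓ i


lemma elim_sup {X : Type} {m : ℕ} (act : Fin m → Finset X) (f : X → ℝ) (j : Fin m)
    (J : Finset (Fin m)) (hJ : J = Finset.univ.filter fun j => (act j).Nonempty)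
    (hJ2 : 2 ≤ J.card) :
    ∃ l ≠ j, ∃ δ ∈ act l, sSup (f '' (⋃ l ∈ J.erase j, (act l : Set X))) = f δ ∧
      ∀ l' ≠ j, ∀ γ ∈ act l', f γ ≤ f δ := by
  set A : Set X := ⋃ l ∈ J.erase j, (act l : Set X) with hA
  have hfin : A.Finite := (J.erase j).finite_toSet.biUnion fun l _ => (act l).finite_toSet
  have hmem : ∀ l' ≠ j, ∀ γ ∈ act l', γ ∈ A := by
    intro l' hl' γ hγ
    simp only [hA, mem_iUnion]
    refine ⟨l', ?_, hγ⟩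
    simp only [hJ, Finset.mem_erase, Finset.mem_filter, Finset.mem_univ, true_and]
    exact ⟨hl', γ, hγ⟩
  have hne : A.Nonempty := by
    have : (J.erase j).Nonempty := by
      rw [← Finset.card_pos]
      have := Finset.pred_card_le_card_erase (s := J) (a := j)
      omega
    obtain ⟨l, hl⟩ := this
    have hl' := Finset.mem_erase.1 hl
    have h2 := hl'.2
    rw [hJ, Finset.mem_filter] at h2
    obtain ⟨γ, hγ⟩ := h2.2
    exact ⟨γ, hmem l hl'.1 γ hγ⟩
  have hs := (hne.image f).csSup_mem (hfin.image f)
  obtain ⟨δ, hδ, hδe⟩ := hs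
  have hδ' := hδ
  simp only [hA, mem_iUnion] at hδ'
  obtain ⟨l, hl, hδl⟩ := hδ'
  refine ⟨l, (Finset.mem_erase.1 hl).1, δ, hδl, hδe.symm, fun l' hl' γ hγ => ?_⟩
  rw [hδe]
  exact le_csSup (hfin.image f).bddAbove (mem_image_of_mem f (hmem l' hl' γ hγ))

/-- one elimination round -/
lemma elim_round {X : Type} {K m : ℕ} (g : Fin K → Fin m) (act act' : Fin m → Finset X)
    (f V : X → ℝ) (u : ℝ) (hu : 0 ≤ u) (A : Fin K → ℝ)
    (J : Finset (Fin m)) (hJ : J = Finset.univ.filter fun j => (act j).Nonempty)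
    (hJ2 : 2 ≤ J.card)
    (hact : ∀ j γ, γ ∈ act' j ↔ γ ∈ act j ∧
      ¬ (sSup (f '' (⋃ l ∈ J.erase j, (act l : Set X))) > f γ + u))
    (happ : ∀ j, ∀ γ ∈ act j, ∃ i, g i = j ∧ |f γ - V γ| ≤ A i) :
    ∀ j, ∀ δ ∈ act j, ∃ j', ∃ δ' ∈ act' j', V δ ≤ V δ' + ∑ i, ∑ i',
      if i ≠ i' ∧ (act (g i)).Nonempty ∧ (act (g i')).Nonempty
        then max 0 (A i + A i' - u) else 0 := by
  intro j δ hδ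
  set W : Fin K → Fin K → ℝ := fun i i' =>
      if i ≠ i' ∧ (act (g i)).Nonempty ∧ (act (g i')).Nonempty
        then max 0 (A i + A i' - u) else 0 with hW
  have hW0 : ∀ i i', 0 ≤ W i i' := by
    intro i i'; simp only [hW]; split_ifs <;> simp
  have hWS : ∀ i i', W i i' ≤ ∑ i, ∑ i', W i i' := fun i i' =>
    (Finset.single_le_sum (f := fun i' => W i i') (fun _ _ => hW0 _ _) (Finset.mem_univ i')).trans
      (Finset.single_le_sum (f := fun i => ∑ i', W i i')
        (fun _ _ => Finset.sum_nonneg fun _ _ => hW0 _ _) (Finset.mem_univ i))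
  have hWS2 : ∀ i i' k k', i ≠ k → W i i' + W k k' ≤ ∑ i, ∑ i', W i i' := by
    intro i i' k k' hik
    have h1 := Finset.add_le_sum (f := fun i => ∑ i', W i i')
      (fun _ _ => Finset.sum_nonneg fun _ _ => hW0 _ _) (Finset.mem_univ i) (Finset.mem_univ k) hik
    have h2 : W i i' ≤ ∑ i', W i i' :=
      Finset.single_le_sum (f := fun i' => W i i') (fun _ _ => hW0 _ _) (Finset.mem_univ i')
    have h3 : W k k' ≤ ∑ i', W k i' :=
      Finset.single_le_sum (f := fun i' => W k i') (fun _ _ => hW0 _ _) (Finset.mem_univ k')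
    linarith
  have hWp : ∀ j1 j2, j1 ≠ j2 → ∀ γ ∈ act j1, ∀ γ' ∈ act j2, f γ' ≥ f γ + u →
      ∃ i i', g i = j1 ∧ g i' = j2 ∧ V γ ≤ V γ' + W i i' := by
    intro j1 j2 h12 γ hγ γ' hγ' hf
    obtain ⟨i, hi, hA⟩ := happ j1 γ hγ
    obtain ⟨i', hi', hA'⟩ := happ j2 γ' hγ'
    refine ⟨i, i', hi, hi', ?_⟩
    have : W i i' = max 0 (A i + A i' - u) := by
      simp only [hW]
      rw [if_pos]
      refine ⟨fun h => h12 (by rw [← hi, ← hi', h]), ?_, ?_⟩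
      · rw [hi]; exact ⟨γ, hγ⟩
      · rw [hi']; exact ⟨γ', hγ'⟩
    rw [this]
    have := le_max_right 0 (A i + A i' - u)
    have := abs_le.1 hA
    have := abs_le.1 hA'
    linarith [this.1, this.2, (abs_le.1 hA).1, (abs_le.1 hA).2]
  by_cases hsurv : δ ∈ act' j
  · exact ⟨j, δ, hsurv, by
      have := Finset.sum_nonneg fun i (_ : i ∈ Finset.univ) =>
        Finset.sum_nonneg fun i' (_ : i' ∈ Finset.univ) => hW0 i i'
      linarith⟩
  obtain ⟨j1, hj1, δ1, hδ1, hs, hmax⟩ := elim_sup act f j J hJ hJ2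
  have h1 : f δ + u < f δ1 := by
    by_contra hcon
    apply hsurv
    rw [hact]
    refine ⟨hδ, ?_⟩
    rw [hs]
    exact hcon
  obtain ⟨i, i1, hi, hi1, hV1⟩ := hWp j j1 hj1.symm δ hδ δ1 hδ1 h1.le
  by_cases hsurv1 : δ1 ∈ act' j1
  · exact ⟨j1, δ1, hsurv1, by linarith [hWS i i1]⟩
  obtain ⟨j2, hj2, δ2, hδ2, hs2, hmax2⟩ := elim_sup act f j1 J hJ hJ2
  have h2 : f δ1 + u < f δ2 := by
    by_contra hcon
    apply hsurv1
    rw [hact]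
    refine ⟨hδ1, ?_⟩
    rw [hs2]
    exact hcon
  obtain rfl : j2 = j := by
    by_contra hne
    have := hmax j2 hne δ2 hδ2
    linarith
  obtain ⟨k, k', hk, hk', hV2⟩ := hWp j1 j2 hj1 δ1 hδ1 δ2 hδ2 h2.le
  refine ⟨j2, δ2, ?_, ?_⟩
  · rw [hact]
    refine ⟨hδ2, ?_⟩
    rw [hs]
    linarith
  · have := hWS2 i i1 k k' (fun h => hj1 (by rw [← hk, ← hi, h]))
    linarith

section policy
variable {K m : ℕ} (g : Fin K → Fin m)

def actI (S : SEState K m) : Finset (Fin K) := Finset.univ.filter fun i => (S.act (g i)).Nonempty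

def rk (I : Finset (Fin K)) (i : Fin K) : ℕ := (I.filter (· < i)).card

lemma rk_lt {I : Finset (Fin K)} {i : Fin K} (h : i ∈ I) : rk I i < I.card :=
  Finset.card_lt_card ((Finset.ssubset_iff_of_subset (Finset.filter_subset _ _)).2 ⟨i, h, by simp⟩)

lemma rk_inj {I : Finset (Fin K)} {i j : Fin K} (hi : i ∈ I) (hj : j ∈ I) (h : rk I i = rk I j) :
    i = j := by
  have key : ∀ i j : Fin K, i ∈ I → i < j → rk I i < rk I j := by
    intro i j hi hij
    refine Finset.card_lt_card ((Finset.ssubset_iff_of_subset ?_).2 ⟨i, ?_, ?_⟩)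
    · exact Finset.monotone_filter_right _ fun w _ hw => lt_trans hw hij
    · simp [hi, hij]
    · simp
  rcases lt_trichotomy i j with h1 | h1 | h1
  · exact absurd h (key i j hi h1).ne
  · exact h1
  · exact absurd h (key j i hj h1).ne'

/-- well-formed records -/
def WF (times : Fin K → List ℕ) (t : ℕ) : Prop :=
  (∀ i, (times i).Pairwise (· < ·)) ∧ (∀ i, ∀ s ∈ times i, s < t) ∧
    ∀ i j s, s ∈ times i → s ∈ times j → i = j

def blockT (I : Finset (Fin K)) (t q : ℕ) (times : Fin K → List ℕ) : Fin K → List ℕ := fun i =>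
  if i ∈ I ∧ rk I i < q then times i ++ [t + rk I i] else times i

lemma WF.block {times : Fin K → List ℕ} {t : ℕ} (h : WF times t) (I : Finset (Fin K)) (q : ℕ) :
    WF (blockT I t q times) (t + q) := by
  have hmem : ∀ i s, s ∈ blockT I t q times i ↔ s ∈ times i ∨ (i ∈ I ∧ rk I i < q ∧ s = t + rk I i) := by
    intro i s
    simp only [blockT]
    split_ifs with hc
    · simp [hc]
    · simp; intro h1 h2; exact absurd ⟨h1, h2⟩ hc
  refine ⟨fun i => ?_, fun i s hs => ?_, fun i j s hi hj => ?_⟩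
  · simp only [blockT]
    split_ifs with hc
    · rw [List.pairwise_append]
      refine ⟨h.1 i, by simp, ?_⟩
      intro s hs u hu
      have := h.2.1 i s hs
      simp at hu; omega
    · exact h.1 i
  · rcases (hmem i s).1 hs with h1 | ⟨_, h1, rfl⟩
    · have := h.2.1 i s h1; omega
    · omega
  · rcases (hmem i s).1 hi with h1 | ⟨hiI, h1, rfl⟩
    · rcases (hmem j s).1 hj with h2 | ⟨hjI, h2, rfl⟩
      · exact h.2.2 i j s h1 h2
      · have := h.2.1 i _ h1; omega
    · rcases (hmem j _).1 hj with h2 | ⟨hjI, h2, he⟩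
      · have := h.2.1 j _ h2; omega
      · exact rk_inj hiI hjI (by omega)

variable (T : (ℝ → ℝ) → ℝ) (C η : ℝ) (n : ℕ) (R : Finset ℕ) (Mn : Finset (Fin K → ℝ))

/-- the elimination part of a step -/
def elimAct (y : ℕ → Fin K → ℝ) (r : ℕ) (S : SEState K m) : Fin m → Finset (Fin K → ℝ) :=
  if (r + 1) ∈ R ∧ 2 ≤ (Finset.univ.filter fun j => (S.act j).Nonempty).card then
    fun j => (S.act j).filter fun γ =>
          ¬ (sSup ((fun δ => T (mix δ (empOf y (blockT (actI g S) S.t (actI g S).card S.times)))) ''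
            (⋃ l ∈ (Finset.univ.filter fun j => (S.act j).Nonempty).erase j, ↑(S.act l)))
              > T (mix γ (empOf y (blockT (actI g S) S.t (actI g S).card S.times)))
                + uEta C η (r + 1) n K)
  else S.act

lemma seStep_eq (y : ℕ → Fin K → ℝ) (r : ℕ) (S : SEState K m) :
    seStep g T C η n R y r S = if (actI g S).card ≤ n - S.t then
      ⟨S.t + (actI g S).card, blockT (actI g S) S.t (actI g S).card S.times,
        elimAct g T C η n R y r S⟩ else S := by
  have hb : blockT (actI g S) S.t (actI g S).card S.times = fun i =>
      if i ∈ actI g S then S.times i ++ [S.t + ((actI g S).filter (· < i)).card] else S.times i := by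
    funext i
    simp only [blockT]
    by_cases h : i ∈ actI g S
    · simp only [h, rk_lt h, and_self, if_true]; rfl
    · simp [h]
  unfold seStep elimAct
  simp only [hb]
  by_cases h2 : (r + 1) ∈ R ∧ 2 ≤ (Finset.univ.filter fun j => (S.act j).Nonempty).card
  · simp only [h2, if_true, actI, true_and, and_self]
    congr!
  · simp only [h2, if_false, actI]
    congr!

lemma seFinal_eq (S : SEState K m) :
    seFinalTimes g n S = blockT (actI g S) S.t (n - S.t) S.times := by
  funext i
  simp only [seFinalTimes, blockT, actI, rk]
  congr!

end policy


section policy2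
variable {K m : ℕ} (g : Fin K → Fin m)
  (T : (ℝ → ℝ) → ℝ) (C η : ℝ) (n : ℕ) (R : Finset ℕ) (Mn : Finset (Fin K → ℝ))

lemma run_WF (y : ℕ → Fin K → ℝ) (k : ℕ) :
    WF (seRun g T C η n R Mn y k).times (seRun g T C η n R Mn y k).t ∧
      (seRun g T C η n R Mn y k).t ≤ n := by
  induction k with
  | zero => simp [seRun, WF]
  | succ k ih =>
    simp only [seRun]
    rw [seStep_eq]
    split_ifs with h
    · refine ⟨ih.1.block _ _, ?_⟩
      have := ih.2
      simp only
      omega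
    · exact ih

def FT (y : ℕ → Fin K → ℝ) : Fin K → List ℕ := seFinalTimes g n (seRun g T C η n R Mn y n)

lemma FT_WF (y : ℕ → Fin K → ℝ) : WF (FT g T C η n R Mn y) n := by
  have h := run_WF g T C η n R Mn y n
  have h2 := h.1.block (actI g (seRun g T C η n R Mn y n)) (n - (seRun g T C η n R Mn y n).t)
  rw [FT, seFinal_eq]
  have e : (seRun g T C η n R Mn y n).t + (n - (seRun g T C η n R Mn y n).t) = n := by
    have := h.2; omega
  rwa [e] at h2

lemma blockT_prefix (I : Finset (Fin K)) (t q : ℕ) (times : Fin K → List ℕ) (i : Fin K) :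
    times i <+: blockT I t q times i := by
  simp only [blockT]
  split_ifs
  · exact List.prefix_append _ _
  · exact List.prefix_refl _

lemma mem_blockT (I : Finset (Fin K)) (t q : ℕ) (times : Fin K → List ℕ) (i : Fin K) (s : ℕ)
    (hs : s < t) : s ∈ blockT I t q times i ↔ s ∈ times i := by
  simp only [blockT]
  split_ifs with h
  · simp; omega
  · exact Iff.rfl

lemma run_prefix (y : ℕ → Fin K → ℝ) {k l : ℕ} (h : k ≤ l) (i : Fin K) :
    (seRun g T C η n R Mn y k).times i <+: (seRun g T C η n R Mn y l).times i := by
  induction l, h using Nat.le_induction with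
  | base => exact List.prefix_refl _
  | succ l hl ih =>
    refine ih.trans ?_
    simp only [seRun]
    rw [seStep_eq]
    split_ifs with h
    · exact blockT_prefix _ _ _ _ _
    · exact List.prefix_refl _

lemma run_prefix_FT (y : ℕ → Fin K → ℝ) {k : ℕ} (h : k ≤ n) (i : Fin K) :
    (seRun g T C η n R Mn y k).times i <+: FT g T C η n R Mn y i := by
  refine (run_prefix g T C η n R Mn y h i).trans ?_
  rw [FT, seFinal_eq]
  exact blockT_prefix _ _ _ _ _

lemma empOf_congr {y y' : ℕ → Fin K → ℝ} {times : Fin K → List ℕ}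
    (h : ∀ i, ∀ s ∈ times i, y s = y' s) : empOf y times = empOf y' times := by
  funext i z
  simp only [empOf]
  congr 2
  refine List.map_congr_left fun s hs => ?_
  rw [h i s hs]

lemma run_pred (y y' : ℕ → Fin K → ℝ) (t : ℕ) (hy : ∀ s < t, y s = y' s) (k : ℕ) :
    seRun g T C η n R Mn y k = seRun g T C η n R Mn y' k ∨
    (t < (seRun g T C η n R Mn y k).t ∧ t < (seRun g T C η n R Mn y' k).t ∧
      ∀ i, t ∈ (seRun g T C η n R Mn y k).times i ↔ t ∈ (seRun g T C η n R Mn y' k).times i) := by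
  induction k with
  | zero => left; rfl
  | succ k ih =>
    have wf := run_WF g T C η n R Mn y k
    simp only [seRun]
    rw [seStep_eq, seStep_eq]
    rcases ih with h | ⟨h1, h2, h3⟩
    · rw [← h]
      set S := seRun g T C η n R Mn y k
      by_cases hc : (actI g S).card ≤ n - S.t
      · simp only [hc, if_true]
        rcases Nat.lt_or_ge t (S.t + (actI g S).card) with h4 | h4
        · right
          exact ⟨h4, h4, fun i => by trivial⟩
        · left
          have he : empOf y (blockT (actI g S) S.t (actI g S).card S.times)
              = empOf y' (blockT (actI g S) S.t (actI g S).card S.times) :=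
            empOf_congr fun i s hs => hy s (lt_of_lt_of_le ((wf.1.block _ _).2.1 i s hs) h4)
          simp only [elimAct, he]
      · left; simp only [hc, if_false]
    · right
      have key : ∀ (z : ℕ → Fin K → ℝ) (S : SEState K m), t < S.t →
          t < (if (actI g S).card ≤ n - S.t then
      ⟨S.t + (actI g S).card, blockT (actI g S) S.t (actI g S).card S.times,
        elimAct g T C η n R z k S⟩ else S : SEState K m).t ∧ ∀ i, t ∈ (if (actI g S).card ≤ n - S.t then
      ⟨S.t + (actI g S).card, blockT (actI g S) S.t (actI g S).card S.times,
        elimAct g T C η n R z k S⟩ else S : SEState K m).times i ↔ t ∈ S.times i := by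
        intro z S hS
        split_ifs with hc
        · exact ⟨by simp only; omega, fun i => mem_blockT _ _ _ _ _ _ hS⟩
        · exact ⟨hS, fun i => Iff.rfl⟩
      have k1 := key y _ h1
      have k2 := key y' _ h2
      exact ⟨k1.1, k2.1, fun i => by rw [k1.2 i, k2.2 i]; exact h3 i⟩

lemma FT_pred (y y' : ℕ → Fin K → ℝ) (t : ℕ) (hy : ∀ s < t, y s = y' s) (i : Fin K) :
    t ∈ FT g T C η n R Mn y i ↔ t ∈ FT g T C η n R Mn y' i := by
  rcases run_pred g T C η n R Mn y y' t hy n with h | ⟨h1, h2, h3⟩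
  · rw [FT, FT, h]
  · rw [FT, FT, seFinal_eq, seFinal_eq, mem_blockT _ _ _ _ _ _ h1, mem_blockT _ _ _ _ _ _ h2]
    exact h3 i

def asgP (ω : Fin n → Fin K → ℝ) (t : Fin n) : Option (Fin K) :=
  if h : ∃ i, (t : ℕ) ∈ FT g T C η n R Mn (Yext ω) i then some h.choose else none

lemma asgP_iff (ω : Fin n → Fin K → ℝ) (t : Fin n) (i : Fin K) :
    asgP g T C η n R Mn ω t = some i ↔ (t : ℕ) ∈ FT g T C η n R Mn (Yext ω) i := by
  unfold asgP
  split_ifs with h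
  · simp only [Option.some.injEq]
    constructor
    · rintro rfl; exact h.choose_spec
    · intro hi; exact (FT_WF g T C η n R Mn (Yext ω)).2.2 _ _ _ h.choose_spec hi
  · simp only [reduceCtorEq, false_iff]
    exact fun hi => h ⟨i, hi⟩

lemma asgP_pred (t : Fin n) (ω ω' : Fin n → Fin K → ℝ) (h : ∀ s, s < t → ω s = ω' s) :
    asgP g T C η n R Mn ω t = asgP g T C η n R Mn ω' t := by
  have key : ∀ i, asgP g T C η n R Mn ω t = some i ↔ asgP g T C η n R Mn ω' t = some i := by
    intro i
    rw [asgP_iff, asgP_iff]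
    refine FT_pred g T C η n R Mn _ _ t (fun s hs => ?_) i
    have hsn : s < n := hs.trans t.2
    simp only [Yext, hsn, dif_pos]
    exact h ⟨s, hsn⟩ hs
  exact Option.ext key

lemma FT_out (ω : Fin n → Fin K → ℝ) (i : Fin K) :
    (FT g T C η n R Mn (Yext ω) i).map (fun s => Yext ω s i)
      = outL (asgP g T C η n R Mn ω) ω i := by
  have wf := FT_WF g T C η n R Mn (Yext ω)
  have e : FT g T C η n R Mn (Yext ω) i
      = (List.range n).filter (fun s => s ∈ FT g T C η n R Mn (Yext ω) i) := by
    refine List.Perm.eq_of_pairwise (le := (· < ·)) ?_ (wf.1 i) ((List.pairwise_lt_range).filter _) ?_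
    · intro a b _ _ h1 h2; omega
    · rw [List.perm_ext_iff_of_nodup ((wf.1 i).imp (fun h => Nat.ne_of_lt h))
        ((List.nodup_range).filter _)]
      intro s
      simp only [List.mem_filter, List.mem_range, decide_eq_true_eq]
      exact ⟨fun h => ⟨wf.2.1 i s h, h⟩, fun h => h.2⟩
  rw [e, ← List.map_coe_finRange_eq_range, List.filter_map, List.map_map, outL]
  have e2 : (List.finRange n).filter ((fun s => decide (s ∈ FT g T C η n R Mn (Yext ω) i)) ∘ fun (i : Fin n) => (i : ℕ))
      = (List.finRange n).filter fun t => asgP g T C η n R Mn ω t = some i := by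
    refine List.filter_congr fun t _ => ?_
    simp only [Function.comp, asgP_iff]
  rw [e2]
  refine List.map_congr_left fun t _ => ?_
  simp [Yext]

end policy2


def empL (x : List ℝ) (z : ℝ) : ℝ := (x.map fun s => if s ≤ z then (1 : ℝ) else 0).sum / x.length

lemma empOf_eq {K : ℕ} (y : ℕ → Fin K → ℝ) (times : Fin K → List ℕ) (i : Fin K) :
    empOf y times i = empL ((times i).map fun s => y s i) := by
  funext z
  simp [empOf, empL, Function.comp_def]

lemma empL_cdf (a b : ℝ) (x : List ℝ) (hx : x ≠ []) (h : ∀ s ∈ x, a ≤ s ∧ s ≤ b) :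
    IsCdfOn a b (empL x) := by
  have hl : (0:ℝ) < x.length := by
    have := List.length_pos_of_ne_nil hx
    exact_mod_cast this
  refine ⟨?_, ?_, ?_, ?_⟩
  · intro z z' hz
    simp only [empL]
    refine div_le_div_of_nonneg_right ?_ hl.le
    refine List.sum_le_sum fun s _ => ?_
    split_ifs with h1 h2
    · exact le_rfl
    · exact absurd (h1.trans hz) h2
    · exact zero_le_one
    · exact le_rfl
  · intro z
    have h0 : ContinuousWithinAt (fun z => (x.map fun s => if s ≤ z then (1 : ℝ) else 0).sum) (Ici z) z := by
      clear hx h hl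
      induction x with
      | nil => simpa using continuousWithinAt_const
      | cons s x ih =>
        simp only [List.map_cons, List.sum_cons]
        refine ContinuousWithinAt.add ?_ ih
        rcases le_or_gt s z with h | h
        · refine (continuousWithinAt_const (b := (1:ℝ))).congr ?_ ?_
          · intro y hy; simp [h.trans (mem_Ici.1 hy)]
          · simp [h]
        · refine ContinuousAt.continuousWithinAt ?_
          refine (continuousAt_const (y := (0:ℝ))).congr ?_
          filter_upwards [Iio_mem_nhds h] with y hy
          simp [mem_Iio.1 hy]
    exact h0.div_const _
  · intro z hz
    have : x.map (fun s => if s ≤ z then (1 : ℝ) else 0) = x.map fun _ => 0 := by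
      refine List.map_congr_left fun s hs => ?_
      rw [if_neg]; have := (h s hs).1; linarith
    simp [empL, this]
  · intro z hz
    have : x.map (fun s => if s ≤ z then (1 : ℝ) else 0) = x.map fun _ => 1 := by
      refine List.map_congr_left fun s hs => ?_
      rw [if_pos]; have := (h s hs).2; linarith
    simp [empL, this, hl.ne']

lemma IsCdfOn.bounds {a b : ℝ} {F : ℝ → ℝ} (h : IsCdfOn a b F) (x : ℝ) : 0 ≤ F x ∧ F x ≤ 1 := by
  constructor
  · have h1 := h.2.2.1 (min x (a - 1)) (by have := min_le_right x (a - 1); linarith)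
    rw [← h1]; exact h.1 (min_le_left _ _)
  · have h1 := h.2.2.2 (max x b) (le_max_right _ _)
    rw [← h1]; exact h.1 (le_max_left _ _)

lemma supDist_bdd {a b : ℝ} {F G : ℝ → ℝ} (hF : IsCdfOn a b F) (hG : IsCdfOn a b G) :
    BddAbove (range fun x : ℝ => |F x - G x|) := by
  refine ⟨1, ?_⟩
  rintro _ ⟨x, rfl⟩
  have := hF.bounds x
  have := hG.bounds x
  simp only [abs_le]
  constructor <;> linarith

lemma supDist_nonneg (F G : ℝ → ℝ) : 0 ≤ supDist F G := Real.iSup_nonneg fun _ => abs_nonneg _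

lemma supDist_le_one {a b : ℝ} {F G : ℝ → ℝ} (hF : IsCdfOn a b F) (hG : IsCdfOn a b G) :
    supDist F G ≤ 1 := by
  refine ciSup_le fun x => ?_
  have := hF.bounds x
  have := hG.bounds x
  simp only [abs_le]
  constructor <;> linarith

lemma mix_mem {K : ℕ} {D : Set (ℝ → ℝ)} (hD : Convex ℝ D) {δ : Fin K → ℝ}
    (hδ : δ ∈ stdSimplex ℝ (Fin K)) {F : Fin K → ℝ → ℝ} (hF : ∀ i, F i ∈ D) : mix δ F ∈ D := by
  have := hD.sum_mem (t := Finset.univ) (w := δ) (z := F) (fun i _ => hδ.1 i) hδ.2 (fun i _ => hF i)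
  convert this using 1
  funext x
  simp [mix]

lemma mix_cdf {K : ℕ} {a b : ℝ} {δ : Fin K → ℝ}
    (hδ : δ ∈ stdSimplex ℝ (Fin K)) {F : Fin K → ℝ → ℝ}
    (hF : ∀ i, δ i ≠ 0 → IsCdfOn a b (F i)) : IsCdfOn a b (mix δ F) := by
  refine ⟨?_, ?_, ?_, ?_⟩
  · intro x x' h
    refine Finset.sum_le_sum fun i _ => ?_
    by_cases h0 : δ i = 0
    · simp [h0]
    · exact mul_le_mul_of_nonneg_left ((hF i h0).1 h) (hδ.1 i)
  · intro x
    refine tendsto_finsetSum (f := fun i x => δ i * F i x) _ fun i _ => ?_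
    change ContinuousWithinAt (fun x => δ i * F i x) (Ici x) x
    by_cases h0 : δ i = 0
    · simp only [h0, zero_mul]; exact continuousWithinAt_const
    · exact continuousWithinAt_const.mul ((hF i h0).2.1 x)
  · intro x hx
    refine Finset.sum_eq_zero fun i _ => ?_
    by_cases h0 : δ i = 0
    · simp [h0]
    · rw [(hF i h0).2.2.1 x hx, mul_zero]
  · intro x hx
    rw [← hδ.2]
    refine Finset.sum_congr rfl fun i _ => ?_
    by_cases h0 : δ i = 0
    · simp [h0]
    · rw [(hF i h0).2.2.2 x hx, mul_one]

lemma T_app {K m : ℕ} {a b : ℝ} {T : (ℝ → ℝ) → ℝ} {D : Set (ℝ → ℝ)}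
    (hDcdf : ∀ F ∈ D, IsCdfOn a b F) (hDconv : Convex ℝ D) {C : ℝ} (hC : 0 < C)
    (hLip : LipschitzAssumption a b T D C) (g : Fin K → Fin m) {F Fh : Fin K → ℝ → ℝ}
    (hF : ∀ i, F i ∈ D) {δ : Fin K → ℝ} (hδ : δ ∈ stdSimplex ℝ (Fin K)) {j : Fin m}
    (hj : GroupSupported g j δ) (hFh : ∀ i, g i = j → IsCdfOn a b (Fh i)) :
    ∃ i, g i = j ∧ |T (mix δ Fh) - T (mix δ F)| ≤ C * supDist (F i) (Fh i) := by
  have hsup : ∀ i, δ i ≠ 0 → g i = j := fun i h => by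
    by_contra hne; exact h (hj i hne)
  have hne : (Finset.univ.filter fun i => δ i ≠ 0).Nonempty := by
    by_contra hcon
    rw [Finset.not_nonempty_iff_eq_empty] at hcon
    have : ∑ i, δ i = 0 := Finset.sum_eq_zero fun i _ => by
      by_contra h
      have : i ∈ (Finset.univ.filter fun i => δ i ≠ 0) := by simp [h]
      rw [hcon] at this; simp at this
    rw [hδ.2] at this; norm_num at this
  obtain ⟨i, hi, hmax⟩ := Finset.exists_max_image _ (fun i => supDist (F i) (Fh i)) hne
  simp only [Finset.mem_filter, Finset.mem_univ, true_and] at hi hmax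
  refine ⟨i, hsup i hi, ?_⟩
  rw [abs_sub_comm]
  refine (hLip _ (mix_mem hDconv hδ hF) _ (mix_cdf hδ fun i h => hFh i (hsup i h))).trans ?_
  refine mul_le_mul_of_nonneg_left ?_ hC.le
  refine ciSup_le fun x => ?_
  simp only [mix]
  rw [← Finset.sum_sub_distrib]
  refine (Finset.abs_sum_le_sum_abs _ _).trans ?_
  calc ∑ k, |δ k * F k x - δ k * Fh k x| ≤ ∑ k, δ k * supDist (F i) (Fh i) := by
        refine Finset.sum_le_sum fun k _ => ?_
        rw [← mul_sub, abs_mul, abs_of_nonneg (hδ.1 k)]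
        by_cases h0 : δ k = 0
        · simp [h0]
        · refine mul_le_mul_of_nonneg_left (le_trans ?_ (hmax k h0)) (hδ.1 k)
          exact le_ciSup (supDist_bdd (hDcdf _ (hF k)) (hFh k (hsup k h0))) x
    _ = supDist (F i) (Fh i) := by rw [← Finset.sum_mul, hδ.2, one_mul]

lemma lexMinArgmax_spec {K : ℕ} (S : Finset (Fin K → ℝ)) (f : (Fin K → ℝ) → ℝ) (hS : S.Nonempty) :
    lexMinArgmax S f ∈ S ∧ ∀ γ ∈ S, f γ ≤ f (lexMinArgmax S f) := by
  obtain ⟨δ, hδ, hmax⟩ := Finset.exists_max_image S f hS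
  have hne : (S.filter fun δ => ∀ γ ∈ S, f γ ≤ f δ).Nonempty :=
    ⟨δ, Finset.mem_filter.2 ⟨hδ, hmax⟩⟩
  have key : lexMinArgmax S f ∈ S.filter fun δ => ∀ γ ∈ S, f γ ≤ f δ := by
    unfold lexMinArgmax
    simp only [hne, dif_pos]
    have h := Finset.min'_mem ((S.filter fun δ => ∀ γ ∈ S, f γ ≤ f δ).image toLex) (hne.image _)
    obtain ⟨w, hw, hwe⟩ := Finset.mem_image.1 h
    rw [← hwe]
    exact hw
  exact Finset.mem_filter.1 key

lemma uEta_nonneg {C : ℝ} (hC : 0 < C) (η : ℝ) (r n K : ℕ) : 0 ≤ uEta C η r n K :=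
  mul_nonneg hC.le (Real.sqrt_nonneg _)


/-- loss of one elimination round in terms of the final outcome lists -/
def lossR {K : ℕ} (F : Fin K → ℝ → ℝ) (C : ℝ) (u : ℝ) (r : ℕ) (out : Fin K → List ℝ) : ℝ :=
  ∑ i, ∑ i', if i ≠ i' ∧ r ≤ (out i).length ∧ r ≤ (out i').length then
    max 0 (C * supDist (F i) (empL ((out i).take r)) + C * supDist (F i') (empL ((out i').take r)) - u)
    else 0

lemma lossR_nonneg {K : ℕ} (F : Fin K → ℝ → ℝ) (C : ℝ) (u : ℝ) (r : ℕ) (out : Fin K → List ℝ) :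
    0 ≤ lossR F C u r out :=
  Finset.sum_nonneg fun _ _ => Finset.sum_nonneg fun _ _ => by split_ifs <;> simp

lemma elimAct_sub {K m : ℕ} (g : Fin K → Fin m) (T : (ℝ → ℝ) → ℝ) (C η : ℝ) (n : ℕ)
    (R : Finset ℕ) (y : ℕ → Fin K → ℝ) (r : ℕ) (S : SEState K m) (j : Fin m) :
    elimAct g T C η n R y r S j ⊆ S.act j := by
  unfold elimAct
  split_ifs
  · exact Finset.filter_subset _ _
  · exact Finset.Subset.refl _

theorem pathwise {K m : ℕ} {a b : ℝ} {T : (ℝ → ℝ) → ℝ} {D : Set (ℝ → ℝ)}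
    (hDcdf : ∀ F ∈ D, IsCdfOn a b F) (hDconv : Convex ℝ D) {C : ℝ} (hC : 0 < C)
    (hLip : LipschitzAssumption a b T D C) (g : Fin K → Fin m) (hg : Function.Surjective g)
    (η : ℝ) (n : ℕ) (hn : 2 * K ≤ n) (R : Finset ℕ) (hR : ∀ r ∈ R, 1 ≤ r ∧ r ≤ n / 2)
    (Mn : Finset (Fin K → ℝ)) (hMn : (Mn : Set (Fin K → ℝ)) ⊆ stdSimplex ℝ (Fin K))
    (hMng : ∀ δ ∈ Mn, ∃ j, GroupSupported g j δ)
    (F : Fin K → ℝ → ℝ) (hF : ∀ i, F i ∈ D)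
    (y : ℕ → Fin K → ℝ) (hy : ∀ s < n, ∀ i, a ≤ y s i ∧ y s i ≤ b)
    (out : Fin K → List ℝ)
    (hout : ∀ i, out i = (FT g T C η n R Mn y i).map fun s => y s i)
    (δ : Fin K → ℝ) (hδ : δ ∈ Mn) :
    seRecommendation g T C η n R Mn y ∈ Mn ∧
    ∃ i i', n / K ≤ (out i).length ∧ n / K ≤ (out i').length ∧
      T (mix δ F) ≤ T (mix (seRecommendation g T C η n R Mn y) F)
        + ∑ r ∈ R, lossR F C (uEta C η r n K) r out
        + (C * supDist (F i) (empL (out i)) + C * supDist (F i') (empL (out i'))) := by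
  have hKpos : 0 < K := by
    obtain ⟨j, _⟩ := hMng δ hδ
    obtain ⟨i, _⟩ := hg j
    exact i.pos
  have houtab : ∀ i, ∀ s ∈ out i, a ≤ s ∧ s ≤ b := by
    intro i s hs
    rw [hout] at hs
    obtain ⟨t, ht, rfl⟩ := List.mem_map.1 hs
    exact hy t ((FT_WF g T C η n R Mn y).2.1 i t ht) i
  set S : ℕ → SEState K m := seRun g T C η n R Mn y with hS
  have hSs : ∀ k, S (k + 1) = seStep g T C η n R y k (S k) := fun k => rfl
  have main : ∀ k ≤ n,
      (((∀ i ∈ actI g (S k), ((S k).times i).length = k) ∧ (S k).t ≤ K * k ∧ k ≤ (S k).t) ∨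
        ∃ ρ < k, (∀ i ∈ actI g (S k), ((S k).times i).length = ρ) ∧
          n - (S k).t < (actI g (S k)).card ∧ (S k).t ≤ K * ρ) ∧
      (∀ j, ∀ γ ∈ (S k).act j, γ ∈ Mn ∧ GroupSupported g j γ) ∧
      (∀ δ ∈ Mn, ∃ j, ∃ δ' ∈ (S k).act j, T (mix δ F) ≤ T (mix δ' F)
        + ∑ r ∈ R.filter (· ≤ k), lossR F C (uEta C η r n K) r out) := by
    intro k hk
    induction k with
    | zero =>
      refine ⟨Or.inl ⟨fun i _ => by simp [hS, seRun], by simp [hS, seRun], by simp⟩, ?_, ?_⟩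
      · intro j γ hγ
        simpa [hS, seRun] using hγ
      · intro δ hδ
        obtain ⟨j, hj⟩ := hMng δ hδ
        refine ⟨j, δ, by simp [hS, seRun, hδ, hj], ?_⟩
        have : 0 ≤ ∑ r ∈ R.filter (· ≤ 0), lossR F C (uEta C η r n K) r out :=
          Finset.sum_nonneg fun _ _ => lossR_nonneg _ _ _ _ _
        linarith
    | succ k ih =>
      obtain ⟨h1, h2, h3⟩ := ih (by omega)
      have hmono : ∑ r ∈ R.filter (· ≤ k), lossR F C (uEta C η r n K) r out
          ≤ ∑ r ∈ R.filter (· ≤ k + 1), lossR F C (uEta C η r n K) r out := by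
        refine Finset.sum_le_sum_of_subset_of_nonneg ?_ fun _ _ _ => lossR_nonneg _ _ _ _ _
        exact Finset.monotone_filter_right _ fun r _ h => by omega
      by_cases hc : (actI g (S k)).card ≤ n - (S k).t
      swap
      · have e : S (k + 1) = S k := by rw [hSs, seStep_eq, if_neg hc]
        rw [e]
        refine ⟨Or.inr ?_, h2, ?_⟩
        · rcases h1 with ⟨h1, h1', _⟩ | ⟨ρ, hρ, h1, h1'⟩
          · exact ⟨k, by omega, h1, by omega, h1'⟩
          · exact ⟨ρ, by omega, h1, h1'⟩
        · intro δ hδ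
          obtain ⟨j, δ', hδ', hV⟩ := h3 δ hδ
          exact ⟨j, δ', hδ', by linarith⟩
      have e : S (k + 1) = ⟨(S k).t + (actI g (S k)).card,
        blockT (actI g (S k)) (S k).t (actI g (S k)).card (S k).times,
        elimAct g T C η n R y k (S k)⟩ := by rw [hSs, seStep_eq, if_pos hc]
      rcases h1 with ⟨h1, h1', h1''⟩ | ⟨ρ, hρ, h1, h1', _⟩
      swap
      · omega
      have hlen : ∀ i ∈ actI g (S k), ((S (k + 1)).times i).length = k + 1 := by
        intro i hi
        rw [e]
        simp only [blockT]
        rw [if_pos ⟨hi, rk_lt hi⟩]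
        simp [h1 i hi]
      have htake : ∀ i ∈ actI g (S k), k + 1 ≤ (out i).length ∧
          empOf y (S (k + 1)).times i = empL ((out i).take (k + 1)) := by
        intro i hi
        have hp : (S (k + 1)).times i <+: FT g T C η n R Mn y i :=
          run_prefix_FT g T C η n R Mn y hk i
        have hl := hlen i hi
        constructor
        · rw [hout, List.length_map, ← hl]
          exact hp.length_le
        · rw [empOf_eq, List.prefix_iff_eq_take.1 hp, hl, hout, List.map_take]
      have hsub : ∀ j, (S (k + 1)).act j ⊆ (S k).act j := by
        intro j; rw [e]; exact elimAct_sub g T C η n R y k (S k) j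
      have hsubI : actI g (S (k + 1)) ⊆ actI g (S k) := by
        intro i hi
        simp only [actI, Finset.mem_filter, Finset.mem_univ, true_and] at hi ⊢
        exact hi.mono (hsub _)
      have hIne : (actI g (S k)).Nonempty := by
        obtain ⟨j, δ', hδ', _⟩ := h3 δ hδ
        obtain ⟨i, rfl⟩ := hg j
        exact ⟨i, by simp only [actI, Finset.mem_filter, Finset.mem_univ, true_and]; exact ⟨δ', hδ'⟩⟩
      have hIcard : (actI g (S k)).card ≤ K := by
        have := Finset.card_le_univ (actI g (S k)); simpa using this
      refine ⟨Or.inl ⟨fun i hi => hlen i (hsubI hi), ?_, ?_⟩, fun j γ hγ => h2 j γ (hsub j hγ), ?_⟩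
      · rw [e]; simp only; rw [Nat.mul_add]; omega
      · rw [e]; simp only; have := hIne.card_pos; omega
      · intro δ hδ
        obtain ⟨j, δ', hδ', hV⟩ := h3 δ hδ
        by_cases hel : (k + 1) ∈ R ∧ 2 ≤ (Finset.univ.filter fun j => ((S k).act j).Nonempty).card
        swap
        · refine ⟨j, δ', ?_, by linarith⟩
          rw [e]
          simp only [elimAct]
          rw [if_neg hel]
          exact hδ'
        have hbl : blockT (actI g (S k)) (S k).t (actI g (S k)).card (S k).times = (S (k + 1)).times := by
          rw [e]
        have hactiff : ∀ j γ, γ ∈ (S (k + 1)).act j ↔ γ ∈ (S k).act j ∧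
            ¬ (sSup ((fun δ => T (mix δ (empOf y (S (k + 1)).times))) '' (⋃ l ∈
              (Finset.univ.filter fun j => ((S k).act j).Nonempty).erase j, ((S k).act l : Set (Fin K → ℝ))))
              > (fun δ => T (mix δ (empOf y (S (k + 1)).times))) γ + uEta C η (k + 1) n K) := by
          intro j γ
          rw [← hbl, e]
          simp only [elimAct]
          rw [if_pos hel, Finset.mem_filter]
        obtain ⟨j', δ'', hδ'', hV'⟩ := elim_round g (S k).act (S (k + 1)).act
          (fun δ => T (mix δ (empOf y (S (k + 1)).times))) (fun δ => T (mix δ F))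
          (uEta C η (k + 1) n K) (uEta_nonneg hC _ _ _ _)
          (fun i => C * supDist (F i) (empOf y (S (k + 1)).times i))
          _ rfl hel.2 hactiff (by
            intro j γ hγ
            refine T_app hDcdf hDconv hC hLip g hF (hMn (h2 j γ hγ).1) (h2 j γ hγ).2 ?_
            intro i hi
            have hiI : i ∈ actI g (S k) := by
              simp only [actI, Finset.mem_filter, Finset.mem_univ, true_and]
              rw [hi]; exact ⟨γ, hγ⟩
            rw [(htake i hiI).2]
            refine empL_cdf a b _ ?_ fun s hs => houtab i s (List.mem_of_mem_take hs)
            have := (htake i hiI).1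
            rw [← List.length_pos_iff, List.length_take]
            omega) j δ' hδ'
        refine ⟨j', δ'', hδ'', ?_⟩
        have hloss : (∑ i, ∑ i', if i ≠ i' ∧ ((S k).act (g i)).Nonempty ∧ ((S k).act (g i')).Nonempty
            then max 0 (C * supDist (F i) (empOf y (S (k + 1)).times i)
              + C * supDist (F i') (empOf y (S (k + 1)).times i') - uEta C η (k + 1) n K) else 0)
            ≤ lossR F C (uEta C η (k + 1) n K) (k + 1) out := by
          refine Finset.sum_le_sum fun i _ => Finset.sum_le_sum fun i' _ => ?_
          split_ifs with c1 c2 c2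
          · rw [(htake i (by simp only [actI, Finset.mem_filter, Finset.mem_univ, true_and]; exact c1.2.1)).2,
              (htake i' (by simp only [actI, Finset.mem_filter, Finset.mem_univ, true_and]; exact c1.2.2)).2]
          · exact absurd ⟨c1.1,
              (htake i (by simp only [actI, Finset.mem_filter, Finset.mem_univ, true_and]; exact c1.2.1)).1,
              (htake i' (by simp only [actI, Finset.mem_filter, Finset.mem_univ, true_and]; exact c1.2.2)).1⟩ c2
          · exact le_max_left _ _
          · exact le_rfl
        have hsum : ∑ r ∈ R.filter (· ≤ k), lossR F C (uEta C η r n K) r out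
            + lossR F C (uEta C η (k + 1) n K) (k + 1) out
            ≤ ∑ r ∈ R.filter (· ≤ k + 1), lossR F C (uEta C η r n K) r out := by
          rw [add_comm, ← Finset.sum_insert (f := fun r => lossR F C (uEta C η r n K) r out)
            (a := k + 1) (by simp)]
          refine Finset.sum_le_sum_of_subset_of_nonneg ?_ fun _ _ _ => lossR_nonneg _ _ _ _ _
          intro r hr
          simp only [Finset.mem_insert, Finset.mem_filter] at hr ⊢
          rcases hr with rfl | hr
          · exact ⟨hel.1, le_rfl⟩
          · exact ⟨hr.1, by omega⟩
        linarith
  obtain ⟨h1, h2, h3⟩ := main n le_rfl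
  obtain ⟨j, δ', hδ', hV⟩ := h3 δ hδ
  have hlenI : ∀ i ∈ actI g (S n), n / K ≤ (out i).length := by
    intro i hi
    have hp : (S n).times i <+: FT g T C η n R Mn y i := run_prefix_FT g T C η n R Mn y le_rfl i
    have hl := hp.length_le
    rw [hout, List.length_map]
    refine le_trans ?_ hl
    rcases h1 with ⟨h1, h1', h1''⟩ | ⟨ρ, hρ, h1, h1', h1''⟩
    · rw [h1 i hi]; exact Nat.div_le_self _ _
    · rw [h1 i hi]
      have hIcard : (actI g (S n)).card ≤ K := by
        have := Finset.card_le_univ (actI g (S n)); simpa using this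
      have : n < K * (ρ + 1) := by rw [Nat.mul_add]; omega
      have := (Nat.div_lt_iff_lt_mul hKpos).2 (by rwa [mul_comm] at this)
      omega
  have hr0 : 1 ≤ n / K := by
    rw [Nat.le_div_iff_mul_le hKpos]; omega
  have hEmp : ∀ i, empOf y (seFinalTimes g n (S n)) i = empL (out i) := by
    intro i
    rw [empOf_eq, hout]; rfl
  have happ : ∀ j, ∀ γ ∈ (S n).act j, ∃ i, n / K ≤ (out i).length ∧
      |T (mix γ (empOf y (seFinalTimes g n (S n)))) - T (mix γ F)|
        ≤ C * supDist (F i) (empL (out i)) := by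
    intro j γ hγ
    have hI : ∀ i, g i = j → i ∈ actI g (S n) := by
      intro i hi
      simp only [actI, Finset.mem_filter, Finset.mem_univ, true_and]
      rw [hi]; exact ⟨γ, hγ⟩
    obtain ⟨i, hi, hA⟩ := T_app hDcdf hDconv hC hLip g hF (hMn (h2 j γ hγ).1) (h2 j γ hγ).2
      (Fh := empOf y (seFinalTimes g n (S n))) (by
        intro i hi
        rw [hEmp]
        refine empL_cdf a b _ ?_ (houtab i)
        have := hlenI i (hI i hi)
        rw [← List.length_pos_iff]
        omega)
    rw [hEmp] at hA
    exact ⟨i, hlenI i (hI i hi), hA⟩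
  obtain ⟨hmem, hmax⟩ := lexMinArgmax_spec (Finset.univ.biUnion (S n).act)
    (fun δ => T (mix δ (empOf y (seFinalTimes g n (S n)))))
    ⟨δ', Finset.mem_biUnion.2 ⟨j, Finset.mem_univ _, hδ'⟩⟩
  change seRecommendation g T C η n R Mn y ∈ _ at hmem
  have hmax' := hmax δ' (Finset.mem_biUnion.2 ⟨j, Finset.mem_univ _, hδ'⟩)
  change _ ≤ T (mix (seRecommendation g T C η n R Mn y) (empOf y (seFinalTimes g n (S n)))) at hmax'
  obtain ⟨jh, _, hjh⟩ := Finset.mem_biUnion.1 hmem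
  refine ⟨(h2 jh _ hjh).1, ?_⟩
  obtain ⟨i, hi, hA⟩ := happ j δ' hδ'
  obtain ⟨i', hi', hA'⟩ := happ jh _ hjh
  refine ⟨i, i', hi, hi', ?_⟩
  have hRn : R.filter (· ≤ n) = R := by
    refine Finset.filter_true_of_mem fun r hr => ?_
    have := (hR r hr).2
    omega
  rw [hRn] at hV
  have := abs_le.1 hA
  have := abs_le.1 hA'
  linarith [(abs_le.1 hA).1, (abs_le.1 hA').2]


lemma Sz_eq (P : Measure ℝ) (x : List ℝ) (hx : x ≠ []) (z : ℝ) :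
    Sz P x z = x.length * (empL x z - P.real (Iic z)) := by
  have hl : (x.length : ℝ) ≠ 0 := by
    have := List.length_pos_of_ne_nil hx
    exact_mod_cast this.ne'
  have h : ∀ l : List ℝ, Sz P l z = (l.map fun s => if s ≤ z then (1:ℝ) else 0).sum
      - l.length * P.real (Iic z) := by
    intro l
    induction l with
    | nil => simp [Sz]
    | cons s l ih =>
      simp only [Sz, List.map_cons, List.sum_cons, List.length_cons, Nat.cast_add, Nat.cast_one] at ih ⊢
      rw [ih]; ring
  rw [h, empL]
  field_simp

lemma dev_exp (P : Measure ℝ) (F : ℝ → ℝ) (hF : ∀ z, F z = P.real (Iic z)) (x : List ℝ)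
    (hx : x ≠ []) (θ : ℝ) (hθ : 0 < θ) (c : ENNReal)
    (hc : ∀ z, ENNReal.ofReal (Real.exp (θ * |Sz P x z|)) ≤ c) :
    ENNReal.ofReal (Real.exp (θ * x.length * supDist F (empL x))) ≤ c := by
  have hl : (0:ℝ) < x.length := by
    have := List.length_pos_of_ne_nil hx
    exact_mod_cast this
  rcases eq_or_ne c ⊤ with h | h
  · rw [h]; exact le_top
  have hM : ∀ z, Real.exp (θ * |Sz P x z|) ≤ c.toReal := fun z =>
    (ENNReal.ofReal_le_iff_le_toReal h).1 (hc z)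
  have hpos : 0 < c.toReal := lt_of_lt_of_le (Real.exp_pos _) (hM 0)
  rw [ENNReal.ofReal_le_iff_le_toReal h, ← Real.le_log_iff_exp_le hpos]
  have : supDist F (empL x) ≤ Real.log c.toReal / (θ * x.length) := by
    refine ciSup_le fun z => ?_
    rw [le_div_iff₀ (mul_pos hθ hl), hF z]
    have h1 := (Real.le_log_iff_exp_le hpos).2 (hM z)
    rw [Sz_eq P x hx, abs_mul, abs_of_pos hl, abs_sub_comm] at h1
    linarith
  rw [le_div_iff₀ (mul_pos hθ hl)] at this
  linarith

lemma lin_max (μ y : ℝ) (hμ : 0 < μ) : max 0 y ≤ Real.exp (μ * y - 1) / μ := by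
  refine max_le (by positivity) ?_
  rw [le_div_iff₀ hμ]
  linarith [Real.add_one_le_exp (μ * y - 1)]

/-- per-round elimination bound -/
def elimB (c2 ρ s : ℝ) (r : ℕ) : ℝ :=
  c2 ^ 2 * (ρ ^ 2 / (2 * Real.exp 1 * (r * s))) * Real.exp (-(r * s ^ 2 / ρ ^ 2))

section prob
variable {K : ℕ} (ν : Measure (Fin K → ℝ)) [IsProbabilityMeasure ν]
  (F : Fin K → ℝ → ℝ) (hF : ∀ i z, F i z = (ν.map fun e => e i).real (Iic z))

include hF in
lemma elim_G (r : ℕ) (hr : 1 ≤ r) (Nb : ℕ) (ρ : ℝ) (hρ1 : 1 ≤ ρ) (hρ : 2 ≤ ρ ^ Nb)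
    (C s : ℝ) (hC : 0 < C) (hs : 0 < s) :
    ∃ G : (Fin K → List ℝ) → ENNReal, SupG ν G ∧
      (∀ ℓ, ENNReal.ofReal (lossR F C (C * s) r ℓ) ≤ G ℓ) ∧
      G (fun _ => []) ≤ ENNReal.ofReal (K ^ 2 * (C * elimB (1 + 16 * Nb) ρ s r)) := by
  have hprob : ∀ i : Fin K, IsProbabilityMeasure (ν.map fun e => e i) := fun i =>
    Measure.isProbabilityMeasure_map (measurable_pi_apply i).aemeasurable
  have hr' : (0:ℝ) < r := by exact_mod_cast hr
  have hρ0 : 0 < ρ := by linarith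
  set μ : ℝ := 2 * r * s / ρ ^ 2 with hμ
  have hμ0 : 0 < μ := by positivity
  have hex := fun i : Fin K => good_exists (ν.map fun e => e i) r Nb ρ hρ1 hρ (μ / r) (by positivity)
  choose Ψ hΨ1 hΨ2 hΨ3 using hex
  set c : ℝ := C * (Real.exp (-(μ * s) - 1) / μ) with hc
  have hc0 : 0 ≤ c := by positivity
  set B0 : ℝ := (1 + 16 * Nb) * Real.exp (r * (μ / r * ρ) ^ 2 / 8) with hB0
  have hB00 : 0 ≤ B0 := by positivity
  refine ⟨fun ℓ => ∑ i, ∑ i', if i ≠ i' then ENNReal.ofReal c * (Ψ i (ℓ i) * Ψ i' (ℓ i')) else 0,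
    ?_, ?_, ?_⟩
  · refine SupG.sum _ fun i _ => SupG.sum _ fun i' _ => ?_
    by_cases h : i = i'
    · simp only [h, ne_eq, not_true_eq_false, if_false]; exact SupG.const ν 0
    · simp only [h, ne_eq, not_false_eq_true, if_true]
      exact (SupG.pair ν i i' h (hΨ1 i) (hΨ1 i')).mul _
  · intro ℓ
    rw [lossR, ENNReal.ofReal_sum_of_nonneg
      (fun _ _ => Finset.sum_nonneg fun _ _ => by split_ifs <;> simp)]
    refine Finset.sum_le_sum fun i _ => ?_
    rw [ENNReal.ofReal_sum_of_nonneg (fun _ _ => by split_ifs <;> simp)]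
    refine Finset.sum_le_sum fun i' _ => ?_
    by_cases h : i ≠ i' ∧ r ≤ (ℓ i).length ∧ r ≤ (ℓ i').length
    swap
    · rw [if_neg h]; simp
    rw [if_pos h, if_pos h.1]
    have key : ∀ i, r ≤ (ℓ i).length →
        ENNReal.ofReal (Real.exp (μ * supDist (F i) (empL ((ℓ i).take r)))) ≤ Ψ i (ℓ i) := by
      intro i hi
      have hlen : ((ℓ i).take r).length = r := by rw [List.length_take]; omega
      have := dev_exp (ν.map fun e => e i) (F i) (hF i) ((ℓ i).take r)
        (by rw [← List.length_pos_iff, hlen]; omega) (μ / r) (by positivity) (Ψ i (ℓ i))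
        (hΨ2 i (ℓ i))
      rw [hlen] at this
      rwa [div_mul_cancel₀ _ hr'.ne'] at this
    set A := supDist (F i) (empL ((ℓ i).take r))
    set A' := supDist (F i') (empL ((ℓ i').take r))
    have h1 : max 0 (C * A + C * A' - C * s) ≤ c * (Real.exp (μ * A) * Real.exp (μ * A')) := by
      have e1 : max 0 (C * A + C * A' - C * s) = C * max 0 (A + A' - s) := by
        rw [mul_max_of_nonneg _ _ hC.le]; ring_nf
      rw [e1, hc, mul_assoc]
      refine mul_le_mul_of_nonneg_left ((lin_max μ _ hμ0).trans (le_of_eq ?_)) hC.le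
      have h3 : Real.exp (μ * (A + A' - s) - 1)
          = Real.exp (-(μ * s) - 1) * (Real.exp (μ * A) * Real.exp (μ * A')) := by
        rw [← Real.exp_add, ← Real.exp_add]; congr 1; ring
      rw [h3]; ring
    refine (ENNReal.ofReal_le_ofReal h1).trans ?_
    rw [ENNReal.ofReal_mul hc0, ENNReal.ofReal_mul (Real.exp_pos _).le]
    exact mul_le_mul' le_rfl (mul_le_mul' (key i h.2.1) (key i' h.2.2))
  · have e : K ^ 2 * (C * elimB (1 + 16 * Nb) ρ s r) = ∑ i : Fin K, ∑ i' : Fin K, c * (B0 * B0) := by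
      simp only [Finset.sum_const, Finset.card_univ, Fintype.card_fin, nsmul_eq_mul]
      have e2 : Real.exp (-(μ * s) - 1) * (Real.exp (r * (μ / r * ρ) ^ 2 / 8)
          * Real.exp (r * (μ / r * ρ) ^ 2 / 8)) = Real.exp (-(r * s ^ 2 / ρ ^ 2)) / Real.exp 1 := by
        rw [← Real.exp_add, ← Real.exp_add, ← Real.exp_sub]
        congr 1
        rw [hμ]
        field_simp
        ring
      have e3 : c * (B0 * B0) = C * ((1 + 16 * Nb) ^ 2 / μ) * (Real.exp (-(μ * s) - 1) *
          (Real.exp (r * (μ / r * ρ) ^ 2 / 8) * Real.exp (r * (μ / r * ρ) ^ 2 / 8))) := by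
        rw [hc, hB0]; field_simp
      rw [e3, e2, elimB, hμ]
      field_simp
    rw [e, ENNReal.ofReal_sum_of_nonneg (fun _ _ => Finset.sum_nonneg fun _ _ => by positivity)]
    refine Finset.sum_le_sum fun i _ => ?_
    rw [ENNReal.ofReal_sum_of_nonneg (fun _ _ => by positivity)]
    refine Finset.sum_le_sum fun i' _ => ?_
    split_ifs
    · rw [ENNReal.ofReal_mul hc0, ENNReal.ofReal_mul hB00]
      exact mul_le_mul' le_rfl (mul_le_mul' (hΨ3 i) (hΨ3 i'))
    · simp

omit [IsProbabilityMeasure ν] in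
lemma fin_lin (μ Q x : ℝ) (hμ : 0 < μ) (hQ : 0 < Q) :
    x ≤ (Real.log Q - 1) / μ + 1 / (μ * Q) * Real.exp (μ * x) := by
  have h := Real.log_le_sub_one_of_pos (show 0 < Real.exp (μ * x) / Q by positivity)
  rw [Real.log_div (Real.exp_pos _).ne' hQ.ne', Real.log_exp] at h
  have : (Real.log Q - 1) / μ + 1 / (μ * Q) * Real.exp (μ * x)
      = (Real.log Q - 1 + Real.exp (μ * x) / Q) / μ := by field_simp
  rw [this, le_div_iff₀ hμ]
  linarith

lemma fin_gen {ι : Type} (s : Finset ι) (Ψ : ι → (Fin K → List ℝ) → ENNReal)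
    (hΨ : ∀ k ∈ s, SupG ν (Ψ k)) (B0 : ℝ)
    (hB : ∀ k ∈ s, Ψ k (fun _ => []) ≤ ENNReal.ofReal B0) (μ Q : ℝ) (hμ : 0 < μ)
    (hQ : Real.exp 1 ≤ Q) (hQB : s.card * B0 ≤ Q) (hB0 : 0 ≤ B0) :
    ∃ G : (Fin K → List ℝ) → ENNReal, SupG ν G ∧
      (∀ ℓ x, (∃ k ∈ s, ENNReal.ofReal (Real.exp (μ * x)) ≤ Ψ k ℓ) → ENNReal.ofReal x ≤ G ℓ) ∧
      G (fun _ => []) ≤ ENNReal.ofReal (Real.log Q / μ) := by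
  have hQ0 : 0 < Q := lt_of_lt_of_le (Real.exp_pos _) hQ
  have hlQ : 0 ≤ (Real.log Q - 1) / μ := by
    have := (Real.le_log_iff_exp_le hQ0).2 hQ
    exact div_nonneg (by linarith) hμ.le
  have hcoef : 0 ≤ 1 / (μ * Q) := by positivity
  refine ⟨fun ℓ => ENNReal.ofReal ((Real.log Q - 1) / μ) +
    ENNReal.ofReal (1 / (μ * Q)) * ∑ k ∈ s, Ψ k ℓ, ?_, ?_, ?_⟩
  · exact (SupG.const ν _).add ((SupG.sum s hΨ).mul _)
  · rintro ℓ x ⟨k, hk, hx⟩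
    refine (ENNReal.ofReal_le_ofReal (fin_lin μ Q x hμ hQ0)).trans ?_
    rw [ENNReal.ofReal_add hlQ (by positivity), ENNReal.ofReal_mul hcoef]
    refine add_le_add le_rfl (mul_le_mul' le_rfl (hx.trans ?_))
    exact Finset.single_le_sum (f := fun k => Ψ k ℓ) (fun _ _ => zero_le) hk
  · have h1 : ∑ k ∈ s, Ψ k (fun _ => []) ≤ ENNReal.ofReal (s.card * B0) := by
      refine (Finset.sum_le_sum hB).trans (le_of_eq ?_)
      rw [Finset.sum_const, nsmul_eq_mul, ENNReal.ofReal_mul (by positivity), ENNReal.ofReal_natCast]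
    have h2 : ENNReal.ofReal (1 / (μ * Q)) * ∑ k ∈ s, Ψ k (fun _ => [])
        ≤ ENNReal.ofReal (1 / μ) := by
      refine (mul_le_mul' le_rfl (h1.trans (ENNReal.ofReal_le_ofReal hQB))).trans ?_
      rw [← ENNReal.ofReal_mul hcoef]
      refine ENNReal.ofReal_le_ofReal (le_of_eq ?_)
      field_simp
    refine (add_le_add le_rfl h2).trans ?_
    rw [← ENNReal.ofReal_add hlQ (by positivity)]
    refine ENNReal.ofReal_le_ofReal (le_of_eq ?_)
    field_simp
    ring

include hF in
/-- first branch of the final-stage bound -/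
lemma fin_G1 (n r0 : ℕ) (hK : 1 ≤ K) (hr0 : 1 ≤ r0) (hrn : r0 ≤ n) :
    ∃ G : (Fin K → List ℝ) → ENNReal, SupG ν G ∧
      (∀ ℓ i, r0 ≤ (ℓ i).length → (ℓ i).length ≤ n →
        ENNReal.ofReal (supDist (F i) (empL (ℓ i))) ≤ G ℓ) ∧
      G (fun _ => []) ≤ ENNReal.ofReal (Real.sqrt (2 * Real.log (17 * (K * n)) / r0)) := by
  have hprob : ∀ i : Fin K, IsProbabilityMeasure (ν.map fun e => e i) := fun i =>
    Measure.isProbabilityMeasure_map (measurable_pi_apply i).aemeasurable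
  have hr0' : (1:ℝ) ≤ r0 := by exact_mod_cast hr0
  have hK' : (1:ℝ) ≤ K := by exact_mod_cast hK
  have hn' : (1:ℝ) ≤ n := by exact_mod_cast hr0.trans hrn
  have hKn : (1:ℝ) ≤ K * n := by nlinarith
  set L := Real.log (17 * (K * n)) with hL
  have he : Real.exp 1 ≤ 17 * (K * n) := by have := Real.exp_one_lt_d9; linarith
  have hL1 : 1 ≤ L := (Real.le_log_iff_exp_le (by linarith)).2 he
  set μ := Real.sqrt (2 * r0 * L) with hμ
  have hμ0 : 0 < μ := Real.sqrt_pos.2 (by positivity)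
  have hμ2 : μ ^ 2 = 2 * r0 * L := Real.sq_sqrt (by positivity)
  have hex := fun (p : Fin K × ℕ) => good_exists (ν.map fun e => e p.1) p.2 1 2 (by norm_num)
    (by norm_num) (μ / p.2) (by positivity)
  choose Ψ hΨ1 hΨ2 hΨ3 using hex
  obtain ⟨G, hG1, hG2, hG3⟩ := fin_gen ν ((Finset.univ : Finset (Fin K)) ×ˢ Finset.Icc r0 n)
    (fun p ℓ => Ψ p (ℓ p.1)) (fun p _ => SupG.single ν p.1 (hΨ1 p)) (17 * Real.exp L) (by
      intro p hp
      simp only [Finset.mem_product, Finset.mem_Icc] at hp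
      refine (hΨ3 p).trans (ENNReal.ofReal_le_ofReal ?_)
      have hp0 : (r0:ℝ) ≤ p.2 := by exact_mod_cast hp.2.1
      have hp00 : (0:ℝ) < p.2 := by linarith
      have h1 : (1 + 16 * ((1:ℕ):ℝ)) = 17 := by norm_num
      rw [h1]
      refine mul_le_mul_of_nonneg_left (Real.exp_le_exp.2 ?_) (by norm_num)
      have : (p.2:ℝ) * (μ / p.2 * 2) ^ 2 / 8 = μ ^ 2 / (2 * p.2) := by field_simp; norm_num
      rw [this, hμ2, div_le_iff₀ (by positivity)]
      nlinarith) μ (17 * (K * n) * Real.exp L) hμ0 (by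
        have : 1 ≤ Real.exp L := Real.one_le_exp (by linarith)
        nlinarith) (by
        have hcard : (((Finset.univ : Finset (Fin K)) ×ˢ Finset.Icc r0 n).card : ℝ) ≤ K * n := by
          rw [Finset.card_product, Finset.card_univ, Fintype.card_fin, Nat.card_Icc]
          push_cast
          refine mul_le_mul_of_nonneg_left ?_ (by linarith)
          exact_mod_cast (show n + 1 - r0 ≤ n by omega)
        have := mul_le_mul_of_nonneg_right hcard (show 0 ≤ 17 * Real.exp L by positivity)
        linarith) (by positivity)
  refine ⟨G, hG1, ?_, hG3.trans (ENNReal.ofReal_le_ofReal ?_)⟩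
  · intro ℓ i h1 h2
    refine hG2 ℓ _ ⟨(i, (ℓ i).length), by simp [h1, h2], ?_⟩
    have hl : (0:ℝ) < (ℓ i).length := by exact_mod_cast (show 0 < (ℓ i).length by omega)
    have := dev_exp (ν.map fun e => e i) (F i) (hF i) (ℓ i)
        (by rw [← List.length_pos_iff]; omega) (μ / (ℓ i).length) (by positivity)
        (Ψ (i, (ℓ i).length) (ℓ i)) (by
          have := hΨ2 (i, (ℓ i).length) (ℓ i)
          simpa using this)
    rwa [div_mul_cancel₀ _ hl.ne'] at this
  · rw [Real.log_mul (by positivity) (Real.exp_pos _).ne', Real.log_exp, ← hL,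
      div_le_iff₀ hμ0, hμ, ← Real.sqrt_mul (by positivity)]
    refine Real.le_sqrt_of_sq_le (le_of_eq ?_)
    field_simp
    ring

include hF in
/-- second branch of the final-stage bound -/
lemma fin_G2 (n r0 : ℕ) (hK : 1 ≤ K) (hr0 : 1 ≤ r0) (hrn : r0 ≤ n) :
    ∃ G : (Fin K → List ℝ) → ENNReal, SupG ν G ∧
      (∀ ℓ i, r0 ≤ (ℓ i).length → (ℓ i).length ≤ n →
        ENNReal.ofReal (supDist (F i) (empL (ℓ i))) ≤ G ℓ) ∧
      G (fun _ => []) ≤ ENNReal.ofReal (Real.sqrt (2 * n * Real.log (17 * K)) / r0) := by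
  have hprob : ∀ i : Fin K, IsProbabilityMeasure (ν.map fun e => e i) := fun i =>
    Measure.isProbabilityMeasure_map (measurable_pi_apply i).aemeasurable
  have hr0' : (1:ℝ) ≤ r0 := by exact_mod_cast hr0
  have hK' : (1:ℝ) ≤ K := by exact_mod_cast hK
  have hn' : (1:ℝ) ≤ n := by exact_mod_cast hr0.trans hrn
  set L := Real.log (17 * K) with hL
  have he : Real.exp 1 ≤ 17 * K := by have := Real.exp_one_lt_d9; linarith
  have hL1 : 1 ≤ L := (Real.le_log_iff_exp_le (by linarith)).2 he
  set θ := Real.sqrt (2 * L / n) with hθ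
  have hθ0 : 0 < θ := Real.sqrt_pos.2 (by positivity)
  have hθ2 : θ ^ 2 = 2 * L / n := Real.sq_sqrt (by positivity)
  have hex := fun (i : Fin K) => good_exists (ν.map fun e => e i) n 1 2 (by norm_num)
    (by norm_num) θ hθ0.le
  choose Ψ hΨ1 hΨ2 hΨ3 using hex
  obtain ⟨G, hG1, hG2, hG3⟩ := fin_gen ν (Finset.univ : Finset (Fin K))
    (fun i ℓ => Ψ i (ℓ i)) (fun i _ => SupG.single ν i (hΨ1 i)) (17 * Real.exp L) (by
      intro i _
      refine (hΨ3 i).trans (ENNReal.ofReal_le_ofReal (le_of_eq ?_))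
      have h1 : (1 + 16 * ((1:ℕ):ℝ)) = 17 := by norm_num
      rw [h1, mul_pow, hθ2]
      congr 2
      field_simp
      norm_num) (θ * r0) (17 * K * Real.exp L) (by positivity) (by
        have : 1 ≤ Real.exp L := Real.one_le_exp (by linarith)
        nlinarith) (by
        rw [Finset.card_univ, Fintype.card_fin]
        exact le_of_eq (by ring)) (by positivity)
  refine ⟨G, hG1, ?_, hG3.trans (ENNReal.ofReal_le_ofReal ?_)⟩
  · intro ℓ i h1 h2
    refine hG2 ℓ _ ⟨i, Finset.mem_univ _, ?_⟩
    have := dev_exp (ν.map fun e => e i) (F i) (hF i) (ℓ i)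
        (by rw [← List.length_pos_iff]; omega) θ hθ0
        (Ψ i (ℓ i)) (by
          have := hΨ2 i (ℓ i)
          rwa [List.take_of_length_le h2] at this)
    refine le_trans (ENNReal.ofReal_le_ofReal (Real.exp_le_exp.2 ?_)) this
    refine mul_le_mul_of_nonneg_right (mul_le_mul_of_nonneg_left ?_ hθ0.le) (supDist_nonneg _ _)
    exact_mod_cast h1
  · rw [Real.log_mul (by positivity) (Real.exp_pos _).ne', Real.log_exp, ← hL,
      div_le_div_iff₀ (by positivity) (by positivity)]
    have : Real.sqrt (2 * n * L) * θ = 2 * L := by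
      rw [hθ, ← Real.sqrt_mul (by positivity)]
      rw [show 2 * n * L * (2 * L / n) = (2 * L) ^ 2 by field_simp]
      exact Real.sqrt_sq (by positivity)
    nlinarith

end prob


lemma integral_le_of_lint {Ω : Type} [MeasurableSpace Ω] (P : Measure Ω) (f : Ω → ℝ) (B : ℝ) (hB : 0 ≤ B)
    (h : ∫⁻ ω, ENNReal.ofReal (f ω) ∂P ≤ ENNReal.ofReal B) : ∫ ω, f ω ∂P ≤ B := by
  by_cases hf : Integrable f P
  · rw [integral_eq_lintegral_pos_part_sub_lintegral_neg_part hf]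
    have h1 : (∫⁻ ω, ENNReal.ofReal (f ω) ∂P).toReal ≤ B := ENNReal.toReal_le_of_le_ofReal hB h
    have h2 : 0 ≤ (∫⁻ ω, ENNReal.ofReal (-f ω) ∂P).toReal := ENNReal.toReal_nonneg
    linarith
  · rw [integral_undef hf]; exact hB

lemma T_close {K : ℕ} {a b : ℝ} {T : (ℝ → ℝ) → ℝ} {D : Set (ℝ → ℝ)}
    (hDcdf : ∀ F ∈ D, IsCdfOn a b F) (hDconv : Convex ℝ D) {C : ℝ} (hC : 0 < C)
    (hLip : LipschitzAssumption a b T D C) {F : Fin K → ℝ → ℝ}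
    (hF : ∀ i, F i ∈ D) {δ γ : Fin K → ℝ} (hδ : δ ∈ stdSimplex ℝ (Fin K))
    (hγ : γ ∈ stdSimplex ℝ (Fin K)) : |T (mix δ F) - T (mix γ F)| ≤ C := by
  have h1 := mix_mem hDconv hδ hF
  have h2 := mix_mem hDconv hγ hF
  refine (hLip _ h1 _ (hDcdf _ h2)).trans ?_
  have := supDist_le_one (hDcdf _ h1) (hDcdf _ h2)
  nlinarith

lemma T_bdd {K : ℕ} {a b : ℝ} {T : (ℝ → ℝ) → ℝ} {D : Set (ℝ → ℝ)}
    (hDcdf : ∀ F ∈ D, IsCdfOn a b F) (hDconv : Convex ℝ D) {C : ℝ} (hC : 0 < C)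
    (hLip : LipschitzAssumption a b T D C) {F : Fin K → ℝ → ℝ}
    (hF : ∀ i, F i ∈ D) {M : Set (Fin K → ℝ)} (hM : M ⊆ stdSimplex ℝ (Fin K))
    (hne : M.Nonempty) {γ : Fin K → ℝ} (hγ : γ ∈ stdSimplex ℝ (Fin K)) :
    BddAbove ((fun δ => T (mix δ F)) '' M) ∧
    |sSup ((fun δ => T (mix δ F)) '' M) - T (mix γ F)| ≤ C := by
  have hb : ∀ x ∈ (fun δ => T (mix δ F)) '' M, |x - T (mix γ F)| ≤ C := by
    rintro _ ⟨δ, hδ, rfl⟩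
    exact T_close hDcdf hDconv hC hLip hF (hM hδ) hγ
  have hbd : BddAbove ((fun δ => T (mix δ F)) '' M) :=
    ⟨T (mix γ F) + C, fun x hx => by have := (abs_le.1 (hb x hx)).2; linarith⟩
  refine ⟨hbd, ?_⟩
  rw [abs_le]
  constructor
  · obtain ⟨δ, hδ⟩ := hne
    have h1 := le_csSup hbd ⟨δ, hδ, rfl⟩
    have h2 := (abs_le.1 (hb _ ⟨δ, hδ, rfl⟩)).1
    simp only at h1 h2
    linarith
  · have : sSup ((fun δ => T (mix δ F)) '' M) ≤ T (mix γ F) + C :=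
      csSup_le (hne.image _) fun x hx => by have := (abs_le.1 (hb x hx)).2; linarith
    linarith

lemma eps_nonneg {K : ℕ} (T : (ℝ → ℝ) → ℝ) (D : Set (ℝ → ℝ)) (M : Set (Fin K → ℝ))
    (Mn : Finset (Fin K → ℝ)) : 0 ≤ epsOpt T D M Mn :=
  Real.sSup_nonneg (by rintro _ ⟨G, _, rfl⟩; exact abs_nonneg _)

lemma eps_spec {K : ℕ} {a b : ℝ} {T : (ℝ → ℝ) → ℝ} {D : Set (ℝ → ℝ)}
    (hDcdf : ∀ F ∈ D, IsCdfOn a b F) (hDconv : Convex ℝ D) {C : ℝ} (hC : 0 < C)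
    (hLip : LipschitzAssumption a b T D C) {F : Fin K → ℝ → ℝ}
    (hF : ∀ i, F i ∈ D) {M : Set (Fin K → ℝ)} (hM : M ⊆ stdSimplex ℝ (Fin K))
    {Mn : Finset (Fin K → ℝ)} (hMn : (Mn : Set (Fin K → ℝ)) ⊆ M) (hne : Mn.Nonempty) :
    ∃ δ ∈ Mn, sSup ((fun δ => T (mix δ F)) '' M) ≤ epsOpt T D M Mn + T (mix δ F) := by
  obtain ⟨δ, hδ, hmax⟩ := Finset.exists_max_image Mn (fun δ => T (mix δ F)) hne
  refine ⟨δ, hδ, ?_⟩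
  have h1 : sSup ((fun δ => T (mix δ F)) '' (Mn : Set (Fin K → ℝ))) ≤ T (mix δ F) := by
    refine csSup_le ((Finset.coe_nonempty.2 hne).image _) ?_
    rintro _ ⟨γ, hγ, rfl⟩
    exact hmax γ hγ
  have h2 : |sSup ((fun δ => T (mix δ F)) '' M)
          - sSup ((fun δ => T (mix δ F)) '' (Mn : Set (Fin K → ℝ)))| ≤ epsOpt T D M Mn := by
    refine le_csSup ⟨2 * C, ?_⟩ ⟨F, hF, rfl⟩
    rintro _ ⟨G, hG, rfl⟩
    have e1 := (T_bdd hDcdf hDconv hC hLip hG hM ⟨δ, hMn hδ⟩ (hM (hMn hδ))).2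
    have e2 := (T_bdd hDcdf hDconv hC hLip hG (hMn.trans hM) ⟨δ, hδ⟩ (hM (hMn hδ))).2
    rw [abs_le] at *
    constructor <;> linarith
  have := (abs_le.1 h2).2
  linarith

section core
variable {a b : ℝ} {T : (ℝ → ℝ) → ℝ} {D : Set (ℝ → ℝ)}

lemma marg_real (hDcdf : ∀ F ∈ D, IsCdfOn a b F) {K : ℕ} {F : Fin K → ℝ → ℝ} (hF : ∀ i, F i ∈ D)
    (ν : Measure (Fin K → ℝ))
    (hmarg : ∀ (i : Fin K) (x : ℝ), ν {y | y i ≤ x} = ENNReal.ofReal (F i x)) (i : Fin K) (z : ℝ) :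
    F i z = (ν.map fun e => e i).real (Iic z) := by
  rw [map_measureReal_apply (measurable_pi_apply i) measurableSet_Iic, Measure.real]
  have : (fun e : Fin K → ℝ => e i) ⁻¹' Iic z = {y | y i ≤ z} := rfl
  rw [this, hmarg, ENNReal.toReal_ofReal ((hDcdf _ (hF i)).bounds z).1]

lemma ae_range (hDcdf : ∀ F ∈ D, IsCdfOn a b F) {K : ℕ} {F : Fin K → ℝ → ℝ} (hF : ∀ i, F i ∈ D)
    (ν : Measure (Fin K → ℝ)) [IsProbabilityMeasure ν]
    (hmarg : ∀ (i : Fin K) (x : ℝ), ν {y | y i ≤ x} = ENNReal.ofReal (F i x)) (n : ℕ) :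
    ∀ᵐ ω ∂(Measure.pi fun _ : Fin n => ν), ∀ s < n, ∀ i, a ≤ Yext ω s i ∧ Yext ω s i ≤ b := by
  have h1 : ∀ᵐ e ∂ν, ∀ i, a ≤ e i ∧ e i ≤ b := by
    rw [ae_all_iff]
    intro i
    have hA : ∀ᵐ e ∂ν, a ≤ e i := by
      have : ∀ᵐ e ∂ν, ∀ q : ℕ, ¬ (e i ≤ a - 1 / ((q : ℝ) + 1)) := by
        rw [ae_all_iff]
        intro q
        rw [ae_iff]
        simp only [not_not]
        rw [hmarg, (hDcdf _ (hF i)).2.2.1]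
        · simp
        · have : (0:ℝ) < 1 / ((q : ℝ) + 1) := by positivity
          linarith
      filter_upwards [this] with e he
      by_contra hlt
      obtain ⟨q, hq⟩ := exists_nat_one_div_lt (sub_pos.2 (not_le.1 hlt))
      exact he q (by linarith)
    have hB : ∀ᵐ e ∂ν, e i ≤ b := by
      have hm : MeasurableSet {e : Fin K → ℝ | e i ≤ b} :=
        measurableSet_le (measurable_pi_apply i) measurable_const
      have := hmarg i b
      rw [(hDcdf _ (hF i)).2.2.2 b le_rfl, ENNReal.ofReal_one] at this
      exact (prob_compl_eq_zero_iff hm).2 this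
    filter_upwards [hA, hB] with e h h' using ⟨h, h'⟩
  have h2 : ∀ t : Fin n, ∀ᵐ ω ∂(Measure.pi fun _ : Fin n => ν), ∀ i, a ≤ ω t i ∧ ω t i ≤ b := by
    intro t
    exact (measurePreserving_eval (fun _ : Fin n => ν) t).quasiMeasurePreserving.ae h1
  rw [← ae_all_iff] at h2
  filter_upwards [h2] with ω hω s hs i
  simp only [Yext, hs, dif_pos]
  exact hω ⟨s, hs⟩ i

theorem core_triv
    (hDcdf : ∀ F ∈ D, IsCdfOn a b F) (hDconv : Convex ℝ D)
    {C : ℝ} (hC : 0 < C) (hLip : LipschitzAssumption a b T D C)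
    {K m n : ℕ} (hm : 2 ≤ m) (hn : 2 * K ≤ n)
    (g : Fin K → Fin m) (hg : Function.Surjective g)
    (M : Set (Fin K → ℝ)) (hMsub : M ⊆ stdSimplex ℝ (Fin K))
    (hMgrouped : ∀ δ ∈ M, ∃ j, GroupSupported g j δ)
    (Mn : Finset (Fin K → ℝ)) (hMnsub : (Mn : Set (Fin K → ℝ)) ⊆ M)
    (hMngroupne : ∀ j, ∃ δ ∈ Mn, GroupSupported g j δ)
    (R : Finset ℕ) (hR : ∀ r ∈ R, 1 ≤ r ∧ r ≤ n / 2)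
    (η : ℝ)
    (F : Fin K → ℝ → ℝ) (hF : ∀ i, F i ∈ D)
    (ν : Measure (Fin K → ℝ)) [IsProbabilityMeasure ν]
    (hmarg : ∀ (i : Fin K) (x : ℝ), ν {y | y i ≤ x} = ENNReal.ofReal (F i x)) :
    ∫ ω : Fin n → Fin K → ℝ,
        (sSup ((fun δ => T (mix δ F)) '' M)
          - T (mix (seRecommendation g T C η n R Mn (Yext ω)) F))
      ∂(Measure.pi fun _ : Fin n => ν) ≤ epsOpt T D M Mn + C := by
  have hne : Mn.Nonempty := by
    obtain ⟨δ, hδ, _⟩ := hMngroupne ⟨0, by omega⟩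
    exact ⟨δ, hδ⟩
  have he := eps_nonneg T D M Mn
  refine integral_le_of_lint _ _ _ (by linarith) ?_
  obtain ⟨δ, hδ, hδe⟩ := eps_spec hDcdf hDconv hC hLip hF hMsub hMnsub hne
  have : ∫⁻ ω : Fin n → Fin K → ℝ, ENNReal.ofReal (epsOpt T D M Mn + C)
      ∂(Measure.pi fun _ : Fin n => ν) = ENNReal.ofReal (epsOpt T D M Mn + C) := by simp
  rw [← this]
  refine lintegral_mono_ae ?_
  filter_upwards [ae_range hDcdf hF ν hmarg n] with ω hω
  refine ENNReal.ofReal_le_ofReal ?_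
  have h1 := (pathwise hDcdf hDconv hC hLip g hg η n hn R hR Mn (hMnsub.trans hMsub)
    (fun δ h => hMgrouped δ (hMnsub h)) F hF (Yext ω) hω _ (fun _ => rfl) δ hδ).1
  have h2 := (abs_le.1 (T_close hDcdf hDconv hC hLip hF (hMsub (hMnsub hδ)) (hMsub (hMnsub h1)))).2
  linarith

theorem core
    (hDcdf : ∀ F ∈ D, IsCdfOn a b F) (hDconv : Convex ℝ D)
    {C : ℝ} (hC : 0 < C) (hLip : LipschitzAssumption a b T D C)
    {K m n : ℕ} (hm : 2 ≤ m) (hn : 2 * K ≤ n)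
    (g : Fin K → Fin m) (hg : Function.Surjective g)
    (M : Set (Fin K → ℝ)) (hMsub : M ⊆ stdSimplex ℝ (Fin K))
    (hMgrouped : ∀ δ ∈ M, ∃ j, GroupSupported g j δ)
    (Mn : Finset (Fin K → ℝ)) (hMnsub : (Mn : Set (Fin K → ℝ)) ⊆ M)
    (hMngroupne : ∀ j, ∃ δ ∈ Mn, GroupSupported g j δ)
    (R : Finset ℕ) (hR : ∀ r ∈ R, 1 ≤ r ∧ r ≤ n / 2)
    (η : ℝ)
    (F : Fin K → ℝ → ℝ) (hF : ∀ i, F i ∈ D)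
    (ν : Measure (Fin K → ℝ)) [IsProbabilityMeasure ν]
    (hmarg : ∀ (i : Fin K) (x : ℝ), ν {y | y i ≤ x} = ENNReal.ofReal (F i x))
    (Nb : ℕ) (ρ : ℝ) (hρ1 : 1 ≤ ρ) (hρ : 2 ≤ ρ ^ Nb) (s : ℕ → ℝ) (hs : ∀ r ∈ R, 0 < s r)
    (hsu : ∀ r ∈ R, uEta C η r n K = C * s r) (Bf : ℝ) (hBf0 : 0 ≤ Bf)
    (hBf : ∃ G : (Fin K → List ℝ) → ENNReal, SupG ν G ∧
      (∀ ℓ i, n / K ≤ (ℓ i).length → (ℓ i).length ≤ n →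
        ENNReal.ofReal (supDist (F i) (empL (ℓ i))) ≤ G ℓ) ∧
      G (fun _ => []) ≤ ENNReal.ofReal Bf) :
    ∫ ω : Fin n → Fin K → ℝ,
        (sSup ((fun δ => T (mix δ F)) '' M)
          - T (mix (seRecommendation g T C η n R Mn (Yext ω)) F))
      ∂(Measure.pi fun _ : Fin n => ν) ≤ epsOpt T D M Mn
        + ∑ r ∈ R, K ^ 2 * (C * elimB (1 + 16 * Nb) ρ (s r) r) + 2 * C * Bf := by
  have hne : Mn.Nonempty := by
    obtain ⟨δ, hδ, _⟩ := hMngroupne ⟨0, by omega⟩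
    exact ⟨δ, hδ⟩
  have he := eps_nonneg T D M Mn
  have hEB : ∀ r ∈ R, 0 ≤ K ^ 2 * (C * elimB (1 + 16 * Nb) ρ (s r) r) := by
    intro r hr
    have := hs r hr
    unfold elimB
    positivity
  have hsum := Finset.sum_nonneg hEB
  have hCB : 0 ≤ 2 * C * Bf := by positivity
  refine integral_le_of_lint _ _ _ (by linarith) ?_
  obtain ⟨δ, hδ, hδe⟩ := eps_spec hDcdf hDconv hC hLip hF hMsub hMnsub hne
  obtain ⟨Gf, hGf1, hGf2, hGf3⟩ := hBf
  have hex : ∀ r, ∃ G : (Fin K → List ℝ) → ENNReal, r ∈ R → SupG ν G ∧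
      (∀ ℓ, ENNReal.ofReal (lossR F C (uEta C η r n K) r ℓ) ≤ G ℓ) ∧
      G (fun _ => []) ≤ ENNReal.ofReal (K ^ 2 * (C * elimB (1 + 16 * Nb) ρ (s r) r)) := by
    intro r
    by_cases hr : r ∈ R
    · obtain ⟨G, h⟩ := elim_G ν F (marg_real hDcdf hF ν hmarg) r (hR r hr).1 Nb ρ hρ1 hρ C (s r) hC (hs r hr)
      refine ⟨G, fun _ => ?_⟩
      rw [hsu r hr]
      exact h
    · exact ⟨fun _ => 0, fun h => absurd h hr⟩
  choose G hG using hex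
  set H : (Fin K → List ℝ) → ENNReal := fun ℓ => ENNReal.ofReal (epsOpt T D M Mn) +
    ∑ r ∈ R, G r ℓ + ENNReal.ofReal (2 * C) * Gf ℓ with hH
  have hHs : SupG ν H := by
    refine SupG.add (SupG.add (SupG.const ν _) (SupG.sum _ fun r hr => (hG r hr).1)) (hGf1.mul _)
  have hsam := sampling ν H (fun ℓ i => (hHs ℓ i).2) n (asgP g T C η n R Mn)
    (fun t ω ω' h => asgP_pred g T C η n R Mn t ω ω' h) (fun _ => [])
  have hH0 : H (fun _ => []) ≤ ENNReal.ofReal (epsOpt T D M Mn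
        + ∑ r ∈ R, K ^ 2 * (C * elimB (1 + 16 * Nb) ρ (s r) r) + 2 * C * Bf) := by
    rw [ENNReal.ofReal_add (by linarith) hCB, ENNReal.ofReal_add he hsum,
      ENNReal.ofReal_sum_of_nonneg hEB, ENNReal.ofReal_mul (by positivity : 0 ≤ 2 * C)]
    exact add_le_add (add_le_add le_rfl (Finset.sum_le_sum fun r hr => (hG r hr).2.2))
      (mul_le_mul' le_rfl hGf3)
  refine le_trans ?_ (hsam.trans hH0)
  refine lintegral_mono_ae ?_
  filter_upwards [ae_range hDcdf hF ν hmarg n] with ω hω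
  simp only [List.nil_append]
  set out : Fin K → List ℝ := fun i => outL (asgP g T C η n R Mn ω) ω i with hout
  have hlen : ∀ i, (out i).length ≤ n := by
    intro i
    simp only [hout, outL, List.length_map]
    exact (List.length_filter_le _ _).trans (by simp)
  obtain ⟨h1, i, i', hi, hi', hT⟩ := pathwise hDcdf hDconv hC hLip g hg η n hn R hR Mn (hMnsub.trans hMsub)
    (fun δ h => hMgrouped δ (hMnsub h)) F hF (Yext ω) hω out
    (fun i => (FT_out g T C η n R Mn ω i).symm) δ hδ
  have hl0 : ∀ r ∈ R, 0 ≤ lossR F C (uEta C η r n K) r out := fun r _ => lossR_nonneg _ _ _ _ _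
  have hls := Finset.sum_nonneg hl0
  have d1 := supDist_nonneg (F i) (empL (out i))
  have d2 := supDist_nonneg (F i') (empL (out i'))
  have step : ENNReal.ofReal (sSup ((fun δ => T (mix δ F)) '' M)
          - T (mix (seRecommendation g T C η n R Mn (Yext ω)) F)) ≤
      ENNReal.ofReal (epsOpt T D M Mn + ∑ r ∈ R, lossR F C (uEta C η r n K) r out
        + (C * supDist (F i) (empL (out i)) + C * supDist (F i') (empL (out i')))) :=
    ENNReal.ofReal_le_ofReal (by linarith)
  refine step.trans ?_
  rw [ENNReal.ofReal_add (by linarith) (by positivity), ENNReal.ofReal_add he hls,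
    ENNReal.ofReal_sum_of_nonneg hl0, ENNReal.ofReal_add (by positivity) (by positivity),
    ENNReal.ofReal_mul hC.le, ENNReal.ofReal_mul hC.le]
  refine add_le_add (add_le_add le_rfl (Finset.sum_le_sum fun r hr => (hG r hr).2.1 out)) ?_
  refine (add_le_add (mul_le_mul' le_rfl (hGf2 out i hi (hlen i)))
    (mul_le_mul' le_rfl (hGf2 out i' hi' (hlen i')))).trans ?_
  rw [← add_mul, ← ENNReal.ofReal_add hC.le hC.le, two_mul]

end core


lemma sum_three_half (N : ℕ) :
    ∑ r ∈ Finset.Icc 1 (N + 1), 1 / ((r : ℝ) * Real.sqrt r) ≤ 3 - 2 / Real.sqrt (N + 1) := by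
  induction N with
  | zero => norm_num
  | succ N ih =>
    rw [Finset.sum_Icc_succ_top (by omega)]
    refine (add_le_add_left ih _).trans ?_
    push_cast
    set x := Real.sqrt ((N:ℝ) + 1) with hx
    set y := Real.sqrt ((N:ℝ) + 1 + 1) with hy
    have hx2 : x ^ 2 = N + 1 := Real.sq_sqrt (by positivity)
    have hy2 : y ^ 2 = N + 1 + 1 := Real.sq_sqrt (by positivity)
    have hx0 : 0 < x := Real.sqrt_pos.2 (by positivity)
    have hy0 : 0 < y := Real.sqrt_pos.2 (by positivity)
    have hxy : x ≤ y := Real.sqrt_le_sqrt (by linarith)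
    have h1 : 2 / x - 2 / y = 2 / (x * y * (x + y)) := by
      have : (y - x) * (x + y) = 1 := by nlinarith
      field_simp
      nlinarith
    have h2 : 1 / (((N:ℝ) + 1 + 1) * y) ≤ 2 / (x * y * (x + y)) := by
      rw [← hy2, div_le_div_iff₀ (by positivity) (by positivity)]
      have : x * (x + y) ≤ y * (y + y) := by gcongr
      nlinarith
    linarith

lemma sum_three_half' (R : Finset ℕ) (hR : ∀ r ∈ R, 1 ≤ r) :
    ∑ r ∈ R, 1 / ((r : ℝ) * Real.sqrt r) ≤ 3 := by
  have h1 : R ⊆ Finset.Icc 1 (R.sup id + 1) := fun r hr =>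
    Finset.mem_Icc.2 ⟨hR r hr, (Finset.le_sup (f := id) hr).trans (Nat.le_succ _)⟩
  refine (Finset.sum_le_sum_of_subset_of_nonneg h1 fun _ _ _ => by positivity).trans
    ((sum_three_half _).trans ?_)
  have : 0 ≤ 2 / Real.sqrt ((R.sup id : ℕ) + 1) := by positivity
  linarith

/-- normalized elimination threshold -/
def sEta (η : ℝ) (r n K : ℕ) : ℝ :=
  Real.sqrt ((1 + η) / r * (0.5 * Real.log n + Real.log (r * K)))

lemma L_eq (r n K : ℕ) (hr : 1 ≤ r) (hn : 1 ≤ n) (hK : 1 ≤ K) :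
    0.5 * Real.log n + Real.log (r * K) = Real.log (r * (Real.sqrt n * K)) := by
  have h1 : (0:ℝ) < r := by exact_mod_cast hr
  have h2 : (0:ℝ) < n := by exact_mod_cast hn
  have h3 : (0:ℝ) < K := by exact_mod_cast hK
  have h4 := Real.sqrt_pos.2 h2
  rw [Real.log_mul h1.ne' h3.ne', Real.log_mul h1.ne' (mul_pos h4 h3).ne', Real.log_mul h4.ne' h3.ne',
    Real.log_sqrt h2.le]
  ring

lemma elim_term (η : ℝ) (hη : 0 < η) (n K r : ℕ) (hr : 1 ≤ r) (hn : 1 ≤ n) (hK : 1 ≤ K)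
    (c2 ρ lam β : ℝ) (hρ : 0 < ρ) (hlam : 0 < lam) (hβ : β * ρ ^ 2 = 1 + η) (hβ1 : 1 ≤ β)
    (hL : Real.exp (lam ^ 2) ≤ Real.sqrt n * K) :
    0 < sEta η r n K ∧
    (K:ℝ) ^ 2 * elimB c2 ρ (sEta η r n K) r ≤
      K / Real.sqrt n * (c2 ^ 2 * ρ ^ 2 / (2 * Real.exp 1 * Real.sqrt (1 + η) * lam)) *
        (Real.sqrt n * K) ^ (-(β - 1)) * (1 / (r * Real.sqrt r)) := by
  have h1 : (1:ℝ) ≤ r := by exact_mod_cast hr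
  have h2 : (0:ℝ) < n := by exact_mod_cast hn
  have h3 : (0:ℝ) < K := by exact_mod_cast hK
  have h4 := Real.sqrt_pos.2 h2
  have hX : 0 < Real.sqrt n * K := by positivity
  have hrX : 0 < r * (Real.sqrt n * K) := by positivity
  set X := Real.sqrt n * K with hXd
  set L := Real.log (r * X) with hLd
  have hlL : lam ^ 2 ≤ L := by
    rw [hLd, Real.le_log_iff_exp_le hrX]
    nlinarith
  have hL0 : 0 < L := lt_of_lt_of_le (by positivity) hlL
  have hs : sEta η r n K = Real.sqrt ((1 + η) / r * L) := by
    unfold sEta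
    rw [L_eq r n K hr hn hK]
  have hs0 : 0 < sEta η r n K := by rw [hs]; exact Real.sqrt_pos.2 (by positivity)
  refine ⟨hs0, ?_⟩
  have hs2 : r * (sEta η r n K) ^ 2 / ρ ^ 2 = β * L := by
    rw [hs, Real.sq_sqrt (by positivity), ← hβ]
    field_simp
  have hexp : Real.exp (-(β * L)) ≤ 1 / (r * X) * X ^ (-(β - 1)) := by
    have e1 : Real.exp (-(β * L)) = (r * X) ^ (-β) := by
      rw [Real.rpow_def_of_pos hrX]; congr 1; ring
    rw [e1, show -β = -1 + -(β - 1) by ring, Real.rpow_add hrX, Real.rpow_neg_one, one_div]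
    refine mul_le_mul_of_nonneg_left ?_ (by positivity)
    refine Real.rpow_le_rpow_of_nonpos hX ?_ (by linarith)
    nlinarith
  have hrs : Real.sqrt (1 + η) * lam * Real.sqrt r ≤ r * sEta η r n K := by
    have : r * sEta η r n K = Real.sqrt (1 + η) * Real.sqrt L * Real.sqrt r := by
      rw [hs, mul_comm ((1 + η) / r) L, ← mul_div_assoc, Real.sqrt_div (by positivity), mul_comm L,
        Real.sqrt_mul (by positivity)]
      have : Real.sqrt r * Real.sqrt r = r := Real.mul_self_sqrt (by positivity)
      have h0 : 0 < Real.sqrt r := Real.sqrt_pos.2 (by positivity)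
      field_simp
      nlinarith
    rw [this]
    have : lam ≤ Real.sqrt L := Real.le_sqrt_of_sq_le hlL
    gcongr
  unfold elimB
  rw [hs2]
  have hsr : 0 < Real.sqrt r := Real.sqrt_pos.2 (by positivity)
  have hη1 : 0 < Real.sqrt (1 + η) := Real.sqrt_pos.2 (by positivity)
  have he := Real.exp_pos 1
  calc (K:ℝ) ^ 2 * (c2 ^ 2 * (ρ ^ 2 / (2 * Real.exp 1 * (r * sEta η r n K))) * Real.exp (-(β * L)))
      ≤ (K:ℝ) ^ 2 * (c2 ^ 2 * (ρ ^ 2 / (2 * Real.exp 1 * (Real.sqrt (1 + η) * lam * Real.sqrt r)))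
        * (1 / (r * X) * X ^ (-(β - 1)))) := by gcongr
    _ = _ := by
      rw [hXd]
      field_simp

lemma elim_sum (η : ℝ) (hη : 0 < η) (n K : ℕ) (hn : 1 ≤ n) (hK : 1 ≤ K)
    (c2 ρ lam β : ℝ) (hρ : 0 < ρ) (hlam : 0 < lam) (hβ : β * ρ ^ 2 = 1 + η)
    (hβ1 : η / (2 + η) ≤ β - 1)
    (hL : Real.exp (lam ^ 2) ≤ Real.sqrt n * K) (h7 : 7 * Real.sqrt K ≤ Real.sqrt n)
    (R : Finset ℕ) (hR : ∀ r ∈ R, 1 ≤ r) (A : ℝ)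
    (hA : 3 * (c2 ^ 2 * ρ ^ 2) ≤ 4 * A * (2 * Real.exp 1 * Real.sqrt (1 + η) * lam) * 7 ^ (β - 1)) :
    ∑ r ∈ R, (K:ℝ) ^ 2 * elimB c2 ρ (sEta η r n K) r ≤
      4 * ((K : ℝ) ^ ((1 : ℝ) - 3 * η / (4 + 2 * η)) / Real.sqrt n) * A := by
  have h2 : (0:ℝ) < n := by exact_mod_cast hn
  have h3 : (1:ℝ) ≤ K := by exact_mod_cast hK
  have h4 := Real.sqrt_pos.2 h2
  have hq : 0 < η / (2 + η) := by positivity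
  have hη1 : 0 < Real.sqrt (1 + η) := Real.sqrt_pos.2 (by positivity)
  have he := Real.exp_pos 1
  have hX : 0 < Real.sqrt n * K := by positivity
  set Q := K / Real.sqrt n * (c2 ^ 2 * ρ ^ 2 / (2 * Real.exp 1 * Real.sqrt (1 + η) * lam)) *
        (Real.sqrt n * K) ^ (-(β - 1)) with hQ
  have hQ0 : 0 ≤ Q := by positivity
  have step : ∑ r ∈ R, (K:ℝ) ^ 2 * elimB c2 ρ (sEta η r n K) r ≤ Q * 3 := by
    refine (Finset.sum_le_sum fun r hr => (elim_term η hη n K r (hR r hr) hn hK c2 ρ lam β hρ hlam hβ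
      (by linarith) hL).2).trans ?_
    rw [← Finset.mul_sum]
    exact mul_le_mul_of_nonneg_left (sum_three_half' R hR) hQ0
  refine step.trans ?_
  have hpow : (Real.sqrt n * K) ^ (-(β - 1)) ≤ 7 ^ (-(β - 1)) * (K:ℝ) ^ (-(3 * η / (4 + 2 * η))) := by
    have e1 : (7 : ℝ) * (K:ℝ) ^ (3/2 : ℝ) ≤ Real.sqrt n * K := by
      have : (K:ℝ) ^ (3/2 : ℝ) = Real.sqrt K * K := by
        rw [show (3/2:ℝ) = 1/2 + 1 by norm_num, Real.rpow_add (by linarith), Real.rpow_one,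
          Real.sqrt_eq_rpow]
      rw [this]
      nlinarith
    refine (Real.rpow_le_rpow_of_nonpos (by positivity) e1 (by linarith)).trans ?_
    rw [Real.mul_rpow (by norm_num) (by positivity), ← Real.rpow_mul (by linarith)]
    refine mul_le_mul_of_nonneg_left ?_ (by positivity)
    refine Real.rpow_le_rpow_of_exponent_le h3 ?_
    have : 3 * η / (4 + 2 * η) = 3 / 2 * (η / (2 + η)) := by field_simp; ring
    rw [this]
    linarith
  have hk : (K : ℝ) ^ ((1 : ℝ) - 3 * η / (4 + 2 * η)) = K * (K:ℝ) ^ (-(3 * η / (4 + 2 * η))) := by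
    rw [sub_eq_add_neg, Real.rpow_add (by linarith), Real.rpow_one]
  rw [hk]
  set κ := (K:ℝ) ^ (-(3 * η / (4 + 2 * η))) with hκ
  have hκ0 : 0 < κ := Real.rpow_pos_of_pos (by linarith) _
  have h70 : (0:ℝ) < 7 ^ (β - 1) := Real.rpow_pos_of_pos (by norm_num) _
  calc Q * 3 ≤ K / Real.sqrt n * (c2 ^ 2 * ρ ^ 2 / (2 * Real.exp 1 * Real.sqrt (1 + η) * lam)) *
        (7 ^ (-(β - 1)) * κ) * 3 := by rw [hQ]; gcongr
    _ = K / Real.sqrt n * κ * (3 * (c2 ^ 2 * ρ ^ 2) / (2 * Real.exp 1 * Real.sqrt (1 + η) * lam * 7 ^ (β - 1))) := by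
      rw [Real.rpow_neg (by norm_num)]
      field_simp
    _ ≤ K / Real.sqrt n * κ * (4 * A) := by
      refine mul_le_mul_of_nonneg_left ?_ (by positivity)
      rw [div_le_iff₀ (by positivity)]
      linarith
    _ = _ := by field_simp


lemma num1 (η c2 : ℝ) (hη : 0 < η) (hη2 : η ≤ 2) (hc0 : 0 ≤ c2) (hc : c2 ≤ 17 + 64 / η) :
    3 * (c2 ^ 2 * (1 + η / 2)) ≤ 4 * (1 + 18.5 / η) ^ 2 * (2 * Real.exp 1 * Real.sqrt (1 + η) * 2.5)
      * 7 ^ (η / (2 + η)) := by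
  have he := Real.exp_one_gt_d9
  set S := Real.sqrt (1 + η) with hS
  have hS2 : S ^ 2 = 1 + η := Real.sq_sqrt (by linarith)
  have hS0 : 0 < S := Real.sqrt_pos.2 (by linarith)
  set P : ℝ := 7 ^ (η / (2 + η)) with hP
  set y := 1 / η with hy
  have e1 : 18.5 / η = 18.5 * y := by rw [hy]; ring
  have e2 : 64 / η = 64 * y := by rw [hy]; ring
  rw [e1]
  rw [e2] at hc
  have hy0 : 0 < y := by positivity
  have hyη : y * η = 1 := by rw [hy]; field_simp
  -- general finishing step
  have fin : ∀ t p d : ℝ, 0 < d → 0 < p → 0 < t → 1 + η / 2 ≤ t * S → p ≤ P → d * c2 ≤ 1 + 18.5 * y →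
      3 * t ≤ 54.36 * d ^ 2 * p → 3 * (c2 ^ 2 * (1 + η / 2)) ≤
        4 * (1 + 18.5 * y) ^ 2 * (2 * Real.exp 1 * S * 2.5) * P := by
    intro t p d hd hp ht h1 h2 h3 h4
    calc 3 * (c2 ^ 2 * (1 + η / 2)) ≤ 3 * (c2 ^ 2 * (t * S)) := by gcongr
      _ = (3 * t) * (c2 ^ 2 * S) := by ring
      _ ≤ (54.36 * d ^ 2 * p) * (c2 ^ 2 * S) := by gcongr
      _ = 4 * (d * c2) ^ 2 * (2 * 2.718 * S * 2.5) * p := by ring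
      _ ≤ _ := by
        have : (2.718:ℝ) ≤ Real.exp 1 := by linarith
        gcongr
  rcases le_total η 0.8 with h | h
  · refine fin 1.05 1 0.24073 (by norm_num) (by norm_num) (by norm_num) ?_ ?_ ?_ (by norm_num)
    · refine (abs_le_of_sq_le_sq' (a := 1 + η / 2) (b := 1.05 * S) ?_ (by positivity)).2
      rw [mul_pow, hS2]
      nlinarith
    · exact Real.one_le_rpow (by norm_num) (by positivity)
    · have : 1.25 ≤ y := by nlinarith
      nlinarith
  · refine fin 1.16 1.7 0.1941 (by norm_num) (by norm_num) (by norm_num) ?_ ?_ ?_ (by norm_num)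
    · refine (abs_le_of_sq_le_sq' (a := 1 + η / 2) (b := 1.16 * S) ?_ (by positivity)).2
      rw [mul_pow, hS2]
      nlinarith
    · have h1 : (7:ℝ) ^ (2/7 : ℝ) ≤ P := by
        refine Real.rpow_le_rpow_of_exponent_le (by norm_num) ?_
        rw [div_le_div_iff₀ (by norm_num) (by positivity)]
        linarith
      refine le_trans ?_ h1
      have h2 : (1.7:ℝ) = ((1.7:ℝ) ^ (7:ℝ)) ^ (1/7:ℝ) := by
        rw [← Real.rpow_mul (by norm_num)]; norm_num
      have h3 : (7:ℝ) ^ (2/7 : ℝ) = ((7:ℝ) ^ (2:ℝ)) ^ (1/7:ℝ) := by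
        rw [← Real.rpow_mul (by norm_num)]; norm_num
      rw [h2, h3]
      refine Real.rpow_le_rpow (by positivity) ?_ (by norm_num)
      rw [show (7:ℝ) = ((7:ℕ):ℝ) by norm_num, Real.rpow_natCast,
        show (2:ℝ) = ((2:ℕ):ℝ) by norm_num, Real.rpow_natCast]
      norm_num
    · have : 0.5 ≤ y := by nlinarith
      nlinarith

lemma num2 (η : ℝ) (hη2 : 2 ≤ η) :
    3 * ((33:ℝ) ^ 2 * 2) ≤ 4 * (1 + 18.5 / η) ^ 2 * (2 * Real.exp 1 * Real.sqrt (1 + η) * 1.7)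
      * 7 ^ ((1 + η) / 2 - 1) := by
  have he := Real.exp_one_gt_d9
  have hη : 0 < η := by linarith
  set S := Real.sqrt (1 + η) with hS
  set P : ℝ := 7 ^ ((1 + η) / 2 - 1) with hP
  have fin : ∀ x s p : ℝ, 0 < s → 0 < p → 0 < x → s ≤ S → p ≤ P → x ≤ 18.5 / η →
      6534 ≤ 4 * (1 + x) ^ 2 * (2 * 2.718 * s * 1.7) * p →
      3 * ((33:ℝ) ^ 2 * 2) ≤ 4 * (1 + 18.5 / η) ^ 2 * (2 * Real.exp 1 * S * 1.7) * P := by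
    intro x s p hs hp hx h1 h2 h3 h4
    refine (le_trans (by norm_num) h4).trans ?_
    have : (2.718:ℝ) ≤ Real.exp 1 := by linarith
    gcongr
  have hs : ∀ s : ℝ, 0 ≤ s → s ^ 2 ≤ 1 + η → s ≤ S := fun s h0 h => Real.le_sqrt_of_sq_le h
  have hp : ∀ q : ℕ, (q:ℝ) ≤ (1 + η) / 2 - 1 → (7:ℝ) ^ q ≤ P := by
    intro q hq
    rw [← Real.rpow_natCast]
    exact Real.rpow_le_rpow_of_exponent_le (by norm_num) hq
  rcases le_total η 3 with h | h
  · refine fin 6.16 1.73 2.6 (by norm_num) (by norm_num) (by norm_num) (hs _ (by norm_num) (by norm_num; linarith)) ?_ ?_ (by norm_num)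
    · have : (7:ℝ) ^ (1/2:ℝ) ≤ P := Real.rpow_le_rpow_of_exponent_le (by norm_num) (by linarith)
      refine le_trans ?_ this
      rw [← Real.sqrt_eq_rpow]
      exact Real.le_sqrt_of_sq_le (by norm_num)
    · rw [le_div_iff₀ hη]; nlinarith
  rcases le_total η 7 with h' | h'
  · refine fin 2.64 2 7 (by norm_num) (by norm_num) (by norm_num) (hs _ (by norm_num) (by norm_num; linarith)) ?_ ?_ (by norm_num)
    · simpa using hp 1 (by norm_num; linarith)
    · rw [le_div_iff₀ hη]; nlinarith
  · have h3 : (7:ℝ) ^ 3 ≤ P := hp 3 (by norm_num; linarith)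
    have hS2 : 2.8 ≤ S := hs _ (by norm_num) (by norm_num; linarith)
    have hx : 0 < 18.5 / η := by positivity
    have : (2.718:ℝ) ≤ Real.exp 1 := by linarith
    calc 3 * ((33:ℝ) ^ 2 * 2) ≤ 4 * (1 + 0) ^ 2 * (2 * 2.718 * 2.8 * 1.7) * 7 ^ 3 := by norm_num
      _ ≤ _ := by gcongr

lemma bern (η : ℝ) (hη : 0 < η) (hη2 : η ≤ 2) (Nb : ℕ) (hNb : 4 / η ≤ Nb) :
    2 ≤ Real.sqrt (1 + η / 2) ^ Nb := by
  have h1 : 1 + (2 / η) * (η / 2) ≤ (1 + η / 2) ^ (2 / η) :=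
    one_add_mul_self_le_rpow_one_add (by linarith) (by rw [le_div_iff₀ hη]; linarith)
  have h2 : 1 + (2 / η) * (η / 2) = 2 := by field_simp; norm_num
  rw [h2] at h1
  refine h1.trans ?_
  rw [Real.sqrt_eq_rpow, ← Real.rpow_natCast, ← Real.rpow_mul (by linarith)]
  refine Real.rpow_le_rpow_of_exponent_le (by linarith) ?_
  have : 2 / η = 1 / 2 * (4 / η) := by ring
  linarith

/-- elimination part, total -/
lemma elim_total (η : ℝ) (hη : 0 < η) (n K : ℕ) (hK : 2 ≤ K) (hn : 56 * (K:ℝ) ≤ n)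
    (hE : 4 * ((K : ℝ) ^ ((1 : ℝ) - 3 * η / (4 + 2 * η)) / Real.sqrt n) * (1 + 18.5 / η) ^ 2 < 1)
    (R : Finset ℕ) (hR : ∀ r ∈ R, 1 ≤ r) :
    ∃ (Nb : ℕ) (ρ : ℝ), 1 ≤ ρ ∧ 2 ≤ ρ ^ Nb ∧ (∀ r ∈ R, 0 < sEta η r n K) ∧
      ∑ r ∈ R, (K:ℝ) ^ 2 * elimB (1 + 16 * Nb) ρ (sEta η r n K) r ≤
      4 * ((K : ℝ) ^ ((1 : ℝ) - 3 * η / (4 + 2 * η)) / Real.sqrt n) * (1 + 18.5 / η) ^ 2 := by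
  have hK' : (2:ℝ) ≤ K := by exact_mod_cast hK
  have hn0 : (0:ℝ) < n := by linarith
  have hn1 : 1 ≤ n := by
    have : 0 < n := by exact_mod_cast hn0
    omega
  have hsn := Real.sqrt_pos.2 hn0
  have h74 : 7.4 * Real.sqrt K ≤ Real.sqrt n := by
    refine Real.le_sqrt_of_sq_le ?_
    rw [mul_pow, Real.sq_sqrt (by linarith)]
    nlinarith
  have hsK : 1.4 ≤ Real.sqrt K := Real.le_sqrt_of_sq_le (by norm_num; linarith)
  have h7 : 7 * Real.sqrt K ≤ Real.sqrt n := by linarith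
  have he := Real.exp_one_lt_d9
  rcases le_total η 2 with h2 | h2
  · set Nb := ⌈4 / η⌉₊ with hNb
    have hNb1 : 4 / η ≤ Nb := Nat.le_ceil _
    have hNb2 : (Nb:ℝ) < 4 / η + 1 := Nat.ceil_lt_add_one (by positivity)
    have hρ2 : Real.sqrt (1 + η / 2) ^ 2 = 1 + η / 2 := Real.sq_sqrt (by linarith)
    have hρ0 : 0 < Real.sqrt (1 + η / 2) := Real.sqrt_pos.2 (by linarith)
    have hβ : (1 + η / (2 + η)) * Real.sqrt (1 + η / 2) ^ 2 = 1 + η := by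
      rw [hρ2]; field_simp; ring
    have hL : Real.exp (2.5 ^ 2) ≤ Real.sqrt n * K := by
      have h18 : 9.25 ≤ 18.5 / η := by rw [le_div_iff₀ hη]; nlinarith
      have hk1 : 1 ≤ (K : ℝ) ^ ((1 : ℝ) - 3 * η / (4 + 2 * η)) := by
        refine Real.one_le_rpow (by linarith) ?_
        rw [sub_nonneg, div_le_one (by positivity)]
        linarith
      have hsq : 420 ≤ Real.sqrt n := by
        have e1 : 4 * (1 / Real.sqrt n) * (1 + 9.25) ^ 2 < 1 := lt_of_le_of_lt (by gcongr) hE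
        have e2 : 4 * (1 / Real.sqrt n) * (1 + 9.25) ^ 2 = 420.25 / Real.sqrt n := by
          field_simp; norm_num
        rw [e2, div_lt_one hsn] at e1
        linarith
      have h3 : Real.exp (2.5 ^ 2) ≤ Real.exp 1 ^ 7 := by
        rw [← Real.exp_nat_mul]; exact Real.exp_le_exp.2 (by norm_num)
      have h3' : Real.exp (2.5 ^ 2) ^ 4 ≤ (840:ℝ) ^ 4 := by
        rw [← Real.exp_nat_mul, show ((4:ℕ):ℝ) * 2.5 ^ 2 = ((25:ℕ):ℝ) * 1 by norm_num, Real.exp_nat_mul]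
        calc Real.exp 1 ^ 25 ≤ (2.72:ℝ) ^ 25 := by gcongr; linarith
          _ ≤ _ := by norm_num
      have h4 : Real.exp (2.5 ^ 2) ≤ 840 := le_of_pow_le_pow_left₀ (by norm_num) (by norm_num) h3'
      nlinarith
    have hc0 : (0:ℝ) ≤ 1 + 16 * Nb := by positivity
    have hc : (1 + 16 * Nb : ℝ) ≤ 17 + 64 / η := by
      have : 64 / η = 16 * (4 / η) := by ring
      linarith
    have hq : 0 < η / (2 + η) := by positivity
    refine ⟨Nb, Real.sqrt (1 + η / 2), Real.one_le_sqrt.2 (by linarith), bern η hη h2 Nb hNb1, ?_, ?_⟩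
    · intro r hr
      exact (elim_term η hη n K r (hR r hr) hn1 (by omega) 1 _ 2.5 _ hρ0 (by norm_num) hβ
        (by linarith) hL).1
    · refine elim_sum η hη n K hn1 (by omega) _ _ 2.5 _ hρ0 (by norm_num) hβ (by linarith) hL h7 R hR _ ?_
      rw [hρ2, add_sub_cancel_left]
      exact num1 η _ hη h2 hc0 hc
  · have hρ2 : Real.sqrt 2 ^ 2 = 2 := Real.sq_sqrt (by norm_num)
    have hρ0 : 0 < Real.sqrt 2 := Real.sqrt_pos.2 (by norm_num)
    have hβ : ((1 + η) / 2) * Real.sqrt 2 ^ 2 = 1 + η := by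
      rw [hρ2]; ring
    have hβ1 : η / (2 + η) ≤ (1 + η) / 2 - 1 := by
      rw [div_le_iff₀ (by positivity)]
      nlinarith
    have hq : 0 < η / (2 + η) := by positivity
    have hL : Real.exp (1.7 ^ 2) ≤ Real.sqrt n * K := by
      have h3 : Real.exp (1.7 ^ 2) ≤ Real.exp 1 ^ 3 := by
        rw [← Real.exp_nat_mul]; exact Real.exp_le_exp.2 (by norm_num)
      have h4 : Real.exp 1 ^ 3 ≤ (2.72:ℝ) ^ 3 := by gcongr; linarith
      have h5 : (2.72:ℝ) ^ 3 ≤ 20.5 := by norm_num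
      nlinarith
    refine ⟨2, Real.sqrt 2, Real.one_le_sqrt.2 (by norm_num), hρ2.ge, ?_, ?_⟩
    · intro r hr
      exact (elim_term η hη n K r (hR r hr) hn1 (by omega) 1 _ 1.7 _ hρ0 (by norm_num) hβ
        (by linarith) hL).1
    · refine elim_sum η hη n K hn1 (by omega) _ _ 1.7 _ hρ0 (by norm_num) hβ hβ1 hL h7 R hR _ ?_
      rw [hρ2]
      have := num2 η h2
      norm_num at this ⊢
      exact this

lemma fin_num1 (n K r0 : ℝ) (hK : 2 ≤ K) (hn : 56 * K ≤ n) (hr : n / K - 1 ≤ r0) :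
    2 * Real.sqrt (2 * Real.log (17 * (K * n)) / r0) ≤
      4 * Real.sqrt (K / n) * Real.sqrt (Real.log (3.01 * (K * (n + 2)))) := by
  have hn0 : 0 < n := by linarith
  have hnK : 56 ≤ n / K := by rw [le_div_iff₀ (by linarith)]; linarith
  have hr0 : 55 / 56 * (n / K) ≤ r0 := by linarith
  have hr00 : 0 < r0 := by linarith
  set z := 3.01 * (K * (n + 2)) with hz
  have hKn : 112 ≤ K * n := by nlinarith
  have hz0 : 300 ≤ z := by nlinarith
  have hz1 : 3.01 * (K * n) ≤ z := by rw [hz]; nlinarith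
  have hl : Real.log (17 * (K * n)) ≤ 1.5 * Real.log z := by
    have e : (1.5:ℝ) * Real.log z = Real.log (z * Real.sqrt z) := by
      rw [Real.log_mul (by linarith) (Real.sqrt_pos.2 (by linarith)).ne', Real.log_sqrt (by linarith)]
      ring
    rw [e]
    refine Real.log_le_log (by positivity) ?_
    have : 17 ≤ Real.sqrt z := Real.le_sqrt_of_sq_le (by norm_num; linarith)
    nlinarith
  have hlz : 0 ≤ Real.log z := Real.log_nonneg (by linarith)
  have h1 : 2 * Real.log (17 * (K * n)) / r0 ≤ 4 * ((K / n) * Real.log z) := by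
    rw [div_le_iff₀ hr00]
    have h3 : 55 / 56 ≤ K / n * r0 := by
      calc (55:ℝ) / 56 = K / n * (55 / 56 * (n / K)) := by field_simp
        _ ≤ _ := by gcongr
    nlinarith
  calc 2 * Real.sqrt (2 * Real.log (17 * (K * n)) / r0)
      ≤ 2 * Real.sqrt (2 ^ 2 * ((K / n) * Real.log z)) := by
        gcongr; linarith
    _ = _ := by
      rw [Real.sqrt_mul (by norm_num), Real.sqrt_sq (by norm_num), Real.sqrt_mul (by positivity)]
      ring

lemma fin_num2 (n K r0 : ℝ) (hK : 2 ≤ K) (hn : 56 * K ≤ n) (hr : n / K - 1 ≤ r0) :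
    2 * (Real.sqrt (2 * n * Real.log (17 * K)) / r0) ≤
      4 * Real.sqrt (K / n) * Real.sqrt (K * Real.log (17 * K)) := by
  have hn0 : 0 < n := by linarith
  have hnK : 56 ≤ n / K := by rw [le_div_iff₀ (by linarith)]; linarith
  have hr0 : 55 / 56 * (n / K) ≤ r0 := by linarith
  have hr00 : 0 < r0 := by linarith
  set L := Real.log (17 * K) with hL
  have hL0 : 0 ≤ L := Real.log_nonneg (by linarith)
  have h3 : 55 / 56 ≤ K / n * r0 := by
    calc (55:ℝ) / 56 = K / n * (55 / 56 * (n / K)) := by field_simp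
      _ ≤ _ := by gcongr
  have : Real.sqrt (2 * n * L) ≤ 2 * (Real.sqrt (K / n) * Real.sqrt (K * L)) * r0 := by
    rw [← Real.sqrt_mul (by positivity)]
    have e : 2 * Real.sqrt (K / n * (K * L)) * r0 = Real.sqrt (4 * r0 ^ 2 * (K / n * (K * L))) := by
      rw [show 4 * r0 ^ 2 = (2 * r0) ^ 2 by ring, Real.sqrt_mul (sq_nonneg (2 * r0)), Real.sqrt_sq (by positivity)]
      ring
    rw [e]
    refine Real.sqrt_le_sqrt ?_
    have e2 : 4 * r0 ^ 2 * (K / n * (K * L)) = 4 * n * L * (K / n * r0) ^ 2 := by field_simp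
    rw [e2]
    have : (1:ℝ)/2 ≤ (K / n * r0) ^ 2 := by nlinarith
    have h5 : 0 ≤ n * L := by positivity
    nlinarith
  rw [← mul_div_assoc, div_le_iff₀ hr00]
  linarith


/-- Theorem 4 of the paper: maximal expected regret bound for the sequential elimination
policy `π̃` (Policy 3) under incompatibility constraints. The treatments `{1,…,K}` are
partitioned into `m ≥ 2` groups by `g`, `M_K = ∪_j M_{A_j,K}` consists of weight vectors
supported in a single group, and `M_K^n = ∪_j M^n_{A_j,K}` is a finite discretization
with a nonempty part in each group. For every `n ≥ 2K`,
`sup_F E[r_n(π̃, M_K)] ≤ ε(n) + 4C√(K/n)·D_{n,K} + 4C·K^{1−3η/(4+2η)}/√n·(1+18.5/η)²`,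
where `D_{n,K} = min(√(K log(17K)), √(log(3.01·K(n+2))))` and the supremum is over all
outcome distributions `F¹,…,F^K ∈ D` (the potential outcome vectors being i.i.d. with
`i`-th marginal cdf `F^i`). -/
theorem sequential_elimination_regret_bound
    (a b : ℝ) (hab : a < b)
    (T : (ℝ → ℝ) → ℝ) (D : Set (ℝ → ℝ)) (hDne : D.Nonempty)
    (hDcdf : ∀ F ∈ D, IsCdfOn a b F) (hDconv : Convex ℝ D)
    (C : ℝ) (hC : 0 < C) (hLip : LipschitzAssumption a b T D C)
    (hTmeas : MeasurabilityAssumption a b T)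
    (K m n : ℕ) (hm : 2 ≤ m) (hn : 2 * K ≤ n)
    (g : Fin K → Fin m) (hg : Function.Surjective g)
    (M : Set (Fin K → ℝ)) (hMsub : M ⊆ stdSimplex ℝ (Fin K)) (hMclosed : IsClosed M)
    (hM2 : M.Nontrivial)
    (hMgrouped : ∀ δ ∈ M, ∃ j, GroupSupported g j δ)
    (hMgroupne : ∀ j, ∃ δ ∈ M, GroupSupported g j δ)
    (Mn : Finset (Fin K → ℝ)) (hMnsub : (Mn : Set (Fin K → ℝ)) ⊆ M)
    (hMngroupne : ∀ j, ∃ δ ∈ Mn, GroupSupported g j δ)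
    (R : Finset ℕ) (hR : ∀ r ∈ R, 1 ≤ r ∧ r ≤ n / 2)
    (η : ℝ) (hη : 0 < η)
    (F : Fin K → ℝ → ℝ) (hF : ∀ i, F i ∈ D)
    (ν : ProbabilityMeasure (Fin K → ℝ))
    (hmarg : ∀ (i : Fin K) (x : ℝ),
      (ν : Measure (Fin K → ℝ)) {y | y i ≤ x} = ENNReal.ofReal (F i x)) :
    ∫ ω : Fin n → Fin K → ℝ,
        (sSup ((fun δ => T (mix δ F)) '' M)
          - T (mix (seRecommendation g T C η n R Mn (Yext ω)) F))
      ∂(Measure.pi fun _ : Fin n => (ν : Measure (Fin K → ℝ)))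
    ≤ epsOpt T D M Mn
        + 4 * C * Real.sqrt ((K : ℝ) / n)
            * min (Real.sqrt (K * Real.log (17 * K)))
                (Real.sqrt (Real.log (3.01 * (K * (n + 2)))))
        + 4 * C * ((K : ℝ) ^ ((1 : ℝ) - 3 * η / (4 + 2 * η)) / Real.sqrt n)
            * (1 + 18.5 / η) ^ 2 := by
  have hK2 : 2 ≤ K := by
    have := Fintype.card_le_of_surjective g hg
    simp only [Fintype.card_fin] at this
    omega
  have hK' : (2:ℝ) ≤ K := by exact_mod_cast hK2
  have hn' : 2 * (K:ℝ) ≤ n := by exact_mod_cast hn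
  have hn0 : (0:ℝ) < n := by linarith
  have hsn := Real.sqrt_pos.2 hn0
  have hη18 : 0 < 18.5 / η := by positivity
  set E2 : ℝ := 4 * ((K : ℝ) ^ ((1 : ℝ) - 3 * η / (4 + 2 * η)) / Real.sqrt n) * (1 + 18.5 / η) ^ 2
    with hE2
  set Dn : ℝ := min (Real.sqrt (K * Real.log (17 * K)))
                (Real.sqrt (Real.log (3.01 * (K * (n + 2))))) with hDn
  set E1 : ℝ := 4 * Real.sqrt ((K : ℝ) / n) * Dn with hE1
  have hE20 : 0 ≤ E2 := by positivity
  have hDn0 : 0 ≤ Dn := le_min (Real.sqrt_nonneg _) (Real.sqrt_nonneg _)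
  have hE10 : 0 ≤ E1 := by positivity
  have hrhs : epsOpt T D M Mn + 4 * C * Real.sqrt ((K : ℝ) / n) * Dn
        + 4 * C * ((K : ℝ) ^ ((1 : ℝ) - 3 * η / (4 + 2 * η)) / Real.sqrt n) * (1 + 18.5 / η) ^ 2
      = epsOpt T D M Mn + C * E2 + C * E1 := by rw [hE1, hE2]; ring
  rw [hrhs]
  by_cases hbig : 1 ≤ E1 ∨ 1 ≤ E2
  · refine (core_triv hDcdf hDconv hC hLip hm hn g hg M hMsub hMgrouped Mn hMnsub hMngroupne R hR η
      F hF (ν : Measure (Fin K → ℝ)) hmarg).trans ?_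
    rcases hbig with h | h <;> nlinarith [mul_nonneg hC.le hE10, mul_nonneg hC.le hE20]
  push Not at hbig
  obtain ⟨hs1, hs2⟩ := hbig
  have hD35 : 3.5 ≤ Dn ^ 2 := by
    have hlog : (3.5:ℝ) ≤ Real.log 34 := by
      rw [Real.le_log_iff_exp_le (by norm_num)]
      have h3' : Real.exp 3.5 ^ 2 ≤ (34:ℝ) ^ 2 := by
        rw [← Real.exp_nat_mul, show ((2:ℕ):ℝ) * 3.5 = ((7:ℕ):ℝ) * 1 by norm_num, Real.exp_nat_mul]
        have he := Real.exp_one_lt_d9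
        calc Real.exp 1 ^ 7 ≤ (2.72:ℝ) ^ 7 := by gcongr; linarith
          _ ≤ _ := by norm_num
      exact le_of_pow_le_pow_left₀ (by norm_num) (by norm_num) h3'
    have hmin : Real.sqrt 3.5 ≤ Dn := by
      refine le_min (Real.sqrt_le_sqrt ?_) (Real.sqrt_le_sqrt ?_)
      · have : Real.log 34 ≤ Real.log (17 * K) := Real.log_le_log (by norm_num) (by linarith)
        nlinarith
      · refine hlog.trans (Real.log_le_log (by norm_num) ?_)
        nlinarith
    calc (3.5:ℝ) = Real.sqrt 3.5 ^ 2 := (Real.sq_sqrt (by norm_num)).symm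
      _ ≤ _ := by gcongr
  have hn56 : 56 * (K:ℝ) ≤ n := by
    have h1 : E1 ^ 2 ≤ 1 := by nlinarith
    have h2 : E1 ^ 2 = 16 * ((K:ℝ) / n) * Dn ^ 2 := by
      rw [hE1, mul_pow, mul_pow, Real.sq_sqrt (by positivity)]; ring
    have h3 : 16 * ((K:ℝ) / n) * 3.5 ≤ 1 := by
      refine le_trans ?_ (h2 ▸ h1)
      gcongr
    have h4 : 16 * ((K:ℝ) / n) * 3.5 = 56 * K / n := by ring
    rw [h4, div_le_one hn0] at h3
    exact h3
  obtain ⟨Nb, ρ, hρ1, hρ, hs, hsum⟩ := elim_total η hη n K hK2 hn56 hs2 R (fun r hr => (hR r hr).1)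
  have hr0 : (n:ℝ) / K - 1 ≤ ((n / K : ℕ) : ℝ) := by
    have := Nat.lt_floor_add_one ((n:ℝ) / K)
    rw [Nat.floor_div_natCast, Nat.floor_natCast] at this
    linarith
  have hr1 : 1 ≤ n / K := Nat.div_pos (by omega) (by omega)
  have hFr := marg_real hDcdf hF (ν : Measure (Fin K → ℝ)) hmarg
  have hfin : ∃ Bf : ℝ, 0 ≤ Bf ∧ 2 * Bf ≤ E1 ∧
      ∃ G : (Fin K → List ℝ) → ENNReal, SupG (ν : Measure (Fin K → ℝ)) G ∧
      (∀ ℓ i, n / K ≤ (ℓ i).length → (ℓ i).length ≤ n →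
        ENNReal.ofReal (supDist (F i) (empL (ℓ i))) ≤ G ℓ) ∧
      G (fun _ => []) ≤ ENNReal.ofReal Bf := by
    rcases min_choice (Real.sqrt (K * Real.log (17 * K)))
                (Real.sqrt (Real.log (3.01 * (K * (n + 2))))) with h | h
    · refine ⟨_, by positivity, ?_, fin_G2 (ν : Measure (Fin K → ℝ)) F hFr n (n / K) (by omega) hr1
        (Nat.div_le_self _ _)⟩
      rw [hE1, hDn, h]
      exact fin_num2 n K _ hK' hn56 hr0
    · refine ⟨_, Real.sqrt_nonneg _, ?_, fin_G1 (ν : Measure (Fin K → ℝ)) F hFr n (n / K) (by omega) hr1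
        (Nat.div_le_self _ _)⟩
      rw [hE1, hDn, h]
      exact fin_num1 n K _ hK' hn56 hr0
  obtain ⟨Bf, hBf0, hBfE, hG⟩ := hfin
  refine (core hDcdf hDconv hC hLip hm hn g hg M hMsub hMgrouped Mn hMnsub hMngroupne R hR η
      F hF (ν : Measure (Fin K → ℝ)) hmarg Nb ρ hρ1 hρ (fun r => sEta η r n K) hs
      (fun r _ => rfl) Bf hBf0 hG).trans ?_
  have e1 : ∑ r ∈ R, (K:ℝ) ^ 2 * (C * elimB (1 + 16 * Nb) ρ (sEta η r n K) r)
      = C * ∑ r ∈ R, (K:ℝ) ^ 2 * elimB (1 + 16 * Nb) ρ (sEta η r n K) r := by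
    rw [Finset.mul_sum]
    exact Finset.sum_congr rfl fun r _ => by ring
  simp only [e1]
  have := mul_le_mul_of_nonneg_left hsum hC.le
  have := mul_le_mul_of_nonneg_left hBfE hC.le
  linarith

end TRDT
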